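/- Let p be a prime number and R a regular local F_p-algebra. Then for all r, m ≥ 1 the map induced by multiplication by p, U^m K^M_r(R((T)))/U^{m+1}K^M_r(R((T))) → U^{pm} K^M_r(R((T)))/U^{pm+1}K^M_r(R((T))), is injective. -/

import Mathlib

/-!
# Statement 17 (Rülling–Saito, Corollary `cor-mult-p-gradedK`)

Let `p` be a prime and `R` a regular local `𝔽_p`-algebra.  Then for all `r, m ≥ 1` the
map induced by multiplication by `p`,
`U^m K^M_r(R((T)))/U^{m+1}K^M_r(R((T))) → U^{pm} K^M_r(R((T)))/U^{pm+1}K^M_r(R((T)))`,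
is injective.

Here `R((T)) = R[[T]][1/T]` is realised as the ring `LaurentSeries R`, the Milnor K-groups
are defined concretely below, and `U^m K^M_r(R((T)))` is the subgroup generated by symbols
`{1+xT^m, y_1,…,y_{r−1}}` with `x ∈ R[[T]]`, `y_i ∈ R((T))^×`.  Regularity of the local
ring `R` is expressed by the existence of a system of parameters generating the maximal
ideal whose length equals the Krull dimension.  Injectivity of the induced map on the
quotients is expressed equivalently: multiplication by `p` maps `U^m` into `U^{pm}`, and
any `x ∈ U^m` with `p·x ∈ U^{pm+1}` lies in `U^{m+1}`.
-/

open scoped Classical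

namespace RuellingSaito

/-- The subgroup of relations defining the `r`-th Milnor K-group of a commutative ring `F`. -/
def milnorRel (F : Type) [CommRing F] (r : ℕ) :
    AddSubgroup (FreeAbelianGroup (Fin r → Fˣ)) :=
  AddSubgroup.closure
    ({x | ∃ (a b : Fin r → Fˣ) (i : Fin r), (∀ j, j ≠ i → a j = b j) ∧
        x = FreeAbelianGroup.of (Function.update a i (a i * b i)) -
            FreeAbelianGroup.of a - FreeAbelianGroup.of b} ∪
     {x | ∃ (a : Fin r → Fˣ) (i j : Fin r), (i : ℕ) + 1 = (j : ℕ) ∧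
        ((a i : F) + (a j : F) = 1) ∧ x = FreeAbelianGroup.of a})

/-- The `r`-th Milnor K-group of a commutative ring `F`. -/
abbrev MilnorK (r : ℕ) (F : Type) [CommRing F] : Type :=
  FreeAbelianGroup (Fin r → Fˣ) ⧸ milnorRel F r

/-- The Milnor symbol `{a 0, …, a (r-1)}`. -/
def MilnorK.symbol {F : Type} [CommRing F] {r : ℕ} (a : Fin r → Fˣ) : MilnorK r F :=
  QuotientAddGroup.mk (FreeAbelianGroup.of a)

/-- The subgroup `U^m K^M_r(R((T)))` of `K^M_r(R((T)))` generated by the symbols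
`{1 + x·T^m, y_1,…,y_{r−1}}` with `x ∈ R[[T]]` and `y_i ∈ R((T))^×`. -/
noncomputable def UT (R : Type) [CommRing R] (m r : ℕ) : AddSubgroup (MilnorK r (LaurentSeries R)) :=
  AddSubgroup.closure
    {z | ∃ (hr : 0 < r) (a : Fin r → (LaurentSeries R)ˣ) (x : PowerSeries R),
      (a ⟨0, hr⟩ : LaurentSeries R) =
        1 + HahnSeries.ofPowerSeries ℤ R x * HahnSeries.single (m : ℤ) (1 : R) ∧
      z = MilnorK.symbol a}

section

open MvPolynomial

section PowerRelations
variable {A : Type} [CommRing A] {κ : Type}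

/-- The ideal of `A[Y]` generated by the relations `Y_k ^ p = a_k`. -/
noncomputable def relIdeal (p : ℕ) (a : κ → A) : Ideal (MvPolynomial κ A) :=
  Ideal.span (Set.range fun k => X k ^ p - C (a k))

theorem X_pow_sub_mem_relIdeal (p : ℕ) (a : κ → A) (k : κ) :
    X k ^ p - C (a k) ∈ relIdeal p a :=
  Ideal.subset_span ⟨k, rfl⟩

/-- Reduction of a monomial modulo the relations `Y_k ^ p = a_k`. -/
noncomputable def normalForm (p : ℕ) (a : κ → A) : MvPolynomial κ A →ₗ[A] MvPolynomial κ A :=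
  (basisMonomials κ A).constr A fun w =>
    monomial (w.mapRange (· % p) (Nat.zero_mod p)) (w.prod fun k n => a k ^ (n / p))

theorem normalForm_monomial (p : ℕ) (a : κ → A) (w : κ →₀ ℕ) (c : A) :
    normalForm p a (monomial w c) =
      monomial (w.mapRange (· % p) (Nat.zero_mod p)) (c * w.prod fun k n => a k ^ (n / p)) := by
  have h : (monomial w c : MvPolynomial κ A) = c • basisMonomials κ A w := by
    simp [smul_monomial]
  rw [h, map_smul, normalForm, Module.Basis.constr_basis, smul_monomial, smul_eq_mul]

theorem X_pow_sub_C_pow_mem_relIdeal (p : ℕ) (a : κ → A) (k : κ) (n : ℕ) :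
    X k ^ n - C (a k ^ (n / p)) * X k ^ (n % p) ∈ relIdeal p a := by
  have h1 : (X k ^ n : MvPolynomial κ A) = (X k ^ p) ^ (n / p) * X k ^ (n % p) := by
    rw [← pow_mul, ← pow_add, Nat.div_add_mod]
  rw [h1, C_pow, ← sub_mul]
  exact Ideal.mul_mem_right _ _
    (Ideal.mem_of_dvd _ (sub_dvd_pow_sub_pow _ _ _) (X_pow_sub_mem_relIdeal p a k))

theorem sub_normalForm_mem (p : ℕ) (a : κ → A) (f : MvPolynomial κ A) :
    f - normalForm p a f ∈ relIdeal p a := by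
  induction f using MvPolynomial.induction_on' with
  | add f g hf hg =>
    rw [map_add, add_sub_add_comm]; exact Ideal.add_mem _ hf hg
  | monomial w c =>
    rw [normalForm_monomial, ← Ideal.Quotient.eq, ← mul_one c, ← C_mul_monomial,
      mul_one, ← C_mul_monomial, map_mul, map_mul]
    congr 1
    have h2 : (monomial (w.mapRange (· % p) (Nat.zero_mod p))
        (w.prod fun k n => a k ^ (n / p)) : MvPolynomial κ A) =
        w.prod fun k n => C (a k ^ (n / p)) * X k ^ (n % p) := by
      rw [Finsupp.prod_mul, monomial_eq]
      congr 1
      · simp [Finsupp.prod, map_prod]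
      · rw [Finsupp.prod_mapRange_index (by simp)]
    rw [h2, monomial_eq, C_1, one_mul, Finsupp.prod, Finsupp.prod, map_prod, map_prod]
    refine Finset.prod_congr rfl fun k _ => ?_
    rw [Ideal.Quotient.eq]
    exact X_pow_sub_C_pow_mem_relIdeal p a k _

theorem normalForm_eq_zero_of_mem {p : ℕ} (hp : 0 < p) (a : κ → A) {f : MvPolynomial κ A}
    (hf : f ∈ relIdeal p a) : normalForm p a f = 0 := by
  classical
  have key : ∀ (k : κ) (g : MvPolynomial κ A),
      normalForm p a (g * (X k ^ p - C (a k))) = 0 := by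
    intro k g
    induction g using MvPolynomial.induction_on' with
    | add f g hf hg => rw [add_mul, map_add, hf, hg, add_zero]
    | monomial w c =>
      rw [mul_sub, map_sub, sub_eq_zero, X_pow_eq_monomial, monomial_mul, mul_comm _ (C _),
        C_mul_monomial, normalForm_monomial, normalForm_monomial]
      refine congrArg₂ (fun u v => monomial u v) ?_ ?_
      · ext j
        by_cases hj : k = j
        · subst hj; simp
        · simp [hj]
      · rw [mul_one, mul_comm (a k), mul_assoc]
        congr 1
        have hw : ∀ v : κ →₀ ℕ, v.prod (fun k n => a k ^ (n / p)) =
            ∏ j ∈ insert k w.support ∪ v.support, a j ^ (v j / p) := fun v =>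
          Finsupp.prod_of_support_subset _ Finset.subset_union_right _ (by simp)
        have hw' : w.prod (fun k n => a k ^ (n / p)) =
            ∏ j ∈ insert k w.support ∪ (w + Finsupp.single k p).support, a j ^ (w j / p) :=
          Finsupp.prod_of_support_subset _
            ((Finset.subset_insert _ _).trans Finset.subset_union_left) _ (by simp)
        rw [hw, hw', ← Finset.mul_prod_erase _ _
            (Finset.mem_union_left _ (Finset.mem_insert_self k _)),
          ← Finset.mul_prod_erase (a := k) _ (fun j => a j ^ (w j / p))
            (Finset.mem_union_left _ (Finset.mem_insert_self k _)), ← mul_assoc]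
        congr 1
        · simp [Nat.add_div_right _ hp, pow_succ, mul_comm]
        · refine Finset.prod_congr rfl fun j hj => ?_
          rw [Finsupp.add_apply, Finsupp.single_apply, if_neg (Finset.ne_of_mem_erase hj).symm,
            add_zero]
  have hall : ∀ g, normalForm p a (g * f) = 0 := by
    refine Submodule.span_induction (p := fun f _ => ∀ g, normalForm p a (g * f) = 0)
      ?_ ?_ ?_ ?_ hf
    · rintro _ ⟨k, rfl⟩ g
      exact key k g
    · simp
    · intro x y _ _ hx hy g
      rw [mul_add, map_add, hx, hy, add_zero]
    · intro b x _ hx g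
      rw [smul_eq_mul, ← mul_assoc, hx]
  simpa using hall 1

theorem normalForm_degree_lt {p : ℕ} (hp : 0 < p) (a : κ → A) (f : MvPolynomial κ A)
    {w : κ →₀ ℕ} (hw : w ∈ (normalForm p a f).support) (k : κ) : w k < p := by
  classical
  induction f using MvPolynomial.induction_on' with
  | monomial v c =>
    rw [normalForm_monomial] at hw
    have := support_monomial_subset hw
    rw [Finset.mem_singleton] at this
    rw [this, Finsupp.mapRange_apply]
    exact Nat.mod_lt _ hp
  | add f g hf hg =>
    rw [map_add] at hw
    rcases Finset.mem_union.1 (support_add hw) with h | h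
    · exact hf h
    · exact hg h

theorem linearMap_mem_map_C {σ τ : Type} (J : Ideal A) (L : MvPolynomial σ A →ₗ[A] MvPolynomial τ A)
    {f : MvPolynomial σ A} (hf : f ∈ J.map (C : A →+* MvPolynomial σ A)) :
    L f ∈ J.map (C : A →+* MvPolynomial τ A) := by
  rw [mem_map_C_iff] at hf
  rw [← support_sum_monomial_coeff f, map_sum]
  refine Ideal.sum_mem _ fun m _ => ?_
  rw [← mul_one (coeff m f), ← smul_eq_mul, ← smul_monomial, map_smul, smul_eq_C_mul]
  exact Ideal.mul_mem_right _ _ (Ideal.mem_map_of_mem _ (hf m))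

theorem mem_relIdeal_sup_iff {p : ℕ} (hp : 0 < p) (a : κ → A) (J : Ideal A)
    (f : MvPolynomial κ A) : f ∈ relIdeal p a ⊔ J.map C ↔ normalForm p a f ∈ J.map C := by
  constructor
  · intro h
    obtain ⟨g, hg, j, hj, rfl⟩ := Submodule.mem_sup.1 h
    rw [map_add, normalForm_eq_zero_of_mem hp a hg, zero_add]
    exact linearMap_mem_map_C J _ hj
  · intro h
    rw [← sub_add_cancel f (normalForm p a f)]
    exact Ideal.add_mem _ (Ideal.mem_sup_left (sub_normalForm_mem p a f)) (Ideal.mem_sup_right h)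

theorem mem_relIdeal_sup_of_C_mul_mem {p : ℕ} (hp : 0 < p) (a : κ → A) (q : Ideal A) [q.IsPrime]
    {c : A} (hc : c ∉ q) {f : MvPolynomial κ A} (h : C c * f ∈ relIdeal p a ⊔ q.map C) :
    f ∈ relIdeal p a ⊔ q.map C := by
  rw [mem_relIdeal_sup_iff hp] at h ⊢
  rw [← smul_eq_C_mul, map_smul, mem_map_C_iff] at h
  rw [mem_map_C_iff]
  intro m
  have := h m
  rw [coeff_smul, smul_eq_mul] at this
  exact (Ideal.IsPrime.mem_or_mem ‹_› this).resolve_left hc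

/-- Modulo `Y_k ^ p = a_k` every `p`-th power is a constant. -/
theorem exists_pow_sub_C_mem_relIdeal (p : ℕ) [Fact p.Prime] [CharP A p] (a : κ → A)
    (f : MvPolynomial κ A) : ∃ c : A, f ^ p - C c ∈ relIdeal p a := by
  have : ExpChar (MvPolynomial κ A) p := ExpChar.prime Fact.out
  induction f using MvPolynomial.induction_on with
  | C c => exact ⟨c ^ p, by simp⟩
  | add f g hf hg =>
    obtain ⟨c, hc⟩ := hf
    obtain ⟨d, hd⟩ := hg
    refine ⟨c + d, ?_⟩
    rw [add_pow_expChar, C_add, add_sub_add_comm]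
    exact Ideal.add_mem _ hc hd
  | mul_X f k hf =>
    obtain ⟨c, hc⟩ := hf
    refine ⟨c * a k, ?_⟩
    have := X_pow_sub_mem_relIdeal p a k
    rw [← Ideal.Quotient.eq] at hc this ⊢
    rw [mul_pow, C_mul, map_mul, map_mul, hc, this]

variable {R : Type} [CommRing R] [Algebra A R]

theorem aeval_eq_zero_of_mem_relIdeal {p : ℕ} {a : κ → A} {y : κ → R}
    (h : ∀ k, algebraMap A R (a k) = y k ^ p) {f : MvPolynomial κ A} (hf : f ∈ relIdeal p a) :
    aeval y f = 0 := by
  have : relIdeal p a ≤ RingHom.ker (aeval y : MvPolynomial κ A →ₐ[A] R) := by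
    rw [relIdeal, Ideal.span_le]
    rintro _ ⟨k, rfl⟩
    simp [h]
  exact this hf

theorem aeval_mem_map {J : Ideal A} {y : κ → R} {f : MvPolynomial κ A} (hf : f ∈ J.map C) :
    aeval y f ∈ J.map (algebraMap A R) := by
  have := Ideal.mem_map_of_mem (aeval y : MvPolynomial κ A →ₐ[A] R).toRingHom hf
  rw [Ideal.map_map] at this
  have h : (aeval y : MvPolynomial κ A →ₐ[A] R).toRingHom.comp C = algebraMap A R := by
    ext; simp
  rwa [h] at this

theorem bind₁_mem_map_C {τ : Type} {J : Ideal A} {f : MvPolynomial κ A} (hf : f ∈ J.map C)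
    (h : κ → MvPolynomial τ A) : bind₁ h f ∈ J.map C :=
  linearMap_mem_map_C J (bind₁ h).toLinearMap hf

theorem bind₁_sub_bind₁_mem {τ : Type} {I : Ideal (MvPolynomial τ A)}
    {h h' : κ → MvPolynomial τ A} (hh : ∀ k, h k - h' k ∈ I) (f : MvPolynomial κ A) :
    bind₁ h f - bind₁ h' f ∈ I := by
  simp only [← Ideal.Quotient.eq] at hh ⊢
  induction f using MvPolynomial.induction_on with
  | C c => simp
  | add f g hf hg => simp [hf, hg]
  | mul_X f k hf => simp [hf, hh]

theorem aeval_sub_aeval_mem {I : Ideal R} {y y' : κ → R} (hh : ∀ k, y k - y' k ∈ I)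
    (f : MvPolynomial κ A) : aeval y f - aeval y' f ∈ I := by
  simp only [← Ideal.Quotient.eq] at hh ⊢
  induction f using MvPolynomial.induction_on with
  | C c => simp
  | add f g hf hg => simp [hf, hg]
  | mul_X f k hf => simp [hf, hh]

theorem bind₁_mem_relIdeal {τ : Type} {p : ℕ} [Fact p.Prime] [CharP A p]
    (hinj : Function.Injective (algebraMap A R)) {a : κ → A} {b : τ → A} {y : κ → R} {z : τ → R}
    (ha : ∀ k, algebraMap A R (a k) = y k ^ p) (hb : ∀ k, algebraMap A R (b k) = z k ^ p)
    {h : κ → MvPolynomial τ A} (hy : ∀ k, y k = aeval z (h k))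
    {f : MvPolynomial κ A} (hf : f ∈ relIdeal p a) : bind₁ h f ∈ relIdeal p b := by
  have : relIdeal p a ≤ (relIdeal p b).comap (bind₁ h : MvPolynomial κ A →ₐ[A] MvPolynomial τ A) := by
    rw [relIdeal, Ideal.span_le]
    rintro _ ⟨k, rfl⟩
    obtain ⟨c, hc⟩ := exists_pow_sub_C_mem_relIdeal p b (h k)
    have h0 := aeval_eq_zero_of_mem_relIdeal hb hc
    have : c = a k := by
      apply hinj
      rw [ha, hy]
      simpa [sub_eq_zero, eq_comm (a := (0 : R))] using (sub_eq_zero.1 (by simpa using h0)).symm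
    rw [this] at hc
    simpa using hc
  exact this hf

theorem exists_homogenize {σ : Type} (c : A) (g : MvPolynomial σ A) :
    ∃ (N : ℕ) (h : MvPolynomial σ A), bind₁ (fun i => C c * X i) h = C (c ^ N) * g := by
  induction g using MvPolynomial.induction_on with
  | C d => exact ⟨0, C d, by simp⟩
  | add f g hf hg =>
    obtain ⟨M, u, hu⟩ := hf
    obtain ⟨N, v, hv⟩ := hg
    refine ⟨M + N, C (c ^ N) * u + C (c ^ M) * v, ?_⟩
    rw [map_add, map_mul, map_mul, hu, hv, bind₁_C_right, bind₁_C_right]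
    simp only [pow_add, C_mul]; ring
  | mul_X f i hf =>
    obtain ⟨M, u, hu⟩ := hf
    refine ⟨M + 1, u * X i, ?_⟩
    rw [map_mul, hu, bind₁_X_right]
    simp only [pow_add, C_mul, pow_one]; ring

end PowerRelations

section Desingularization
variable {A R : Type} [CommRing A] [CommRing R] [Algebra A R]

/-- Solutions in `R` modulo `J` of polynomial equations over `A` come from solutions
in algebras `A[Y] / (Y ^ p - a)`. -/
def LiftsModulo (R : Type) {A : Type} [CommRing A] [CommRing R] [Algebra A R]
    (p : ℕ) (J : Ideal A) : Prop :=
  ∀ (ι : Type) [Finite ι] (x : ι → R) (G : Set (MvPolynomial ι A)),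
    (∀ g ∈ G, aeval x g ∈ J.map (algebraMap A R)) →
    ∃ (κ : Type) (_ : Finite κ) (y : κ → R) (a : κ → A) (f : ι → MvPolynomial κ A),
      (∀ k, algebraMap A R (a k) = y k ^ p) ∧ (∀ i, x i = aeval y (f i)) ∧
      ∀ g ∈ G, bind₁ f g ∈ relIdeal p a ⊔ J.map C

/-- The description of the fibre of `A → R` at the prime `q` by a finite number of
elements which are `p`-independent modulo `q`. -/
def FibreCondition (R : Type) {A : Type} [CommRing A] [CommRing R] [Algebra A R]
    (p : ℕ) (q : Ideal A) : Prop :=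
  ∀ (ι : Type) [Finite ι] (x : ι → R),
    ∃ (κ : Type) (_ : Finite κ) (y : κ → R) (b : κ → A) (c : A) (F : ι → MvPolynomial κ A),
      (∀ k, algebraMap A R (b k) = y k ^ p) ∧ c ∉ q ∧
      (∀ i, algebraMap A R c * x i - aeval y (F i) ∈ q.map (algebraMap A R)) ∧
      ∀ g : MvPolynomial κ A, aeval y g ∈ q.map (algebraMap A R) → g ∈ relIdeal p b ⊔ q.map C

theorem rename_mem_relIdeal_sup {κ τ : Type} {p : ℕ} {J : Ideal A} {a : κ → A} {b : τ → A}
    (e : κ → τ) (hab : ∀ k, b (e k) = a k) {f : MvPolynomial κ A}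
    (hf : f ∈ relIdeal p a ⊔ J.map C) : rename e f ∈ relIdeal p b ⊔ J.map C := by
  obtain ⟨i, hi, j, hj, rfl⟩ := Submodule.mem_sup.1 hf
  rw [map_add]
  refine Ideal.add_mem _ (Ideal.mem_sup_left ?_)
    (Ideal.mem_sup_right (linearMap_mem_map_C J (rename e).toLinearMap hj))
  have : relIdeal p a ≤
      (relIdeal p b).comap (rename e : MvPolynomial κ A →ₐ[A] MvPolynomial τ A) := by
    rw [relIdeal, Ideal.span_le]
    rintro _ ⟨k, rfl⟩
    have := X_pow_sub_mem_relIdeal p b (e k)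
    rw [hab] at this
    simpa using this
  exact this hi

theorem LiftsModulo.of_approx [IsNoetherianRing A] {p : ℕ} [Fact p.Prime] [CharP A p]
    (hpow : ∀ x : R, ∃ a : A, algebraMap A R a = x ^ p) (J : Ideal A)
    (ι : Type) [Finite ι] (x : ι → R) (G : Set (MvPolynomial ι A))
    (H : ∃ (κ : Type) (_ : Finite κ) (y : κ → R) (a : κ → A) (f : ι → MvPolynomial κ A),
      (∀ k, algebraMap A R (a k) = y k ^ p) ∧
      (∀ i, x i - aeval y (f i) ∈ J.map (algebraMap A R)) ∧
      ∀ g ∈ G, bind₁ f g ∈ relIdeal p a ⊔ J.map C) :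
    ∃ (κ : Type) (_ : Finite κ) (y : κ → R) (a : κ → A) (f : ι → MvPolynomial κ A),
      (∀ k, algebraMap A R (a k) = y k ^ p) ∧ (∀ i, x i = aeval y (f i)) ∧
      ∀ g ∈ G, bind₁ f g ∈ relIdeal p a ⊔ J.map C := by
  obtain ⟨κ, _, y, a, f, ha, hx, hG⟩ := H
  obtain ⟨n, s, hs⟩ := Submodule.fg_iff_exists_fin_generating_family.1 (IsNoetherian.noetherian J)
  have hz : ∀ i, ∃ z : Fin n → R, x i - aeval y (f i) = ∑ k, z k * algebraMap A R (s k) := by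
    intro i
    have := hx i
    rw [← hs, ← Ideal.span, Ideal.map_span, ← Set.range_comp, Ideal.mem_span_range_iff_exists_fun] at this
    obtain ⟨z, hz⟩ := this
    exact ⟨z, hz.symm⟩
  choose z hz using hz
  choose b hb using fun ik : ι × Fin n => hpow (z ik.1 ik.2)
  refine ⟨κ ⊕ (ι × Fin n), inferInstance, Sum.elim y (fun ik => z ik.1 ik.2), Sum.elim a b,
    fun i => rename Sum.inl (f i) + ∑ k, X (Sum.inr (i, k)) * C (s k), ?_, ?_, ?_⟩
  · rintro (k | k)
    · exact ha k
    · exact hb k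
  · intro i
    rw [map_add, aeval_rename, Sum.elim_comp_inl, map_sum]
    simp only [map_mul, aeval_X, Sum.elim_inr, aeval_C]
    rw [← hz i]; ring
  · intro g hg
    have h1 : bind₁ (fun i => rename (Sum.inl : κ → κ ⊕ (ι × Fin n)) (f i)) g ∈
        relIdeal p (Sum.elim a b) ⊔ J.map C := by
      have h3 := rename_mem_relIdeal_sup (b := Sum.elim a b) (Sum.inl : κ → κ ⊕ (ι × Fin n))
        (fun k => rfl) (hG g hg)
      rwa [rename_bind₁] at h3
    rw [← sub_add_cancel (bind₁ _ g) (bind₁ (fun i => rename (Sum.inl : κ → κ ⊕ (ι × Fin n)) (f i)) g)]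
    refine Ideal.add_mem _ (Ideal.mem_sup_right (bind₁_sub_bind₁_mem (fun i => ?_) g)) h1
    rw [add_sub_cancel_left]
    refine Ideal.sum_mem _ fun k _ => Ideal.mul_mem_left _ _ (Ideal.mem_map_of_mem _ ?_)
    rw [← hs]
    exact Submodule.subset_span ⟨k, rfl⟩

theorem Ideal.mem_sup_span_singleton_iff {B : Type} [CommRing B] {I : Ideal B} {x a : B} :
    x ∈ I ⊔ Ideal.span {a} ↔ ∃ e, x - e * a ∈ I := by
  constructor
  · intro h
    obtain ⟨i, hi, j, hj, rfl⟩ := Submodule.mem_sup.1 h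
    obtain ⟨e, rfl⟩ := Ideal.mem_span_singleton'.1 hj
    exact ⟨e, by simpa using hi⟩
  · rintro ⟨e, he⟩
    rw [← sub_add_cancel x (e * a)]
    exact Ideal.add_mem _ (Ideal.mem_sup_left he)
      (Ideal.mem_sup_right (Ideal.mul_mem_left _ _ (Ideal.mem_span_singleton_self a)))

theorem LiftsModulo.top (p : ℕ)
    (hpow : ∀ x : R, ∃ a : A, algebraMap A R a = x ^ p) : LiftsModulo R p (⊤ : Ideal A) := by
  intro ι _ x G _
  choose a ha using fun i => hpow (x i)
  refine ⟨ι, inferInstance, x, a, X, ha, by simp, fun g _ => ?_⟩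
  rw [Ideal.map_top, sup_top_eq]; trivial

theorem LiftsModulo.of_mul_mem {p : ℕ} [Fact p.Prime] [CharP A p]
    (hinj : Function.Injective (algebraMap A R))
    (hcolon : ∀ (J : Ideal A) (a : A) (r : R), algebraMap A R a * r ∈ J.map (algebraMap A R) →
      r ∈ (J.colon {a}).map (algebraMap A R))
    {J : Ideal A} (a : A) (h1 : LiftsModulo R p (J ⊔ Ideal.span {a}))
    (h2 : LiftsModulo R p (J.colon {a})) : LiftsModulo R p J := by
  intro ι _ x G hG
  obtain ⟨κ, _, u, b, f, hb, hx, hf⟩ := h1 ι x G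
    fun g hg => Ideal.map_mono le_sup_left (hG g hg)
  have he : ∀ g ∈ G, ∃ e, bind₁ f g - C a * e ∈ relIdeal p b ⊔ J.map C := by
    intro g hg
    have := hf g hg
    rw [Ideal.map_sup, ← sup_assoc, Ideal.map_span, Set.image_singleton,
      Ideal.mem_sup_span_singleton_iff] at this
    obtain ⟨e, he⟩ := this
    exact ⟨e, by rwa [mul_comm]⟩
  choose! e he using he
  obtain ⟨τ, _, w, d, h, hd, hu, hh⟩ := h2 κ u (e '' G) (by
    rintro _ ⟨g, hg, rfl⟩
    apply hcolon
    obtain ⟨i, hi, j, hj, hij⟩ := Submodule.mem_sup.1 (he g hg)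
    have h3 := congrArg (aeval u) hij
    rw [map_add, aeval_eq_zero_of_mem_relIdeal hb hi, zero_add, map_sub, map_mul, aeval_C,
      aeval_bind₁] at h3
    have h4 : (fun i => aeval u (f i)) = x := by funext i; exact (hx i).symm
    rw [h4] at h3
    have h5 : algebraMap A R a * aeval u (e g) = aeval x g - aeval u j := by rw [h3]; ring
    rw [h5]
    exact Ideal.sub_mem _ (hG g hg) (aeval_mem_map hj))
  refine ⟨τ, inferInstance, w, d, fun i => bind₁ h (f i), hd, ?_, ?_⟩
  · intro i
    rw [aeval_bind₁, hx]
    congr 2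
    funext k; exact hu k
  · intro g hg
    rw [← bind₁_bind₁, ← sub_add_cancel (bind₁ f g) (C a * e g), map_add]
    refine Ideal.add_mem _ ?_ ?_
    · obtain ⟨i, hi, j, hj, hij⟩ := Submodule.mem_sup.1 (he g hg)
      rw [← hij, map_add]
      exact Ideal.add_mem _ (Ideal.mem_sup_left (bind₁_mem_relIdeal hinj hb hd hu hi))
        (Ideal.mem_sup_right (bind₁_mem_map_C hj h))
    · rw [map_mul, bind₁_C_right]
      obtain ⟨i, hi, j, hj, hij⟩ := Submodule.mem_sup.1 (hh _ ⟨g, hg, rfl⟩)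
      rw [← hij, mul_add]
      refine Ideal.add_mem _ (Ideal.mem_sup_left (Ideal.mul_mem_left _ _ hi))
        (Ideal.mem_sup_right ?_)
      rw [mem_map_C_iff] at hj ⊢
      intro m
      rw [coeff_C_mul]
      have := hj m
      rw [Submodule.mem_colon_singleton] at this
      rw [mul_comm]
      exact this

theorem LiftsModulo.of_prime [IsNoetherianRing A] {p : ℕ} [Fact p.Prime] [CharP A p]
    (hinj : Function.Injective (algebraMap A R))
    (hpow : ∀ x : R, ∃ a : A, algebraMap A R a = x ^ p)
    (hcolon : ∀ (J : Ideal A) (a : A) (r : R), algebraMap A R a * r ∈ J.map (algebraMap A R) →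
      r ∈ (J.colon {a}).map (algebraMap A R))
    {q : Ideal A} [hq : q.IsPrime] (hfib : FibreCondition R p q)
    (IH : ∀ J, q < J → LiftsModulo R p J) : LiftsModulo R p q := by
  intro ι _ x G hG
  apply LiftsModulo.of_approx hpow
  have hp : 0 < p := (Fact.out : p.Prime).pos
  obtain ⟨κ, _, y, b, c, F, hb, hc, hF, hind⟩ := hfib ι x
  have hlt : q < q ⊔ Ideal.span {c} := by
    refine lt_of_le_of_ne le_sup_left fun h => hc ?_
    rw [h]
    exact Ideal.mem_sup_right (Ideal.mem_span_singleton_self c)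
  obtain ⟨τ, _, u, d, Y, hd, hy, hY⟩ := IH _ hlt κ y (Set.range F) (by
    rintro _ ⟨i, rfl⟩
    rw [← sub_sub_self (algebraMap A R c * x i) (aeval y (F i))]
    refine Ideal.sub_mem _ (Ideal.mul_mem_right _ _ (Ideal.mem_map_of_mem _ ?_))
      (Ideal.map_mono le_sup_left (hF i))
    exact Ideal.mem_sup_right (Ideal.mem_span_singleton_self c))
  have he : ∀ i, ∃ e, bind₁ Y (F i) - C c * e ∈ relIdeal p d ⊔ q.map C := by
    intro i
    have := hY (F i) ⟨i, rfl⟩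
    rw [Ideal.map_sup, ← sup_assoc, Ideal.map_span, Set.image_singleton,
      Ideal.mem_sup_span_singleton_iff] at this
    obtain ⟨e, he⟩ := this
    exact ⟨e, by rwa [mul_comm]⟩
  choose e he using he
  have haev : ∀ f : MvPolynomial τ A, f ∈ relIdeal p d ⊔ q.map C →
      aeval u f ∈ q.map (algebraMap A R) := by
    intro f hf
    obtain ⟨i, hi, j, hj, hij⟩ := Submodule.mem_sup.1 hf
    rw [← hij, map_add, aeval_eq_zero_of_mem_relIdeal hd hi, zero_add]
    exact aeval_mem_map hj
  have hcol : ∀ r : R, algebraMap A R c * r ∈ q.map (algebraMap A R) →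
      r ∈ q.map (algebraMap A R) := by
    intro r hr
    have := hcolon q c r hr
    have h2 : q.colon {c} = q := by
      ext s
      rw [Submodule.mem_colon_singleton, smul_eq_mul]
      exact ⟨fun h => (hq.mem_or_mem h).resolve_right hc, fun h => Ideal.mul_mem_right _ _ h⟩
    rwa [h2] at this
  have hyY : y = fun k => aeval u (Y k) := funext hy
  refine ⟨τ, inferInstance, u, d, e, hd, ?_, ?_⟩
  · intro i
    apply hcol
    have h1 := haev _ (he i)
    rw [map_sub, map_mul, aeval_C, aeval_bind₁, ← hyY] at h1
    have := Ideal.add_mem _ (hF i) h1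
    convert this using 1
    ring
  · intro g hg
    obtain ⟨N, ĝ, hN⟩ := exists_homogenize c g
    have h1 : aeval y (bind₁ F ĝ) ∈ q.map (algebraMap A R) := by
      have h2 := aeval_sub_aeval_mem (fun i => hF i) ĝ
      have h3 := congrArg (aeval x) hN
      rw [aeval_bind₁] at h3
      simp only [map_mul, aeval_C, aeval_X] at h3
      rw [aeval_bind₁]
      rw [h3] at h2
      exact (Submodule.sub_mem_iff_right _ (Ideal.mul_mem_left _ _ (hG g hg))).1 h2
    have h4 : bind₁ Y (bind₁ F ĝ) ∈ relIdeal p d ⊔ q.map C := by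
      obtain ⟨i, hi, j, hj, hij⟩ := Submodule.mem_sup.1 (hind _ h1)
      rw [← hij, map_add]
      exact Ideal.add_mem _ (Ideal.mem_sup_left (bind₁_mem_relIdeal hinj hb hd hy hi))
        (Ideal.mem_sup_right (bind₁_mem_map_C hj Y))
    have hcN : c ^ N ∉ q := fun h => hc (hq.mem_of_pow_mem N h)
    apply mem_relIdeal_sup_of_C_mul_mem hp d q hcN
    have h5 := bind₁_sub_bind₁_mem he ĝ
    rw [← bind₁_bind₁] at h5
    have h6 := (Submodule.sub_mem_iff_right _ h4).1 h5
    have h7 := congrArg (bind₁ e) hN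
    rw [bind₁_bind₁] at h7
    simp only [map_mul, bind₁_C_right, bind₁_X_right] at h7
    rw [map_pow, ← map_pow C] at h7
    rwa [h7] at h6

theorem liftsModulo_of_fibreCondition [IsNoetherianRing A] {p : ℕ} [Fact p.Prime] [CharP A p]
    (hinj : Function.Injective (algebraMap A R))
    (hpow : ∀ x : R, ∃ a : A, algebraMap A R a = x ^ p)
    (hcolon : ∀ (J : Ideal A) (a : A) (r : R), algebraMap A R a * r ∈ J.map (algebraMap A R) →
      r ∈ (J.colon {a}).map (algebraMap A R))
    (hfib : ∀ q : Ideal A, q.IsPrime → FibreCondition R p q) (J : Ideal A) :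
    LiftsModulo R p J := by
  induction J using WellFoundedGT.induction with
  | ind J IH =>
    by_cases htop : J = ⊤
    · subst htop; exact LiftsModulo.top p hpow
    by_cases hJ : J.IsPrime
    · exact LiftsModulo.of_prime hinj hpow hcolon (hfib J hJ) IH
    · rw [Ideal.isPrime_iff] at hJ
      push Not at hJ
      obtain ⟨a, b, hab, ha, hb⟩ := hJ htop
      refine LiftsModulo.of_mul_mem hinj hcolon a (IH _ ?_) (IH _ ?_)
      · refine lt_of_le_of_ne le_sup_left fun h => ha ?_
        rw [h]
        exact Ideal.mem_sup_right (Ideal.mem_span_singleton_self a)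
      · refine lt_of_le_of_ne (fun s hs => ?_) fun h => hb ?_
        · rw [Submodule.mem_colon_singleton]
          exact Ideal.mul_mem_right _ _ hs
        · rw [h, Submodule.mem_colon_singleton, smul_eq_mul, mul_comm]
          exact hab

end Desingularization

end

section RegularDomain

theorem span_quotient_eq_maximalIdeal {R : Type} [CommRing R] [IsLocalRing R] {n : ℕ}
    (t : Fin (n + 1) → R) (ht : Ideal.span (Set.range t) = IsLocalRing.maximalIdeal R)
    (I : Ideal R) (h0 : t 0 ∈ I) [IsLocalRing (R ⧸ I)] :
    Ideal.span (Set.range fun i : Fin n => Ideal.Quotient.mk I (t i.succ)) =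
      IsLocalRing.maximalIdeal (R ⧸ I) := by
  have hmap : (IsLocalRing.maximalIdeal R).map (Ideal.Quotient.mk I) =
      IsLocalRing.maximalIdeal (R ⧸ I) := by
    have hs := Ideal.Quotient.mk_surjective (I := I)
    have hl : IsLocalHom (Ideal.Quotient.mk I) := .of_surjective _ hs
    rcases Ideal.map_eq_top_or_isMaximal_of_surjective _ hs
      (IsLocalRing.maximalIdeal.isMaximal R) with h | h
    · have h2 : (IsLocalRing.maximalIdeal R).map (Ideal.Quotient.mk I) ≤
          IsLocalRing.maximalIdeal (R ⧸ I) :=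
        ((IsLocalRing.local_hom_TFAE (Ideal.Quotient.mk I)).out 0 2).1 hl
      exact absurd (top_le_iff.1 (h ▸ h2)) (IsLocalRing.maximalIdeal.isMaximal _).ne_top
    · exact IsLocalRing.eq_maximalIdeal h
  rw [← hmap, ← ht, Ideal.map_span]
  apply le_antisymm
  · refine Ideal.span_mono ?_
    rintro _ ⟨i, rfl⟩
    exact ⟨_, ⟨i.succ, rfl⟩, rfl⟩
  · rw [Ideal.span_le]
    rintro _ ⟨_, ⟨i, rfl⟩, rfl⟩
    refine Fin.cases ?_ (fun i => ?_) i
    · rw [Ideal.Quotient.eq_zero_iff_mem.2 h0]; exact zero_mem _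
    · exact Ideal.subset_span ⟨i, rfl⟩

theorem ringKrullDim_le_of_span_eq_maximalIdeal {R : Type} [CommRing R] [IsLocalRing R]
    [IsNoetherianRing R] {n : ℕ} (t : Fin n → R)
    (ht : Ideal.span (Set.range t) = IsLocalRing.maximalIdeal R) : ringKrullDim R ≤ n := by
  refine (ringKrullDim_le_spanFinrank_maximalIdeal R).trans ?_
  rw [← ht]
  have := Submodule.spanFinrank_span_le_ncard_of_finite (R := R) (Set.finite_range t)
  have h2 : (Set.range t).ncard ≤ n := by
    rw [← Set.image_univ]
    refine (Set.ncard_image_le Set.finite_univ).trans ?_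
    simp
  exact_mod_cast this.trans h2

theorem isLocalRing_quotient {R : Type} [CommRing R] [IsLocalRing R] {I : Ideal R} (hI : I ≠ ⊤) :
    IsLocalRing (R ⧸ I) :=
  have := Ideal.Quotient.nontrivial_iff.2 hI
  .of_surjective' _ (Ideal.Quotient.mk_surjective (I := I))

theorem ringKrullDim_quotient_span_singleton_le {R : Type} [CommRing R] [IsLocalRing R]
    [IsNoetherianRing R] {t : R} (ht : t ∈ IsLocalRing.maximalIdeal R) :
    ringKrullDim R ≤ ringKrullDim (R ⧸ Ideal.span {t}) + 1 := by
  have := ringKrullDim_le_ringKrullDim_quotient_add_card (R := R) {t} (by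
    simpa [IsLocalRing.ringJacobson_eq_maximalIdeal] using ht)
  rwa [Finset.coe_singleton, Finset.card_singleton, Nat.cast_one] at this

theorem regular_quotient {R : Type} [CommRing R] [IsLocalRing R] [IsNoetherianRing R] {n : ℕ}
    (t : Fin (n + 1) → R) (ht : Ideal.span (Set.range t) = IsLocalRing.maximalIdeal R)
    (hd : ringKrullDim R = (n + 1 : ℕ)) :
    ∃ _ : IsLocalRing (R ⧸ Ideal.span {t 0}),
      Ideal.span (Set.range fun i : Fin n => Ideal.Quotient.mk (Ideal.span {t 0}) (t i.succ)) =
      IsLocalRing.maximalIdeal (R ⧸ Ideal.span {t 0}) ∧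
      ringKrullDim (R ⧸ Ideal.span {t 0}) = n := by
  have h0 : t 0 ∈ IsLocalRing.maximalIdeal R := ht ▸ Ideal.subset_span ⟨0, rfl⟩
  have hI : Ideal.span {t 0} ≠ ⊤ := by
    rw [Ne, Ideal.span_singleton_eq_top]; exact h0
  have := isLocalRing_quotient hI
  have hg := span_quotient_eq_maximalIdeal t ht _ (Ideal.mem_span_singleton_self (t 0))
  refine ⟨this, hg, le_antisymm (ringKrullDim_le_of_span_eq_maximalIdeal _ hg) ?_⟩
  have h := ringKrullDim_quotient_span_singleton_le h0
  rw [hd] at h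
  push_cast at h
  generalize ringKrullDim (R ⧸ Ideal.span {t 0}) = d at h ⊢
  induction d with
  | bot => simp at h
  | coe d =>
    have h' : ((n : ℕ∞) + 1) ≤ d + 1 := by exact_mod_cast h
    exact_mod_cast (ENat.add_le_add_iff_right ENat.one_ne_top).1 h'

theorem exists_prime_ringKrullDim_quotient {R : Type} [CommRing R] {n : ℕ}
    (hd : ringKrullDim R = n) : ∃ q : Ideal R, q.IsPrime ∧ n ≤ ringKrullDim (R ⧸ q) := by
  have : Nonempty (PrimeSpectrum R) := by
    by_contra h
    rw [not_nonempty_iff] at h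
    rw [ringKrullDim, Order.krullDim_eq_bot] at hd
    exact absurd hd (by simp)
  obtain ⟨s, hs⟩ := Order.le_krullDim_iff.1 (hd.ge : (n : WithBot ℕ∞) ≤ Order.krullDim _)
  refine ⟨s.head.asIdeal, s.head.2, ?_⟩
  rw [ringKrullDim_quotient]
  refine Order.le_krullDim_iff.2 ⟨⟨s.length, fun i => ⟨s i, ?_⟩, fun i => ?_⟩, hs⟩
  · rw [PrimeSpectrum.mem_zeroLocus]
    exact s.head_le i
  · exact s.step i

theorem isDomain_of_regular (n : ℕ) : ∀ (R : Type) [CommRing R] [IsLocalRing R]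
    [IsNoetherianRing R] (t : Fin n → R),
    Ideal.span (Set.range t) = IsLocalRing.maximalIdeal R → ringKrullDim R = n → IsDomain R := by
  induction n with
  | zero =>
    intro R _ _ _ t ht _
    have : IsField R := by
      rw [IsLocalRing.isField_iff_maximalIdeal_eq, ← ht]
      simp
    exact this.isDomain
  | succ n IH =>
    intro R _ _ _ t ht hd
    have h0 : t 0 ∈ IsLocalRing.maximalIdeal R := ht ▸ Ideal.subset_span ⟨0, rfl⟩
    obtain ⟨hl, hg, hd'⟩ := regular_quotient t ht hd
    have hdom := IH _ _ hg hd'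
    obtain ⟨q, hq, hqd⟩ := exists_prime_ringKrullDim_quotient hd
    have hlq := isLocalRing_quotient hq.ne_top
    have htq : t 0 ∉ q := fun h => by
      have := hqd.trans
        (ringKrullDim_le_of_span_eq_maximalIdeal _ (span_quotient_eq_maximalIdeal t ht q h))
      have h2 : n + 1 ≤ n := by exact_mod_cast this
      omega
    have h0' : Ideal.Quotient.mk q (t 0) ∈ IsLocalRing.maximalIdeal (R ⧸ q) := by
      rw [IsLocalRing.mem_maximalIdeal, mem_nonunits_iff]
      intro hu
      have := IsLocalHom.of_surjective (Ideal.Quotient.mk q) Ideal.Quotient.mk_surjective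
      exact h0 (isUnit_of_map_unit _ _ hu)
    have hqt : q ≤ Ideal.span {t 0} := by
      intro x hx
      by_contra hxt
      have hx0 : Ideal.Quotient.mk (Ideal.span {t 0}) x ∈ nonZeroDivisors _ :=
        mem_nonZeroDivisors_of_ne_zero (by rwa [Ne, Ideal.Quotient.eq_zero_iff_mem])
      have h1 := ringKrullDim_quotient_succ_le_of_nonZeroDivisor hx0
      have h2 := hqd.trans (ringKrullDim_quotient_span_singleton_le h0')
      let f : (R ⧸ Ideal.span {t 0}) →+*
          (R ⧸ q) ⧸ Ideal.span {Ideal.Quotient.mk q (t 0)} :=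
        Ideal.Quotient.lift _ ((Ideal.Quotient.mk _).comp (Ideal.Quotient.mk q)) (by
          intro a ha
          obtain ⟨b, rfl⟩ := Ideal.mem_span_singleton'.1 ha
          rw [RingHom.comp_apply, Ideal.Quotient.eq_zero_iff_mem, map_mul]
          exact Ideal.mul_mem_left _ _ (Ideal.mem_span_singleton_self _))
      have hf : Function.Surjective f := Ideal.Quotient.lift_surjective_of_surjective _ _
        (Ideal.Quotient.mk_surjective.comp Ideal.Quotient.mk_surjective)
      let g : (R ⧸ Ideal.span {t 0}) ⧸ Ideal.span {Ideal.Quotient.mk (Ideal.span {t 0}) x} →+*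
          (R ⧸ q) ⧸ Ideal.span {Ideal.Quotient.mk q (t 0)} :=
        Ideal.Quotient.lift _ f (by
          intro a ha
          obtain ⟨b, rfl⟩ := Ideal.mem_span_singleton'.1 ha
          rw [map_mul]
          have : f (Ideal.Quotient.mk (Ideal.span {t 0}) x) = 0 := by
            simp only [f, Ideal.Quotient.lift_mk, RingHom.comp_apply]
            rw [Ideal.Quotient.eq_zero_iff_mem.2 hx, map_zero]
          rw [this, mul_zero])
      have hgs : Function.Surjective g := Ideal.Quotient.lift_surjective_of_surjective _ _ hf
      have h3 := ringKrullDim_le_of_surjective g hgs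
      have h4 : ((n + 1 : ℕ) : WithBot ℕ∞) ≤ n :=
        (h2.trans (add_le_add_left h3 1)).trans (h1.trans hd'.le)
      have h5 : n + 1 ≤ n := by exact_mod_cast h4
      omega
    have hbot : q = ⊥ := by
      refine Submodule.eq_bot_of_le_smul_of_le_jacobson_bot (Ideal.span {t 0}) q
        (IsNoetherian.noetherian q) ?_ ?_
      · intro x hx
        obtain ⟨y, rfl⟩ := Ideal.mem_span_singleton'.1 (hqt hx)
        rw [mul_comm]
        exact Submodule.smul_mem_smul (Ideal.mem_span_singleton_self _)
          ((hq.mem_or_mem hx).resolve_right htq)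
      · rw [IsLocalRing.jacobson_eq_maximalIdeal _ bot_ne_top, Ideal.span_singleton_le_iff_mem]
        exact h0
    subst hbot
    exact MulEquiv.isDomain (R ⧸ (⊥ : Ideal R)) (RingEquiv.quotientBot R).symm.toMulEquiv

end RegularDomain

section Flatness
variable {A B : Type} [CommRing A] [CommRing B]

/-- The span of the images of the syzygies modulo `T` of the family of vectors `v`. -/
def syzSpan (φ : A →+* B) (T : Ideal A) {ι κ : Type} [Fintype ι] (v : ι → κ → A) :
    Submodule B (ι → B) :=
  Submodule.span B {s | ∃ a : ι → A, (∀ j, ∑ i, a i * v i j ∈ T) ∧ s = fun i => φ (a i)}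

/-- Relations modulo `T` with coefficients in the image of `φ` come from syzygies. -/
def FlatMod (φ : A →+* B) (T : Ideal A) : Prop :=
  ∀ (ι : Type) [Fintype ι] (f : ι → A) (x : ι → B), ∑ i, φ (f i) * x i ∈ T.map φ →
    ∃ s ∈ syzSpan φ T (fun i (_ : Unit) => f i), ∀ i, x i - s i ∈ T.map φ

theorem mem_syzSpan_iff {φ : A →+* B} {T : Ideal A} {ι κ : Type} [Fintype ι] {v : ι → κ → A}
    {s : ι → B} : s ∈ syzSpan φ T v ↔ ∃ (n : ℕ) (b : Fin n → B) (a : Fin n → ι → A),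
      (∀ u j, ∑ i, a u i * v i j ∈ T) ∧ ∀ i, s i = ∑ u, b u * φ (a u i) := by
  constructor
  · intro h
    obtain ⟨n, b, g, rfl⟩ := Submodule.mem_span_set'.1 h
    choose a ha ha' using fun u => (g u).2
    refine ⟨n, b, a, ha, fun i => ?_⟩
    rw [Finset.sum_apply]
    refine Finset.sum_congr rfl fun u _ => ?_
    rw [Pi.smul_apply, ha' u, smul_eq_mul]
  · rintro ⟨n, b, a, ha, hs⟩
    have : s = ∑ u, b u • fun i => φ (a u i) := by
      funext i
      rw [hs, Finset.sum_apply]; rfl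
    rw [this]
    exact Submodule.sum_mem _ fun u _ => Submodule.smul_mem _ _ (Submodule.subset_span ⟨_, ha u, rfl⟩)

theorem subset_syzSpan {φ : A →+* B} {T : Ideal A} {ι κ : Type} [Fintype ι] {v : ι → κ → A}
    {a : ι → A} (ha : ∀ j, ∑ i, a i * v i j ∈ T) : (fun i => φ (a i)) ∈ syzSpan φ T v :=
  Submodule.subset_span ⟨a, ha, rfl⟩

theorem FlatMod.vector {φ : A →+* B} {T : Ideal A} (h : FlatMod φ T) {ι κ : Type} [Fintype ι]
    [Fintype κ] (v : ι → κ → A) (x : ι → B) (hx : ∀ j, ∑ i, φ (v i j) * x i ∈ T.map φ) :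
    ∃ s ∈ syzSpan φ T v, ∀ i, x i - s i ∈ T.map φ := by
  classical
  have key : ∀ S : Finset κ, ∃ s ∈ syzSpan φ T (fun i (j : S) => v i j),
      ∀ i, x i - s i ∈ T.map φ := by
    intro S
    induction S using Finset.induction_on with
    | empty =>
      refine ⟨x, ?_, by simp⟩
      rw [mem_syzSpan_iff]
      refine ⟨Fintype.card ι, fun u => x ((Fintype.equivFin ι).symm u),
        fun u => Pi.single ((Fintype.equivFin ι).symm u) 1, ?_, fun i => ?_⟩
      · rintro u ⟨j, hj⟩; simp at hj
      · rw [← (Fintype.equivFin ι).sum_comp]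
        simp [Pi.single_apply, apply_ite φ]
    | insert k S _ IH =>
      obtain ⟨s, hs, hsx⟩ := IH
      obtain ⟨n, b, a, ha, hs⟩ := mem_syzSpan_iff.1 hs
      obtain ⟨s', hs', hsb⟩ := h (Fin n) (fun u => ∑ i, a u i * v i k) b (by
        have h1 : ∑ u, φ (∑ i, a u i * v i k) * b u =
            ∑ i, φ (v i k) * x i - ∑ i, φ (v i k) * (x i - s i) := by
          simp only [mul_sub, Finset.sum_sub_distrib, sub_sub_cancel, hs, map_sum, map_mul,
            Finset.mul_sum, Finset.sum_mul]
          rw [Finset.sum_comm]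
          refine Finset.sum_congr rfl fun i _ => Finset.sum_congr rfl fun u _ => ?_
          ring
        rw [h1]
        exact Ideal.sub_mem _ (hx k) (Ideal.sum_mem _ fun i _ => Ideal.mul_mem_left _ _ (hsx i)))
      obtain ⟨m, c, d, hd, hs'⟩ := mem_syzSpan_iff.1 hs'
      refine ⟨fun i => ∑ u, s' u * φ (a u i), ?_, fun i => ?_⟩
      · rw [mem_syzSpan_iff]
        refine ⟨m, c, fun w i => ∑ u, d w u * a u i, ?_, fun i => ?_⟩
        · rintro w ⟨j, hj⟩
          have h2 : ∑ i, (∑ u, d w u * a u i) * v i j = ∑ u, d w u * ∑ i, a u i * v i j := by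
            simp only [Finset.mul_sum, Finset.sum_mul]
            rw [Finset.sum_comm]
            refine Finset.sum_congr rfl fun i _ => Finset.sum_congr rfl fun u _ => ?_
            ring
          simp only [h2]
          rcases Finset.mem_insert.1 hj with rfl | hj
          · exact hd w ()
          · exact Ideal.sum_mem _ fun u _ => Ideal.mul_mem_left _ _ (ha u ⟨j, hj⟩)
        · simp only [hs', map_sum, map_mul, Finset.mul_sum, Finset.sum_mul]
          rw [Finset.sum_comm]
          refine Finset.sum_congr rfl fun i _ => Finset.sum_congr rfl fun u _ => ?_
          ring
      · have h3 : x i - ∑ u, s' u * φ (a u i) = (x i - s i) + ∑ u, (b u - s' u) * φ (a u i) := by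
          simp only [hs i, sub_mul, Finset.sum_sub_distrib]; ring
        rw [h3]
        exact Ideal.add_mem _ (hsx i) (Ideal.sum_mem _ fun u _ => Ideal.mul_mem_right _ _ (hsb u))
  obtain ⟨s, hs, hsx⟩ := key Finset.univ
  refine ⟨s, ?_, hsx⟩
  rw [mem_syzSpan_iff] at hs ⊢
  obtain ⟨n, b, a, ha, hs⟩ := hs
  exact ⟨n, b, a, fun u j => ha u ⟨j, Finset.mem_univ j⟩, hs⟩

/-- Flatness restricted to relations whose coefficients generate the ideal `I`. -/
def FlatIdeal (φ : A →+* B) (I : Ideal A) : Prop :=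
  ∀ (ι : Type) [Fintype ι] (f : ι → A), Ideal.span (Set.range f) = I →
    ∀ (x : ι → B), ∑ i, φ (f i) * x i = 0 → x ∈ syzSpan φ ⊥ (fun i (_ : Unit) => f i)

theorem FlatIdeal.of_torsionFree [IsLocalRing B] [IsNoetherianRing B] {φ : A →+* B} {t : A}
    (ht : φ t ∈ IsLocalRing.maximalIdeal B) (hreg : ∀ b, φ t * b = 0 → b = 0)
    (h : FlatMod φ (Ideal.span {t})) {I : Ideal A} (hI : ∀ a, t * a ∈ I → a ∈ I) :
    FlatIdeal φ I := by
  intro ι _ f hf x hx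
  let N : Submodule B (ι → B) := LinearMap.ker (∑ i, φ (f i) • LinearMap.proj (R := B) (φ := fun _ => B) i)
  have hN : ∀ z, z ∈ N ↔ ∑ i, φ (f i) * z i = 0 := by
    intro z; simp [N, LinearMap.mem_ker]
  have hle : N ≤ syzSpan φ ⊥ (fun i (_ : Unit) => f i) := by
    refine Submodule.le_of_le_smul_of_le_jacobson_bot (I := Ideal.span {φ t})
      (IsNoetherian.noetherian N) ?_ ?_
    · rw [IsLocalRing.jacobson_eq_maximalIdeal _ bot_ne_top, Ideal.span_singleton_le_iff_mem]
      exact ht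
    · intro z hz
      rw [hN] at hz
      obtain ⟨s, hs, hsz⟩ := h ι f z (by rw [hz]; exact zero_mem _)
      obtain ⟨n, b, a, ha, hs⟩ := mem_syzSpan_iff.1 hs
      have hc : ∀ u, ∃ c : ι → A, ∑ i, a u i * f i = t * ∑ i, c i * f i := by
        intro u
        obtain ⟨e, he⟩ := Ideal.mem_span_singleton.1 (ha u ())
        have : e ∈ I := by
          apply hI
          rw [← he, ← hf]
          exact Ideal.sum_mem _ fun i _ => Ideal.mul_mem_left _ _ (Ideal.subset_span ⟨i, rfl⟩)
        rw [← hf, Ideal.mem_span_range_iff_exists_fun] at this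
        obtain ⟨c, hc⟩ := this
        exact ⟨c, by rw [he, hc]⟩
      choose c hc using hc
      rw [Ideal.map_span, Set.image_singleton] at hsz
      choose w hw using fun i => Ideal.mem_span_singleton.1 (hsz i)
      let s' : ι → B := fun i => ∑ u, b u * φ (a u i - t * c u i)
      have hs' : s' ∈ syzSpan φ ⊥ (fun i (_ : Unit) => f i) := by
        rw [mem_syzSpan_iff]
        refine ⟨n, b, fun u i => a u i - t * c u i, fun u _ => ?_, fun i => rfl⟩
        rw [Ideal.mem_bot]
        simp only [sub_mul, Finset.sum_sub_distrib, hc u, Finset.mul_sum, mul_assoc, sub_self]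
      have hs'N : ∑ i, φ (f i) * s' i = 0 := by
        have : ∑ i, φ (f i) * s' i = ∑ u, b u * φ (∑ i, (a u i - t * c u i) * f i) := by
          simp only [s', Finset.mul_sum, map_sum, map_mul]
          rw [Finset.sum_comm]
          refine Finset.sum_congr rfl fun i _ => Finset.sum_congr rfl fun u _ => ?_
          ring
        rw [this]
        refine Finset.sum_eq_zero fun u _ => ?_
        simp only [sub_mul, Finset.sum_sub_distrib, hc u, Finset.mul_sum, mul_assoc, sub_self,
          map_zero, mul_zero]
      let y : ι → B := fun i => w i + ∑ u, b u * φ (c u i)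
      have hzy : z = s' + φ t • y := by
        funext i
        have h1 : z i = s i + φ t * w i := by rw [← hw i]; ring
        simp only [Pi.add_apply, Pi.smul_apply, s', y, h1, hs i, smul_eq_mul, map_sub, map_mul,
          mul_sub, Finset.sum_sub_distrib, mul_add, Finset.mul_sum]
        have : ∀ u, b u * (φ t * φ (c u i)) = φ t * (b u * φ (c u i)) := fun u => by ring
        simp only [this]
        ring
      rw [hzy]
      refine Submodule.add_mem_sup hs' (Submodule.smul_mem_smul (Ideal.mem_span_singleton_self _) ?_)
      rw [hN]
      apply hreg
      have h2 := hz
      rw [hzy] at h2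
      simp only [Pi.add_apply, Pi.smul_apply, mul_add, Finset.sum_add_distrib, hs'N, zero_add,
        smul_eq_mul] at h2
      rw [← h2, Finset.mul_sum]
      refine Finset.sum_congr rfl fun i _ => ?_
      ring
  exact hle ((hN x).2 hx)

theorem FlatIdeal.of_le [IsNoetherianRing A] {φ : A →+* B} {t : A}
    (hreg : ∀ b, φ t * b = 0 → b = 0)
    (h : FlatMod φ (Ideal.span {t})) {I J : Ideal A} (hJ : FlatIdeal φ J) (hIJ : I ≤ J)
    (htJ : ∀ a ∈ J, t * a ∈ I) : FlatIdeal φ I := by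
  classical
  intro ι _ f hf x hx
  obtain ⟨k, g, hg⟩ := Submodule.fg_iff_exists_fin_generating_family.1 (IsNoetherian.noetherian J)
  have hg : Ideal.span (Set.range g) = J := hg
  have hm : ∀ i, ∃ m : Fin k → A, ∑ j, m j * g j = f i := by
    intro i
    rw [← Ideal.mem_span_range_iff_exists_fun, hg]
    apply hIJ
    rw [← hf]
    exact Ideal.subset_span ⟨i, rfl⟩
  choose m hm using hm
  have hn : ∀ j, ∃ n : ι → A, ∑ i, n i * f i = t * g j := by
    intro j
    rw [← Ideal.mem_span_range_iff_exists_fun, hf]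
    apply htJ
    rw [← hg]
    exact Ideal.subset_span ⟨j, rfl⟩
  choose n hn using hn
  have hcomb : ∀ s : Fin k → B, s ∈ syzSpan φ ⊥ (fun i (_ : Unit) => g i) →
      (fun i => ∑ j, s j * φ (n j i)) ∈ syzSpan φ ⊥ (fun i (_ : Unit) => f i) := by
    intro s hs
    obtain ⟨e, b, a, ha, hs⟩ := mem_syzSpan_iff.1 hs
    rw [mem_syzSpan_iff]
    refine ⟨e, b, fun u i => ∑ j, a u j * n j i, fun u _ => ?_, fun i => ?_⟩
    · have : ∑ i, (∑ j, a u j * n j i) * f i = t * ∑ j, a u j * g j := by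
        simp only [Finset.sum_mul, Finset.mul_sum]
        rw [Finset.sum_comm]
        refine Finset.sum_congr rfl fun j _ => ?_
        rw [mul_left_comm, ← hn, Finset.mul_sum]
        exact Finset.sum_congr rfl fun i _ => by ring
      rw [this, (Ideal.mem_bot).1 (ha u ()), mul_zero]
      exact zero_mem _
    · simp only [hs, map_sum, map_mul, Finset.sum_mul, Finset.mul_sum]
      rw [Finset.sum_comm]
      exact Finset.sum_congr rfl fun j _ => Finset.sum_congr rfl fun i _ => by ring
  have hy := hJ (Fin k) g hg (fun j => ∑ i, φ (m i j) * x i) (by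
    rw [← hx]
    simp only [Finset.mul_sum, ← hm, map_sum, Finset.sum_mul, map_mul]
    rw [Finset.sum_comm]
    exact Finset.sum_congr rfl fun i _ => Finset.sum_congr rfl fun j _ => by ring)
  obtain ⟨e, b, s, hs, hy⟩ := mem_syzSpan_iff.1 hy
  obtain ⟨z, hz, hxz⟩ := h.vector (Sum.elim m (fun u j => - s u j) : ι ⊕ Fin e → Fin k → A)
    (Sum.elim x b) (by
      intro j
      have : ∑ i, φ ((Sum.elim m (fun u j => - s u j) : ι ⊕ Fin e → Fin k → A) i j) *
          (Sum.elim x b : ι ⊕ Fin e → B) i = 0 := by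
        simp only [Fintype.sum_sum_type, Sum.elim_inl, Sum.elim_inr, hy j, map_neg, neg_mul,
          Finset.sum_neg_distrib]
        rw [← sub_eq_add_neg, sub_eq_zero]
        exact Finset.sum_congr rfl fun i _ => by ring
      rw [this]; exact zero_mem _)
  obtain ⟨l, β, a, ha, hz⟩ := mem_syzSpan_iff.1 hz
  choose c hc using fun u j => Ideal.mem_span_singleton.1 (ha u j)
  rw [Ideal.map_span, Set.image_singleton] at hxz
  choose w hw using fun i => Ideal.mem_span_singleton.1 (hxz (Sum.inl i))
  simp only [Sum.elim_inl] at hw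
  simp only [Fintype.sum_sum_type, Sum.elim_inl, Sum.elim_inr] at hc
  have hag : ∀ u, ∑ i, a u (Sum.inl i) * f i = t * ∑ j, c u j * g j := by
    intro u
    have h1 : ∑ j, (∑ i, a u (Sum.inl i) * m i j + ∑ v, a u (Sum.inr v) * - s v j) * g j =
        ∑ j, (t * c u j) * g j := Finset.sum_congr rfl fun j _ => by rw [hc]
    simp only [add_mul, Finset.sum_add_distrib, Finset.sum_mul] at h1
    have h2 : ∑ j, ∑ v, a u (Sum.inr v) * - s v j * g j = 0 := by
      rw [Finset.sum_comm]
      refine Finset.sum_eq_zero fun v _ => ?_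
      have : ∑ j, a u (Sum.inr v) * - s v j * g j = - a u (Sum.inr v) * ∑ j, s v j * g j := by
        rw [Finset.mul_sum]
        exact Finset.sum_congr rfl fun i _ => by ring
      rw [this, (Ideal.mem_bot).1 (hs v ()), mul_zero]
    rw [h2, add_zero, Finset.sum_comm] at h1
    rw [Finset.mul_sum]
    simp only [mul_assoc] at h1
    rw [← h1]
    refine Finset.sum_congr rfl fun i _ => ?_
    rw [← hm i, Finset.mul_sum]
  have ha' : ∀ u, (fun i => φ (a u (Sum.inl i) - ∑ j, c u j * n j i)) ∈
      syzSpan φ ⊥ (fun i (_ : Unit) => f i) := by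
    intro u
    refine subset_syzSpan fun _ => ?_
    rw [Ideal.mem_bot]
    simp only [sub_mul, Finset.sum_sub_distrib, hag, Finset.sum_mul, Finset.mul_sum]
    rw [sub_eq_zero, Finset.sum_comm]
    refine Finset.sum_congr rfl fun j _ => ?_
    rw [mul_left_comm, ← hn, Finset.mul_sum]
    exact Finset.sum_congr rfl fun i _ => by ring
  let γ : Fin k → B := fun j => ∑ u, β u * φ (c u j)
  let δ : Fin k → B := fun j => γ j + ∑ i, φ (m i j) * w i
  have hx1 : ∀ i, x i = ∑ u, β u * φ (a u (Sum.inl i) - ∑ j, c u j * n j i) +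
      (∑ j, δ j * φ (n j i) + ∑ i', w i' * φ ((if i' = i then t else 0) - ∑ j, m i' j * n j i)) := by
    intro i
    have h1 : x i = z (Sum.inl i) + φ t * w i := by rw [← hw i]; ring
    rw [h1, hz]
    simp only [map_sub, mul_sub, Finset.sum_sub_distrib, map_sum, map_mul, δ, γ, add_mul,
      Finset.sum_add_distrib, apply_ite φ, map_zero, mul_ite, mul_zero, Finset.sum_ite_eq',
      Finset.mem_univ, if_true, Finset.sum_mul, Finset.mul_sum]
    rw [Finset.sum_comm (s := (Finset.univ : Finset (Fin k))) (t := (Finset.univ : Finset (Fin l))),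
      Finset.sum_comm (s := (Finset.univ : Finset (Fin k))) (t := (Finset.univ : Finset ι))]
    have e1 : ∀ (u) (j), β u * (φ (c u j) * φ (n j i)) = β u * φ (c u j) * φ (n j i) := fun u j => by ring
    have e2 : ∀ (u) (j), w u * (φ (m u j) * φ (n j i)) = φ (m u j) * w u * φ (n j i) := fun u j => by ring
    simp only [e1, e2]
    ring
  have hm' : ∀ i', (fun i => φ ((if i' = i then t else 0) - ∑ j, m i' j * n j i)) ∈
      syzSpan φ ⊥ (fun i (_ : Unit) => f i) := by
    intro i'
    refine subset_syzSpan fun _ => ?_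
    rw [Ideal.mem_bot]
    simp only [sub_mul, Finset.sum_sub_distrib, ite_mul, zero_mul, Finset.sum_ite_eq,
      Finset.mem_univ, if_true, Finset.sum_mul]
    rw [sub_eq_zero, Finset.sum_comm, ← hm i', Finset.mul_sum]
    refine Finset.sum_congr rfl fun j _ => ?_
    rw [mul_left_comm, ← hn, Finset.mul_sum]
    exact Finset.sum_congr rfl fun i _ => by ring
  have hzero : ∀ s ∈ syzSpan φ ⊥ (fun i (_ : Unit) => f i), ∑ i, φ (f i) * s i = 0 := by
    intro s hs
    obtain ⟨e, b, a, ha, hs⟩ := mem_syzSpan_iff.1 hs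
    simp only [hs, Finset.mul_sum]
    rw [Finset.sum_comm]
    refine Finset.sum_eq_zero fun u _ => ?_
    have : ∑ i, φ (f i) * (b u * φ (a u i)) = b u * φ (∑ i, a u i * f i) := by
      rw [map_sum, Finset.mul_sum]
      exact Finset.sum_congr rfl fun i _ => by rw [map_mul]; ring
    rw [this, (Ideal.mem_bot).1 (ha u ()), map_zero, mul_zero]
  have hS1 : (fun i => ∑ u, β u * φ (a u (Sum.inl i) - ∑ j, c u j * n j i)) ∈
      syzSpan φ ⊥ (fun i (_ : Unit) => f i) := by
    have := Submodule.sum_mem _ fun u (_ : u ∈ Finset.univ) => Submodule.smul_mem _ (β u) (ha' u)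
    convert this using 1
    funext i; simp
  have hS2 : (fun i => ∑ i', w i' * φ ((if i' = i then t else 0) - ∑ j, m i' j * n j i)) ∈
      syzSpan φ ⊥ (fun i (_ : Unit) => f i) := by
    have := Submodule.sum_mem _ fun u (_ : u ∈ Finset.univ) => Submodule.smul_mem _ (w u) (hm' u)
    convert this using 1
    funext i; simp
  have hδ : ∑ j, φ (g j) * δ j = 0 := by
    apply hreg
    have h1 := hx
    simp only [hx1, mul_add, Finset.sum_add_distrib] at h1
    rw [hzero _ hS1, hzero _ hS2, zero_add, add_zero] at h1
    rw [← h1, Finset.mul_sum]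
    simp only [Finset.mul_sum]
    rw [Finset.sum_comm]
    refine Finset.sum_congr rfl fun j _ => ?_
    rw [← mul_assoc, ← map_mul, ← hn, map_sum, Finset.sum_mul]
    exact Finset.sum_congr rfl fun i _ => by rw [map_mul]; ring
  have hS3 := hcomb δ (hJ (Fin k) g hg δ hδ)
  have := Submodule.add_mem _ hS1 (Submodule.add_mem _ hS3 hS2)
  convert this using 1
  funext i
  exact hx1 i

/-- The local criterion of flatness along a regular element. -/
theorem FlatMod.of_regular_element [IsNoetherianRing A] [IsLocalRing B] [IsNoetherianRing B]
    {φ : A →+* B} {t : A} (ht : φ t ∈ IsLocalRing.maximalIdeal B)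
    (hreg : ∀ b, φ t * b = 0 → b = 0) (h : FlatMod φ (Ideal.span {t})) : FlatMod φ ⊥ := by
  have key : ∀ I : Ideal A, FlatIdeal φ I := by
    intro I
    let T : ℕ →o Ideal A := ⟨fun n => I.colon {t ^ n}, fun m n hmn a ha => by
      rw [Submodule.mem_colon_singleton, smul_eq_mul] at ha ⊢
      rw [← Nat.sub_add_cancel hmn, pow_add, mul_left_comm]
      exact Ideal.mul_mem_left _ _ ha⟩
    have hT : ∀ n a, a ∈ T n ↔ a * t ^ n ∈ I := fun n a => by
      change a ∈ I.colon {t ^ n} ↔ _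
      rw [Submodule.mem_colon_singleton, smul_eq_mul]
    obtain ⟨n, hn⟩ := monotone_stabilizes_iff_noetherian.2 ‹IsNoetherianRing A› T
    have hX : ∀ k, FlatIdeal φ (I ⊔ Ideal.span {t ^ k} * T n) := by
      intro k
      induction k with
      | zero =>
        refine FlatIdeal.of_torsionFree ht hreg h fun a ha => ?_
        rw [pow_zero, Ideal.span_singleton_one, Ideal.one_eq_top.symm, one_mul, sup_eq_right.2] at ha ⊢
        · rw [hn (n + 1) (Nat.le_succ n), hT, pow_succ]
          rw [hT] at ha
          convert ha using 1; ring
        all_goals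
          intro b hb
          rw [hT]
          exact Ideal.mul_mem_right _ _ hb
      | succ k IH =>
        refine FlatIdeal.of_le hreg h IH ?_ ?_
        · refine sup_le_sup le_rfl (Ideal.mul_mono_left ?_)
          rw [Ideal.span_singleton_le_span_singleton]
          exact pow_dvd_pow _ (Nat.le_succ k)
        · intro a ha
          obtain ⟨i, hi, b, hb, rfl⟩ := Submodule.mem_sup.1 ha
          rw [mul_add]
          refine Ideal.add_mem _ (Ideal.mem_sup_left (Ideal.mul_mem_left _ _ hi))
            (Ideal.mem_sup_right ?_)
          rw [pow_succ', ← Ideal.span_singleton_mul_span_singleton, mul_assoc]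
          exact Ideal.mul_mem_mul (Ideal.mem_span_singleton_self t) hb
    have : I ⊔ Ideal.span {t ^ n} * T n = I := by
      rw [sup_eq_left, Ideal.mul_le]
      intro r hr s hs
      obtain ⟨c, rfl⟩ := Ideal.mem_span_singleton'.1 hr
      rw [hT] at hs
      rw [mul_assoc, mul_comm (t ^ n)]
      exact Ideal.mul_mem_left _ _ hs
    rw [← this]
    exact hX n
  intro ι _ f x hx
  rw [Ideal.map_bot, Ideal.mem_bot] at hx
  exact ⟨x, key _ ι f rfl x hx, fun i => by simp⟩

theorem FlatMod.of_field {K : Type} [Field K] (φ : K →+* B) : FlatMod φ ⊥ := by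
  intro ι _ f x hx
  rw [Ideal.map_bot, Ideal.mem_bot] at hx
  refine ⟨x, ?_, fun i => by rw [sub_self]; exact zero_mem _⟩
  let := φ.toAlgebra
  obtain ⟨k, a, y, hy, ha⟩ := Module.Flat.isTrivialRelation_of_sum_smul_eq_zero (R := K) (M := B)
    (f := f) (x := x) (by simpa [Algebra.smul_def] using! hx)
  rw [mem_syzSpan_iff]
  refine ⟨_, fun u => y u, fun u i => a i u, fun u _ => ?_, fun i => ?_⟩
  · rw [Ideal.mem_bot, ← ha u]
    exact Finset.sum_congr rfl fun i _ => mul_comm _ _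
  · rw [hy i]
    exact Finset.sum_congr rfl fun i _ => by rw [Algebra.smul_def, mul_comm]; rfl

theorem flatMod_frobenius_span_singleton {R : Type} [CommRing R] [IsDomain R] (p : ℕ) [Fact p.Prime]
    [CharP R p] (t : R) (ht : t ≠ 0) [CharP (R ⧸ Ideal.span {t}) p]
    (h : FlatMod (frobenius (R ⧸ Ideal.span {t}) p) ⊥) :
    FlatMod (frobenius R p) (Ideal.span {t}) := by
  have h1 : ∀ (ι : Type) [Fintype ι] (f x : ι → R), ∑ i, f i ^ p * x i ∈ Ideal.span {t} →
      ∃ s ∈ syzSpan (frobenius R p) (Ideal.span {t}) (fun i (_ : Unit) => f i),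
        ∀ i, x i - s i ∈ Ideal.span {t} := by
    intro ι _ f x hx
    obtain ⟨s, hs, hxs⟩ := h ι (fun i => Ideal.Quotient.mk _ (f i))
      (fun i => Ideal.Quotient.mk _ (x i)) (by
        rw [Ideal.map_bot, Ideal.mem_bot, ← Ideal.Quotient.eq_zero_iff_mem.2 hx]
        simp [frobenius_def])
    obtain ⟨n, b, a, ha, hs⟩ := mem_syzSpan_iff.1 hs
    choose b' hb' using fun u => Ideal.Quotient.mk_surjective (b u)
    choose a' ha' using fun u i => Ideal.Quotient.mk_surjective (a u i)
    refine ⟨fun i => ∑ u, b' u * frobenius R p (a' u i),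
      mem_syzSpan_iff.2 ⟨n, b', a', fun u _ => ?_, fun i => rfl⟩, fun i => ?_⟩
    · rw [← Ideal.Quotient.eq_zero_iff_mem, map_sum]
      have := ha u ()
      rw [Ideal.mem_bot] at this
      rw [← this]
      exact Finset.sum_congr rfl fun i _ => by rw [map_mul, ha']
    · have := hxs i
      rw [Ideal.map_bot, Ideal.mem_bot, hs] at this
      rw [← Ideal.Quotient.eq_zero_iff_mem, ← this, map_sub, map_sum]
      congr 1
      exact Finset.sum_congr rfl fun u _ => by rw [map_mul, hb', frobenius_def, map_pow, ha', frobenius_def]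
  have key : ∀ k ≤ p, ∀ (ι : Type) [Fintype ι] (f x : ι → R), ∑ i, f i ^ p * x i ∈ Ideal.span {t ^ k} →
      ∃ s ∈ syzSpan (frobenius R p) (Ideal.span {t}) (fun i (_ : Unit) => f i),
        ∀ i, x i - s i ∈ Ideal.span {t ^ k} := by
    intro k
    induction k with
    | zero =>
      intro _ ι _ f x _
      exact ⟨0, zero_mem _, by simp⟩
    | succ k IH =>
      intro hk ι _ f x hx
      obtain ⟨s, hs, hxs⟩ := IH (by omega) ι f x
        (Ideal.span_singleton_le_span_singleton.2 (pow_dvd_pow _ (Nat.le_succ k)) hx)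
      choose z hz using fun i => Ideal.mem_span_singleton.1 (hxs i)
      have h2 : ∑ i, f i ^ p * s i ∈ Ideal.span {t ^ (k + 1)} := by
        obtain ⟨n, b, a, ha, hs⟩ := mem_syzSpan_iff.1 hs
        have : ∑ i, f i ^ p * s i = ∑ u, b u * (∑ i, a u i * f i) ^ p := by
          simp only [hs, Finset.mul_sum]
          rw [Finset.sum_comm]
          refine Finset.sum_congr rfl fun u _ => ?_
          have := map_sum (frobenius R p) (fun i => a u i * f i) Finset.univ
          rw [frobenius_def] at this
          rw [this, Finset.mul_sum]
          refine Finset.sum_congr rfl fun i _ => ?_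
          rw [map_mul, frobenius_def, frobenius_def]; ring
        rw [this]
        refine Ideal.sum_mem _ fun u _ => Ideal.mul_mem_left _ _ ?_
        obtain ⟨c, hc⟩ := Ideal.mem_span_singleton.1 (ha u ())
        rw [hc, mul_pow]
        exact Ideal.mul_mem_right _ _ (Ideal.mem_span_singleton.2 (pow_dvd_pow _ hk))
      have h3 : ∑ i, f i ^ p * z i ∈ Ideal.span {t} := by
        have h4 : t ^ k * ∑ i, f i ^ p * z i = ∑ i, f i ^ p * x i - ∑ i, f i ^ p * s i := by
          rw [← Finset.sum_sub_distrib, Finset.mul_sum]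
          refine Finset.sum_congr rfl fun i _ => ?_
          rw [← mul_sub, hz]; ring
        have h5 := Ideal.sub_mem _ hx h2
        rw [← h4, Ideal.mem_span_singleton, pow_succ] at h5
        rw [Ideal.mem_span_singleton]
        exact (mul_dvd_mul_iff_left (pow_ne_zero k ht)).1 h5
      obtain ⟨s', hs', hzs⟩ := h1 ι f z h3
      refine ⟨s + t ^ k • s', Submodule.add_mem _ hs (Submodule.smul_mem _ _ hs'), fun i => ?_⟩
      have : x i - (s + t ^ k • s') i = t ^ k * (z i - s' i) := by
        simp only [Pi.add_apply, Pi.smul_apply, smul_eq_mul, mul_sub, ← hz]; ring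
      rw [this, pow_succ, ← Ideal.span_singleton_mul_span_singleton]
      exact Ideal.mul_mem_mul (Ideal.mem_span_singleton_self _) (hzs i)
  have hmap : (Ideal.span {t}).map (frobenius R p) = Ideal.span {t ^ p} := by
    rw [Ideal.map_span, Set.image_singleton, frobenius_def]
  intro ι _ f x hx
  rw [hmap] at hx ⊢
  exact key p le_rfl ι f x hx

theorem flatMod_frobenius_of_regular (p : ℕ) [Fact p.Prime] (n : ℕ) : ∀ (R : Type) [CommRing R]
    [IsLocalRing R] [IsNoetherianRing R] [CharP R p] (t : Fin n → R),
    Ideal.span (Set.range t) = IsLocalRing.maximalIdeal R → ringKrullDim R = n →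
    FlatMod (frobenius R p) ⊥ := by
  induction n with
  | zero =>
    intro R _ _ _ _ t ht _
    have : IsField R := by
      rw [IsLocalRing.isField_iff_maximalIdeal_eq, ← ht]
      simp
    let := this.toField
    exact FlatMod.of_field (frobenius R p)
  | succ n IH =>
    intro R _ _ _ _ t ht hd
    have hdom := isDomain_of_regular _ R t ht hd
    have h0 : t 0 ∈ IsLocalRing.maximalIdeal R := ht ▸ Ideal.subset_span ⟨0, rfl⟩
    obtain ⟨hl, hg, hd'⟩ := regular_quotient t ht hd
    have : CharP (R ⧸ Ideal.span {t 0}) p := by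
      have h1 : ((p : ℕ) : R ⧸ Ideal.span {t 0}) = 0 := by
        rw [← map_natCast (Ideal.Quotient.mk (Ideal.span {t 0})), CharP.cast_eq_zero, map_zero]
      exact (CharP.charP_iff_prime_eq_zero Fact.out).2 h1
    have h2 := IH _ _ hg hd'
    have ht0 : t 0 ≠ 0 := by
      intro h
      have e : ringKrullDim (R ⧸ Ideal.span {t 0}) = ringKrullDim R := by
        rw [h, Ideal.span_singleton_zero]
        exact ringKrullDim_eq_of_ringEquiv (RingEquiv.quotientBot R)
      rw [hd', hd] at e
      have : n = n + 1 := by exact_mod_cast e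
      omega
    refine FlatMod.of_regular_element (t := t 0) ?_ ?_ (flatMod_frobenius_span_singleton p (t 0) ht0 h2)
    · rw [frobenius_def]
      exact Ideal.pow_mem_of_mem _ h0 _ (Fact.out : p.Prime).pos
    · intro b hb
      rw [frobenius_def] at hb
      exact (mul_eq_zero.1 hb).resolve_left (pow_ne_zero p ht0)

end Flatness

section PBasis
open MvPolynomial

variable {K : Type} [Field K] (p : ℕ) [Fact p.Prime] [CharP K p]

/-- `p`-independence of a family of elements of a field of characteristic `p`. -/
def PIndep {ι : Type} (y : ι → K) : Prop :=
  ∀ g : MvPolynomial ι K, (∀ w ∈ g.support, ∀ k, w k < p) → eval₂ (frobenius K p) y g = 0 → g = 0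

/-- A `p`-basis of a field of characteristic `p`. -/
def IsPBasis {ι : Type} (y : ι → K) : Prop :=
  PIndep p y ∧ ∀ x, ∃ g : MvPolynomial ι K, eval₂ (frobenius K p) y g = x

variable {p}

theorem PIndep.comp {ι κ : Type} {y : ι → K} (h : PIndep p y) (e : κ ↪ ι) :
    PIndep p (y ∘ e) := by
  intro g hg h0
  rw [← eval₂_rename] at h0
  refine rename_injective e e.injective ?_
  rw [map_zero]
  refine h _ ?_ h0
  intro w hw k
  rw [support_rename_of_injective e.injective, Finset.mem_image] at hw
  obtain ⟨v, hv, rfl⟩ := hw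
  by_cases hk : k ∈ Set.range e
  · obtain ⟨l, rfl⟩ := hk
    rw [Finsupp.mapDomain_apply e.injective]
    exact hg v hv l
  · rw [Finsupp.mapDomain_of_notMem_range _ _ hk]
    exact (Fact.out : p.Prime).pos

theorem PIndep.of_finset {ι : Type} {y : ι → K}
    (h : ∀ s : Finset ι, PIndep p (fun i : s => y i)) : PIndep p y := by
  intro g hg h0
  obtain ⟨s, q, rfl⟩ := exists_finset_rename g
  rw [eval₂_rename] at h0
  rw [h s q _ h0, map_zero]
  intro w hw k
  have := hg (w.mapDomain (↑)) (by
    rw [support_rename_of_injective Subtype.val_injective]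
    exact Finset.mem_image_of_mem _ hw) k
  rwa [Finsupp.mapDomain_apply Subtype.val_injective] at this

/-- The subfield generated by `p`-th powers and the members of a family. -/
noncomputable def pSpan (p : ℕ) [Fact p.Prime] [CharP K p] {ι : Type} (y : ι → K) : Subfield K where
  __ := (eval₂Hom (frobenius K p) y).range
  inv_mem' := by
    rintro x ⟨g, hg⟩
    by_cases hx : x = 0
    · subst hx; exact ⟨0, by simp⟩
    refine ⟨g ^ (p - 1) * C x⁻¹, ?_⟩
    rw [map_mul, map_pow, hg]
    simp only [coe_eval₂Hom, eval₂_C, frobenius_def]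
    obtain ⟨k, hk⟩ := Nat.exists_eq_succ_of_ne_zero (Fact.out : p.Prime).ne_zero
    rw [hk]
    rw [Nat.succ_sub_one, pow_succ, inv_pow]
    field_simp

theorem mem_pSpan {ι : Type} {y : ι → K} {x : K} :
    x ∈ pSpan p y ↔ ∃ g : MvPolynomial ι K, eval₂ (frobenius K p) y g = x := Iff.rfl

theorem pow_mem_pSpan {ι : Type} (y : ι → K) (x : K) : x ^ p ∈ pSpan p y :=
  ⟨C x, by simp [frobenius_def]⟩

theorem PIndep.option {ι : Type} {y : ι → K} (h : PIndep p y) {x : K} (hx : x ∉ pSpan p y) :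
    PIndep p (fun o : Option ι => o.elim x y) := by
  intro g hg h0
  set H := optionEquivLeft K ι g with hH
  let ev : MvPolynomial ι K →+* pSpan p y := (eval₂Hom (frobenius K p) y).rangeRestrict
  have hev : ∀ f, ((ev f : pSpan p y) : K) = eval₂ (frobenius K p) y f := fun f => rfl
  have h1 : Polynomial.eval₂ (algebraMap (pSpan p y) K) x (H.map ev) = 0 := by
    rw [← h0, Polynomial.eval₂_map]
    have : ((Polynomial.eval₂RingHom ((algebraMap (pSpan p y) K).comp ev) x).comp
        (optionEquivLeft K ι : MvPolynomial (Option ι) K →+* Polynomial (MvPolynomial ι K))) =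
        eval₂Hom (frobenius K p) (fun o : Option ι => o.elim x y) := by
      apply MvPolynomial.ringHom_ext
      · intro r
        have e : (optionEquivLeft K ι) (C r) = Polynomial.C (C r) := optionEquivLeft_C ..
        simp only [RingHom.comp_apply, RingHom.coe_coe, e, Polynomial.coe_eval₂RingHom,
          Polynomial.eval₂_C]
        change ((ev (C r) : pSpan p y) : K) = _
        rw [hev]; simp
      · rintro (_ | i)
        · have e : (optionEquivLeft K ι) (X none) = Polynomial.X := optionEquivLeft_X_none ..
          simp only [RingHom.comp_apply, RingHom.coe_coe, e, Polynomial.coe_eval₂RingHom,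
            Polynomial.eval₂_X]
          simp
        · have e : (optionEquivLeft K ι) (X (some i)) = Polynomial.C (X i) :=
            optionEquivLeft_X_some ..
          simp only [RingHom.comp_apply, RingHom.coe_coe, e, Polynomial.coe_eval₂RingHom,
            Polynomial.eval₂_C]
          change ((ev (X i) : pSpan p y) : K) = _
          rw [hev]; simp
    exact congrArg (fun f => f g) this
  have hirr : Irreducible (Polynomial.X ^ p - Polynomial.C (⟨x ^ p, pow_mem_pSpan y x⟩ : pSpan p y)) := by
    refine X_pow_sub_C_irreducible_of_prime Fact.out fun b hb => hx ?_
    have : (b : K) ^ p = x ^ p := congrArg Subtype.val hb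
    rw [← frobenius_inj K p this]
    exact b.2
  have h2 : H.map ev = 0 := by
    by_contra hne
    have h3 := minpoly.degree_le_of_ne_zero (pSpan p y) x hne h1
    replace h3 := Polynomial.natDegree_le_natDegree h3
    rw [← minpoly.eq_of_irreducible_of_monic hirr ?_ (Polynomial.monic_X_pow_sub_C _
      (Fact.out : p.Prime).ne_zero), Polynomial.natDegree_X_pow_sub_C] at h3
    · have h4 : (H.map ev).natDegree ≤ g.degreeOf none := by
        rw [← natDegree_optionEquivLeft]; exact Polynomial.natDegree_map_le
      have h5 : g.degreeOf none < p := by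
        rw [degreeOf_lt_iff (Fact.out : p.Prime).pos]
        exact fun w hw => hg w hw _
      omega
    · simp only [map_sub, map_pow, Polynomial.aeval_X, Polynomial.aeval_C]
      exact sub_self _
  have h3 : ∀ i, H.coeff i = 0 := by
    intro i
    refine h _ ?_ ?_
    · intro w hw k
      rw [mem_support_coeff_optionEquivLeft] at hw
      simpa using hg _ hw (some k)
    · have := congrArg (fun f => f.coeff i) h2
      simp only [Polynomial.coeff_map, Polynomial.coeff_zero] at this
      rw [← hev, this]; rfl
  have h4 : H = 0 := Polynomial.ext h3
  exact (EmbeddingLike.map_eq_zero_iff (f := optionEquivLeft K ι)).1 h4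

theorem exists_isPBasis (S : Set K) (hS : ∀ x : K, ∃ a ∈ S, ∃ b ∈ S, x = a / b) :
    ∃ B : Set K, B ⊆ S ∧ IsPBasis p (fun b : B => (b : K)) := by
  classical
  obtain ⟨B, hB⟩ := zorn_subset {B : Set K | B ⊆ S ∧ PIndep p (fun b : B => (b : K))} (by
    intro c hc hchain
    by_cases hne : c.Nonempty
    swap
    · refine ⟨∅, ⟨Set.empty_subset _, ?_⟩, fun s hs => (hne ⟨s, hs⟩).elim⟩
      intro g _ h0
      obtain ⟨a, rfl⟩ := C_surjective _ g
      rw [eval₂_C, frobenius_def] at h0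
      rw [eq_zero_of_pow_eq_zero h0, map_zero]
    refine ⟨⋃₀ c, ⟨Set.sUnion_subset fun s hs => (hc hs).1, PIndep.of_finset fun s => ?_⟩,
      fun s hs => Set.subset_sUnion_of_mem hs⟩
    have := hne.to_subtype
    obtain ⟨b, hb⟩ := Directed.exists_mem_subset_of_finset_subset_biUnion
      (f := fun b : c => (b : Set K)) (s := s.image Subtype.val)
      (fun u v => by
        rcases hchain.total u.2 v.2 with h | h
        · exact ⟨v, h, subset_rfl⟩
        · exact ⟨u, subset_rfl, h⟩) (by
        intro x hx
        simp only [Finset.coe_image, Set.mem_image] at hx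
        obtain ⟨y, _, rfl⟩ := hx
        rw [← Set.sUnion_eq_iUnion]
        exact y.2)
    exact (hc b.2).2.comp ⟨fun i : s => ⟨(i : ⋃₀ c).1, hb (Finset.mem_coe.2 (Finset.mem_image_of_mem _ i.2))⟩, fun i j hij => by
      have : i.1.1 = j.1.1 := congrArg (fun u : (b : Set K) => (u : K)) hij
      exact Subtype.ext (Subtype.ext this)⟩)
  obtain ⟨⟨hBS, hBi⟩, hmax⟩ := hB
  refine ⟨B, hBS, hBi, fun x => ?_⟩
  have key : ∀ x ∈ S, x ∈ pSpan p (fun b : B => (b : K)) := by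
    intro x hx
    by_contra hxn
    have hxB : x ∉ B := fun h => hxn ⟨X ⟨x, h⟩, by simp⟩
    have h1 : insert x B ⊆ B := by
      refine hmax ⟨Set.insert_subset hx hBS, ?_⟩ (Set.subset_insert _ _)
      have h2 := (hBi.option hxn).comp ((Equiv.Set.insert hxB).trans (Equiv.optionEquivSumPUnit.{0} B).symm).toEmbedding
      convert h2 using 1
      funext ⟨b, hb⟩
      rcases hb with rfl | hb
      · simp
      · have : b ≠ x := fun h => hxB (h ▸ hb)
        have e : (⟨b, Set.mem_insert_of_mem _ hb⟩ : (insert x B : Set K)) =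
          (⟨((⟨b, hb⟩ : B) : K), Or.inr hb⟩ : (insert x B : Set K)) := rfl
        simp only [Function.comp, Equiv.coe_toEmbedding, Equiv.trans_apply]
        rw [e, Equiv.Set.insert_apply_right hxB ⟨b, hb⟩]
        simp
    exact hxB (h1 (Set.mem_insert _ _))
  obtain ⟨a, ha, b, hb, rfl⟩ := hS x
  exact mem_pSpan.1 ((pSpan p _).div_mem (key a ha) (key b hb))

end PBasis

section Saturation
variable {R : Type} [CommRing R] (Q : Ideal R) [hQ : Q.IsPrime]

/-- The contraction of the localization of `I` at the prime ideal `Q`. -/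
def satIdeal (I : Ideal R) : Ideal R where
  carrier := {x | ∃ s, s ∉ Q ∧ s * x ∈ I}
  zero_mem' := ⟨1, hQ.one_notMem, by simp⟩
  add_mem' := by
    rintro a b ⟨s, hs, hsa⟩ ⟨u, hu, hub⟩
    refine ⟨s * u, fun h => (hQ.mem_or_mem h).elim hs hu, ?_⟩
    have : s * u * (a + b) = u * (s * a) + s * (u * b) := by ring
    rw [this]
    exact I.add_mem (I.mul_mem_left _ hsa) (I.mul_mem_left _ hub)
  smul_mem' := by
    rintro c x ⟨s, hs, hsx⟩
    refine ⟨s, hs, ?_⟩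
    rw [smul_eq_mul, mul_left_comm]
    exact I.mul_mem_left _ hsx

variable {Q}

theorem le_satIdeal (I : Ideal R) : I ≤ satIdeal Q I :=
  fun x hx => ⟨1, hQ.one_notMem, by simpa using hx⟩

theorem satIdeal_mono {I J : Ideal R} (h : I ≤ J) : satIdeal Q I ≤ satIdeal Q J :=
  fun _ ⟨s, hs, hx⟩ => ⟨s, hs, h hx⟩

theorem mem_satIdeal_of_mul_mem {I : Ideal R} {s x : R} (hs : s ∉ Q) (h : s * x ∈ satIdeal Q I) :
    x ∈ satIdeal Q I := by
  obtain ⟨u, hu, hux⟩ := h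
  exact ⟨u * s, fun h => (hQ.mem_or_mem h).elim hu hs, by rwa [mul_assoc]⟩

theorem satIdeal_le_self {I : Ideal R} (h : I ≤ Q) : satIdeal Q I ≤ Q :=
  fun _ ⟨_, hs, hx⟩ => (hQ.mem_or_mem (h hx)).resolve_left hs

/-- Independence in the sense of Lech of a family after localization at `Q`. -/
def LechIndep (Q : Ideal R) [Q.IsPrime] {ι : Type} [Fintype ι] (y : ι → R) : Prop :=
  ∀ r : ι → R, ∑ i, r i * y i = 0 → ∀ i, r i ∈ satIdeal Q (Ideal.span (Set.range y))

theorem span_le_span_update {ι : Type} {y : ι → R} {k : ι} {f g : R} (hy : y k = f * g) :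
    Ideal.span (Set.range y) ≤ Ideal.span (Set.range (Function.update y k g)) := by
  rw [Ideal.span_le]
  rintro _ ⟨i, rfl⟩
  by_cases hi : i = k
  · subst hi
    rw [hy]
    exact Ideal.mul_mem_left _ _ (Ideal.subset_span ⟨i, by simp⟩)
  · exact Ideal.subset_span ⟨i, by simp [hi]⟩

theorem LechIndep.mem_of_mul_mem {ι : Type} [Fintype ι] {y : ι → R} (h : LechIndep Q y)
    {k : ι} {f g z : R} (hy : y k = f * g) (hz : f * z ∈ satIdeal Q (Ideal.span (Set.range y))) :
    z ∈ satIdeal Q (Ideal.span (Set.range (Function.update y k g))) := by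
  obtain ⟨s, hs, hsz⟩ := hz
  obtain ⟨c, hc⟩ := (Submodule.mem_span_range_iff_exists_fun R).1 hsz
  simp only [smul_eq_mul] at hc
  have h1 : ∑ i, (Function.update (fun i => - c i * g) k (s * z - c k * g)) i * y i = 0 := by
    have h2 : ∀ i, (Function.update (fun i => - c i * g) k (s * z - c k * g)) i * y i =
        g * (- (c i * y i)) + if i = k then s * z * y k else 0 := by
      intro i
      by_cases hi : i = k
      · subst hi; simp; ring
      · simp [hi]; ring
    rw [Finset.sum_congr rfl fun i _ => h2 i, Finset.sum_add_distrib, ← Finset.mul_sum,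
      Finset.sum_neg_distrib, hc, Finset.sum_ite_eq' Finset.univ k, if_pos (Finset.mem_univ _), hy]
    ring
  have h3 := satIdeal_mono (span_le_span_update hy) (h _ h1 k)
  rw [Function.update_self] at h3
  refine mem_satIdeal_of_mul_mem hs ?_
  rw [← sub_add_cancel (s * z) (c k * g)]
  refine Ideal.add_mem _ h3 (Ideal.mul_mem_left _ _ (le_satIdeal _ ?_))
  exact Ideal.subset_span ⟨k, by simp⟩

theorem LechIndep.update {ι : Type} [Fintype ι] {y : ι → R} (h : LechIndep Q y)
    {k : ι} {f g : R} (hy : y k = f * g) : LechIndep Q (Function.update y k g) := by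
  intro r hr
  have h1 : ∑ i, (if i = k then r i else f * r i) * y i = 0 := by
    rw [← mul_zero f, ← hr, Finset.mul_sum]
    refine Finset.sum_congr rfl fun i _ => ?_
    by_cases hi : i = k
    · subst hi; simp [hy]; ring
    · simp [hi]; ring
  intro i
  have h2 := h _ h1 i
  by_cases hi : i = k
  · subst hi
    simp only [if_true] at h2
    exact satIdeal_mono (span_le_span_update hy) h2
  · simp only [hi, if_false] at h2
    exact h.mem_of_mul_mem hy h2

theorem mem_of_mul_prod_pow_mem {ι : Type} [Fintype ι] {t : ι → R} {p : ℕ} (hp : 0 < p)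
    (ht : ∀ i, t i ∈ Q) (h : LechIndep Q (fun i => t i ^ p)) {e : R}
    (he : e * ∏ i, t i ^ (p - 1) ∈ satIdeal Q (Ideal.span (Set.range fun i => t i ^ p))) : e ∈ Q := by
  have key : ∀ S : Finset ι, LechIndep Q (fun i => if i ∈ S then t i else t i ^ p) ∧
      e * ∏ i ∈ Sᶜ, t i ^ (p - 1) ∈
        satIdeal Q (Ideal.span (Set.range fun i => if i ∈ S then t i else t i ^ p)) := by
    intro S
    induction S using Finset.induction_on with
    | empty => simpa using ⟨h, he⟩
    | insert k S hk IH =>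
      have h1 : (fun i => if i ∈ insert k S then t i else t i ^ p) =
          Function.update (fun i => if i ∈ S then t i else t i ^ p) k (t k) := by
        funext i
        by_cases hi : i = k
        · subst hi; simp
        · simp [hi]
      have hy : (fun i => if i ∈ S then t i else t i ^ p) k = t k ^ (p - 1) * t k := by
        rw [← pow_succ, Nat.sub_add_cancel hp]; simp [hk]
      rw [h1]
      refine ⟨IH.1.update hy, IH.1.mem_of_mul_mem hy ?_⟩
      have h2 : ∏ i ∈ Sᶜ, t i ^ (p - 1) = t k ^ (p - 1) * ∏ i ∈ (insert k S)ᶜ, t i ^ (p - 1) := by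
        rw [← Finset.mul_prod_erase Sᶜ _ (Finset.mem_compl.2 hk), ← Finset.compl_insert]
      rw [mul_left_comm, ← h2]
      exact IH.2
  have := (key Finset.univ).2
  simp only [Finset.compl_univ, Finset.prod_empty, mul_one, Finset.mem_univ, if_true] at this
  refine satIdeal_le_self ?_ this
  rw [Ideal.span_le]
  rintro _ ⟨i, rfl⟩
  exact ht i

variable (Q) in
theorem exists_minimal_generators [IsNoetherianRing R] : ∃ (ι : Type) (_ : Fintype ι) (t : ι → R),
    (∀ i, t i ∈ Q) ∧ (∃ s ∉ Q, ∀ x ∈ Q, s * x ∈ Ideal.span (Set.range t)) ∧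
    ∀ d : ι → R, ∑ i, d i * t i = 0 → ∀ i, d i ∈ Q := by
  let P : ℕ → Prop := fun n => ∃ S : Finset R, S.card = n ∧ (∀ x ∈ S, x ∈ Q) ∧
    ∃ s ∉ Q, ∀ x ∈ Q, s * x ∈ Ideal.span (S : Set R)
  have hP : ∃ n, P n := by
    obtain ⟨S, hS⟩ := IsNoetherian.noetherian Q
    refine ⟨_, S, rfl, fun x hx => hS ▸ Submodule.subset_span hx, 1, hQ.one_notMem,
      fun x hx => ?_⟩
    rw [one_mul]
    change x ∈ Submodule.span R (S : Set R)
    rwa [hS]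
  obtain ⟨S, hc, hSQ, s, hs, hsx⟩ := Nat.find_spec hP
  refine ⟨S, inferInstance, fun x => x, fun i => hSQ _ i.2, ⟨s, hs, by simpa using hsx⟩, ?_⟩
  intro d hd i
  by_contra hi
  have hlt : (S.erase i).card < Nat.find hP := by
    rw [← hc]; exact Finset.card_erase_lt_of_mem i.2
  refine Nat.find_min hP hlt ⟨S.erase i, rfl, fun x hx => hSQ x (Finset.mem_of_mem_erase hx),
    d i * s, fun h => (hQ.mem_or_mem h).elim hi hs, fun x hx => ?_⟩
  have h1 := hsx x hx
  have h2 : ∀ y ∈ Ideal.span (S : Set R), d i * y ∈ Ideal.span ((S.erase i : Finset R) : Set R) := by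
    intro y hy
    induction hy using Submodule.span_induction with
    | mem y hy =>
      by_cases hyi : y = i
      · subst hyi
        have h3 := Fintype.sum_eq_add_sum_compl i (fun j : S => d j * (j : R))
        rw [hd, eq_comm, add_eq_zero_iff_eq_neg] at h3
        rw [h3]
        refine Submodule.neg_mem _ (Ideal.sum_mem _ fun j hj => Ideal.mul_mem_left _ _
          (Ideal.subset_span ?_))
        simp only [Finset.coe_erase, Set.mem_sdiff, Set.mem_singleton_iff]
        refine ⟨j.2, fun h => ?_⟩
        simp at hj
        exact hj (Subtype.ext h)
      · exact Ideal.mul_mem_left _ _ (Ideal.subset_span (by simpa [hyi] using hy))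
    | zero => simp
    | add a b _ _ ha hb => rw [mul_add]; exact Ideal.add_mem _ ha hb
    | smul c a _ ha => rw [smul_eq_mul, mul_left_comm]; exact Ideal.mul_mem_left _ _ ha
  rw [mul_assoc]
  exact h2 _ h1

end Saturation

section Fibre
open MvPolynomial

variable {R A κ : Type} [CommRing R] [CommRing A] [Algebra A R] [Field κ] {p : ℕ} [Fact p.Prime]
  [CharP κ p] {φ : R →+* A} {π : R →+* κ}

theorem frobenius_apply_eq_of_factor (hφ : ∀ x, algebraMap A R (φ x) = x ^ p) (x : R) :
    π (algebraMap A R (φ x)) = frobenius κ p (π x) := by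
  rw [hφ, map_pow, frobenius_def]

/-- Independence of the monomials in generators of `Q` and lifts of a `p`-basis of the residue
field. -/
theorem coeff_mem_of_aeval_mem {Q : Ideal R} [Q.IsPrime] {q : Ideal A} [q.IsPrime]
    (hφ : ∀ x, algebraMap A R (φ x) = x ^ p)
    (hsurj : Function.Surjective φ) (hπ : ∀ x, π x = 0 ↔ x ∈ Q) (hq : ∀ x, φ x ∈ q ↔ x ∈ Q)
    {ι B : Type} [Fintype ι] {t : ι → R} {y : B → R} (ht : ∀ i, t i ∈ Q)
    (hlech : LechIndep Q (fun i => t i ^ p))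
    (hsat : q.map (algebraMap A R) ≤ satIdeal Q (Ideal.span (Set.range fun i => t i ^ p)))
    (hy : PIndep p (fun b => π (y b))) {h : MvPolynomial (ι ⊕ B) A}
    (hdeg : ∀ w ∈ h.support, ∀ k, w k < p)
    (hh : aeval (Sum.elim t y) h ∈ q.map (algebraMap A R)) (m : (ι ⊕ B) →₀ ℕ) : coeff m h ∈ q := by
  by_contra hm
  have hp : 0 < p := (Fact.out : p.Prime).pos
  set I := satIdeal Q (Ideal.span (Set.range fun i => t i ^ p)) with hI
  have hbad : (h.support.filter fun m => coeff m h ∉ q).Nonempty :=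
    ⟨m, Finset.mem_filter.2 ⟨mem_support_iff.2 fun h0 => hm (h0 ▸ q.zero_mem), hm⟩⟩
  obtain ⟨m0, hm0, hmin⟩ := Finset.exists_min_image _ (fun m => ∑ i, m (Sum.inl i)) hbad
  simp only [Finset.mem_filter, mem_support_iff] at hm0 hmin
  let w : ((ι ⊕ B) →₀ ℕ) → (B →₀ ℕ) := fun m => m.comapDomain Sum.inr Sum.inr_injective.injOn
  let W : ((ι ⊕ B) →₀ ℕ) → R := fun m => (w m).prod fun b n => y b ^ n
  have hmon : ∀ m : (ι ⊕ B) →₀ ℕ, (m.prod fun k n => (Sum.elim t y k) ^ n) =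
      (∏ i, t i ^ m (Sum.inl i)) * W m := by
    intro m
    conv_lhs => rw [← Finsupp.comapDomain_sumElim_comapDomain m]
    rw [Finsupp.prod_sumElim]
    congr 1
    rw [Finsupp.prod_fintype _ _ (by simp)]
    rfl
  have hsum : aeval (Sum.elim t y) h = ∑ m ∈ h.support,
      algebraMap A R (coeff m h) * ((∏ i, t i ^ m (Sum.inl i)) * W m) := by
    rw [aeval_def, eval₂_eq]
    refine Finset.sum_congr rfl fun m _ => ?_
    rw [← hmon]; rfl
  set S0 := h.support.filter fun m => ∀ i, m (Sum.inl i) = m0 (Sum.inl i) with hS0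
  have hdeg0 : ∀ k, m0 k < p := hdeg m0 (mem_support_iff.2 hm0.1)
  have hE : (∑ m ∈ S0, algebraMap A R (coeff m h) * W m) * ∏ i, t i ^ (p - 1) ∈ I := by
    have h1 : aeval (Sum.elim t y) h * ∏ i, t i ^ (p - 1 - m0 (Sum.inl i)) ∈ I :=
      Ideal.mul_mem_right _ _ (hsat hh)
    rw [hsum, Finset.sum_mul, ← Finset.sum_filter_add_sum_filter_not h.support
      (fun m => ∀ i, m (Sum.inl i) = m0 (Sum.inl i))] at h1
    have h2 : ∑ m ∈ h.support with ¬ ∀ i, m (Sum.inl i) = m0 (Sum.inl i),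
        algebraMap A R (coeff m h) * ((∏ i, t i ^ m (Sum.inl i)) * W m) *
          ∏ i, t i ^ (p - 1 - m0 (Sum.inl i)) ∈ I := by
      refine Ideal.sum_mem _ fun m hm => ?_
      rw [Finset.mem_filter, mem_support_iff] at hm
      by_cases hmq : coeff m h ∈ q
      · exact Ideal.mul_mem_right _ _ (Ideal.mul_mem_right _ _
          (hsat (Ideal.mem_map_of_mem _ hmq)))
      · have hle := hmin m ⟨hm.1, hmq⟩
        have : ∃ i, m0 (Sum.inl i) < m (Sum.inl i) := by
          by_contra! hcon
          refine hm.2 fun i => ?_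
          have := (Finset.sum_eq_sum_iff_of_le fun i _ => hcon i).1
            (le_antisymm (Finset.sum_le_sum fun i _ => hcon i) hle)
          exact this i (Finset.mem_univ i)
        obtain ⟨i, hi⟩ := this
        have h3 : t i ^ p ∣ (∏ i, t i ^ m (Sum.inl i)) * ∏ i, t i ^ (p - 1 - m0 (Sum.inl i)) := by
          rw [← Finset.prod_mul_distrib]
          refine dvd_trans ?_ (Finset.dvd_prod_of_mem _ (Finset.mem_univ i))
          rw [← pow_add]
          exact pow_dvd_pow _ (by have := hdeg0 (Sum.inl i); omega)
        obtain ⟨c, hc⟩ := h3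
        have h4 : algebraMap A R (coeff m h) * ((∏ i, t i ^ m (Sum.inl i)) * W m) *
          ∏ i, t i ^ (p - 1 - m0 (Sum.inl i)) =
            algebraMap A R (coeff m h) * W m * c * t i ^ p := by
          linear_combination algebraMap A R (coeff m h) * W m * hc
        rw [h4]
        exact Ideal.mul_mem_left _ _ (le_satIdeal _ (Ideal.subset_span ⟨i, rfl⟩))
    have h5 := Ideal.sub_mem _ h1 h2
    rw [add_sub_cancel_right] at h5
    convert h5 using 1
    rw [Finset.sum_mul]
    refine Finset.sum_congr rfl fun m hm => ?_
    rw [Finset.mem_filter] at hm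
    have h6 : (∏ i, t i ^ m (Sum.inl i)) * ∏ i, t i ^ (p - 1 - m0 (Sum.inl i)) =
        ∏ i, t i ^ (p - 1) := by
      rw [← Finset.prod_mul_distrib]
      refine Finset.prod_congr rfl fun i _ => ?_
      rw [← pow_add, hm.2 i]
      have := hdeg0 (Sum.inl i)
      congr 1; omega
    rw [← h6]; ring
  have hEQ := mem_of_mul_prod_pow_mem hp ht hlech hE
  choose ψ hψ using hsurj
  let G : MvPolynomial B κ := ∑ m ∈ S0, monomial (w m) (π (ψ (coeff m h)))
  have hwinj : ∀ m ∈ S0, ∀ m' ∈ S0, w m = w m' → m = m' := by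
    intro m hm m' hm' hw
    rw [Finset.mem_filter] at hm hm'
    ext (i | b)
    · rw [hm.2, hm'.2]
    · exact DFunLike.congr_fun hw b
  have hcoeff : ∀ m ∈ S0, coeff (w m) G = π (ψ (coeff m h)) := by
    intro m hm
    rw [coeff_sum, Finset.sum_eq_single m]
    · rw [coeff_monomial, if_pos rfl]
    · intro m' hm' hne
      rw [coeff_monomial, if_neg fun h => hne (hwinj _ hm' _ hm h)]
    · exact fun h => (h hm).elim
  have hG : G = 0 := by
    refine hy G ?_ ?_
    · intro v hv b
      have := support_sum hv
      simp only [Finset.mem_biUnion] at this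
      obtain ⟨m, hm, hv⟩ := this
      have := support_monomial_subset hv
      rw [Finset.mem_singleton] at this
      rw [this]
      exact hdeg m (Finset.mem_filter.1 hm).1 (Sum.inr b)
    · rw [← coe_eval₂Hom, map_sum]
      rw [← hπ, map_sum] at hEQ
      rw [← hEQ]
      refine Finset.sum_congr rfl fun m _ => ?_
      rw [coe_eval₂Hom, eval₂_monomial, map_mul, ← frobenius_apply_eq_of_factor hφ, hψ,
        map_finsuppProd]
      simp only [map_pow]
  have hm0S : m0 ∈ S0 := Finset.mem_filter.2 ⟨mem_support_iff.2 hm0.1, fun i => rfl⟩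
  have h7 := hcoeff m0 hm0S
  rw [hG, coeff_zero, eq_comm, hπ, ← hq, hψ] at h7
  exact hm0.2 h7

theorem exists_pow_mul_sub_aeval_mem {Q : Ideal R} [hQ : Q.IsPrime]
    (hφ : ∀ x, algebraMap A R (φ x) = x ^ p) (hπ : ∀ x, π x = 0 ↔ x ∈ Q)
    (hfrac : ∀ x : κ, ∃ a s, s ∉ Q ∧ x = π a / π s)
    {N : Type} {t : N → R} {ι B : Type} [Fintype ι] {e₁ : ι → N} {e₂ : B → N}
    (hy : ∀ x, ∃ g : MvPolynomial B κ, eval₂ (frobenius κ p) (fun b => π (t (e₂ b))) g = x)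
    (ht : ∀ i, t (e₁ i) ∈ Q) (hgen : ∃ s ∉ Q, ∀ x ∈ Q, s * x ∈ Ideal.span (Set.range (t ∘ e₁)))
    (k : ℕ) (x : R) : ∃ s ∉ Q, ∃ F : MvPolynomial N A, s ^ p * x - aeval t F ∈ Q ^ k := by
  have h0 : ∀ s ∉ Q, π s ≠ 0 := fun s hs h => hs ((hπ s).1 h)
  have hmul : ∀ {s u : R}, s ∉ Q → u ∉ Q → s * u ∉ Q := fun hs hu h =>
    (hQ.mem_or_mem h).elim hs hu
  have hres : ∀ g : MvPolynomial B κ, ∃ s ∉ Q, ∃ F : MvPolynomial N A,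
      π s ^ p * eval₂ (frobenius κ p) (fun b => π (t (e₂ b))) g = π (aeval t F) := by
    intro g
    induction g using MvPolynomial.induction_on with
    | C a =>
      obtain ⟨c, s, hs, rfl⟩ := hfrac a
      refine ⟨s, hs, C (φ c), ?_⟩
      rw [eval₂_C, aeval_C, frobenius_apply_eq_of_factor hφ, frobenius_def, frobenius_def,
        ← mul_pow, mul_div_cancel₀ _ (h0 s hs)]
    | add f g hf hg =>
      obtain ⟨s, hs, F, hF⟩ := hf
      obtain ⟨u, hu, G, hG⟩ := hg
      refine ⟨s * u, hmul hs hu, C (φ u) * F + C (φ s) * G, ?_⟩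
      simp only [eval₂_add, map_add, map_mul, aeval_C, ← hF, ← hG, hφ, map_pow]
      ring
    | mul_X f b hf =>
      obtain ⟨s, hs, F, hF⟩ := hf
      refine ⟨s, hs, F * X (e₂ b), ?_⟩
      rw [eval₂_mul, eval₂_X, map_mul, map_mul, aeval_X, ← hF, mul_assoc]
  have hone : ∀ x, ∃ s ∉ Q, ∃ F : MvPolynomial N A, s ^ p * x - aeval t F ∈ Q := by
    intro x
    obtain ⟨g, hg⟩ := hy (π x)
    obtain ⟨s, hs, F, hF⟩ := hres g
    refine ⟨s, hs, F, ?_⟩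
    rw [← hπ, map_sub, ← hF, hg, map_mul, map_pow, sub_self]
  obtain ⟨s₁, hs₁, hs₁'⟩ := hgen
  have hp : p ≠ 0 := (Fact.out : p.Prime).ne_zero
  induction k generalizing x with
  | zero => exact ⟨1, hQ.one_notMem, 0, by simp⟩
  | succ k IH =>
    obtain ⟨s, hs, F, hF⟩ := hone x
    obtain ⟨c, hc⟩ := (Submodule.mem_span_range_iff_exists_fun R).1 (hs₁' _ hF)
    simp only [smul_eq_mul, Function.comp] at hc
    choose u hu G hG using fun i => IH (s₁ ^ (p - 1) * c i)
    let U := ∏ i : ι, u i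
    let V := fun i => ∏ j ∈ Finset.univ.erase i, u j
    have hUV : ∀ i, U = u i * V i := fun i => (Finset.mul_prod_erase _ _ (Finset.mem_univ i)).symm
    have hU : U ∉ Q := by
      have : U ∈ Q.primeCompl := Submonoid.prod_mem _ fun i _ => hu i
      exact this
    refine ⟨U * s₁ * s, hmul (hmul hU hs₁) hs, C (φ (U * s₁)) * F +
      ∑ i, C (φ (V i)) * G i * X (e₁ i), ?_⟩
    have h1 : (U * s₁ * s) ^ p * x - aeval t (C (φ (U * s₁)) * F +
        ∑ i, C (φ (V i)) * G i * X (e₁ i)) =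
        ∑ i, V i ^ p * (((u i) ^ p * (s₁ ^ (p - 1) * c i) - aeval t (G i)) * t (e₁ i)) := by
      have h2 : (U * s₁ * s) ^ p * x - (U * s₁) ^ p * aeval t F =
          ∑ i, (V i * u i) ^ p * (s₁ ^ (p - 1) * (c i * t (e₁ i))) := by
        have h3 : s₁ ^ p = s₁ ^ (p - 1) * s₁ := by rw [← pow_succ, Nat.sub_add_cancel
          (Nat.one_le_iff_ne_zero.2 hp)]
        calc _ = U ^ p * s₁ ^ p * (s ^ p * x - aeval t F) := by ring
          _ = U ^ p * s₁ ^ (p - 1) * ∑ i, c i * t (e₁ i) := by rw [hc, h3]; ring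
          _ = _ := by
            rw [Finset.mul_sum]
            refine Finset.sum_congr rfl fun i _ => ?_
            rw [hUV i]; ring
      simp only [map_add, map_mul, aeval_C, map_sum, aeval_X, hφ]
      rw [← sub_sub, ← mul_pow, h2, ← Finset.sum_sub_distrib]
      refine Finset.sum_congr rfl fun i _ => ?_
      ring
    rw [h1]
    refine Ideal.sum_mem _ fun i _ => Ideal.mul_mem_left _ _ ?_
    rw [pow_succ]
    exact Ideal.mul_mem_mul (hG i) (ht i)

end Fibre

section Lift
open MvPolynomial

variable {R : Type} [CommRing R] {p : ℕ} [Fact p.Prime]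
  [CharP R p]

theorem mem_map_colon_of_flat (hflat : FlatMod (frobenius R p) ⊥)
    (J : Ideal (frobenius R p).range) (a : (frobenius R p).range) (r : R)
    (h : algebraMap _ R a * r ∈ J.map (algebraMap _ R)) :
    r ∈ (J.colon {a}).map (algebraMap _ R) := by
  let φ := (frobenius R p).rangeRestrict
  obtain ⟨α, hα⟩ : ∃ α, φ α = a := (frobenius R p).rangeRestrict_surjective a
  have hφ : ∀ x, algebraMap (frobenius R p).range R (φ x) = x ^ p := fun x => rfl
  rw [Ideal.map] at h
  obtain ⟨n, c, g, hg⟩ := Submodule.mem_span_set'.1 h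
  choose j hj hj' using fun i => (g i).2
  choose b hb using fun i => (frobenius R p).rangeRestrict_surjective (j i)
  obtain ⟨s, hs, hsx⟩ := hflat (Option (Fin n)) (fun o => o.elim α b)
    (fun o => o.elim r fun i => - c i) (by
      rw [Ideal.map_bot, Ideal.mem_bot, Fintype.sum_option]
      have : ∀ i, frobenius R p (b i) = g i := fun i => by
        rw [← hj' i, ← hb i]; rfl
      simp only [Option.elim_none, Option.elim_some, this, mul_neg, Finset.sum_neg_distrib]
      have h2 : frobenius R p α = algebraMap (frobenius R p).range R a := by rw [← hα]; rfl
      rw [h2, ← hg]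
      simp [mul_comm])
  have h1 := hsx none
  rw [Ideal.map_bot, Ideal.mem_bot, sub_eq_zero] at h1
  simp only [Option.elim_none] at h1
  obtain ⟨N, β, γ, hγ, hsβ⟩ := mem_syzSpan_iff.1 hs
  rw [h1, hsβ]
  refine Ideal.sum_mem _ fun u _ => Ideal.mul_mem_left _ _ ?_
  have h2 : frobenius R p (γ u none) = algebraMap (frobenius R p).range R (φ (γ u none)) := rfl
  rw [h2]
  refine Ideal.mem_map_of_mem _ ?_
  rw [Submodule.mem_colon_singleton, smul_eq_mul, ← hα, ← map_mul]
  have h3 := hγ u ()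
  rw [Ideal.mem_bot, Fintype.sum_option] at h3
  simp only [Option.elim_none, Option.elim_some] at h3
  rw [add_eq_zero_iff_eq_neg.1 h3, map_neg, map_sum]
  refine J.neg_mem (Ideal.sum_mem _ fun i _ => ?_)
  rw [map_mul, hb]
  exact Ideal.mul_mem_left _ _ (hj i)

theorem fibreCondition_of_flat [IsNoetherianRing R] (hflat : FlatMod (frobenius R p) ⊥)
    (q : Ideal (frobenius R p).range) (hq : q.IsPrime) : FibreCondition R p q := by
  let φ := (frobenius R p).rangeRestrict
  have hφ : ∀ x, algebraMap (frobenius R p).range R (φ x) = x ^ p := fun x => rfl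
  have hφs : Function.Surjective φ := (frobenius R p).rangeRestrict_surjective
  set Q := q.comap φ with hQ
  have hQp : Q.IsPrime := Ideal.comap_isPrime _ _
  let κ := FractionRing (R ⧸ Q)
  let π : R →+* κ := (algebraMap (R ⧸ Q) κ).comp (Ideal.Quotient.mk Q)
  have hπ : ∀ x, π x = 0 ↔ x ∈ Q := by
    intro x
    rw [RingHom.comp_apply, map_eq_zero_iff _ (IsFractionRing.injective (R ⧸ Q) κ),
      Ideal.Quotient.eq_zero_iff_mem]
  have : CharP κ p := by
    refine (CharP.charP_iff_prime_eq_zero Fact.out).2 ?_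
    rw [← map_natCast π, CharP.cast_eq_zero, map_zero]
  have hfrac : ∀ x : κ, ∃ a s, s ∉ Q ∧ x = π a / π s := by
    intro x
    obtain ⟨a, s, hs, rfl⟩ := IsFractionRing.div_surjective (A := R ⧸ Q) x
    obtain ⟨a, rfl⟩ := Ideal.Quotient.mk_surjective a
    obtain ⟨s, rfl⟩ := Ideal.Quotient.mk_surjective s
    refine ⟨a, s, fun h => ?_, rfl⟩
    rw [Ideal.Quotient.eq_zero_iff_mem.2 h] at hs
    exact zero_notMem_nonZeroDivisors hs
  obtain ⟨B, hBS, hB⟩ := exists_isPBasis (p := p) (Set.range π) (by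
    intro x
    obtain ⟨a, s, _, rfl⟩ := hfrac x
    exact ⟨_, ⟨a, rfl⟩, _, ⟨s, rfl⟩, rfl⟩)
  choose y hy using fun b : B => hBS b.2
  have hyB : (fun b : B => (b : κ)) = fun b => π (y b) := funext fun b => (hy b).symm
  rw [hyB] at hB
  obtain ⟨T, _, t, htQ, ⟨s, hs, hst⟩, htind⟩ := exists_minimal_generators Q
  have hpne : p ≠ 0 := (Fact.out : p.Prime).ne_zero
  have hpow : ∀ x ∈ Q, x ^ p ∈ q.map (algebraMap _ R) := fun x hx => by
    rw [← hφ]; exact Ideal.mem_map_of_mem _ hx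
  have hsat : q.map (algebraMap _ R) ≤ satIdeal Q (Ideal.span (Set.range fun i => t i ^ p)) := by
    rw [Ideal.map_le_iff_le_comap]
    intro a ha
    obtain ⟨x, rfl⟩ := hφs a
    refine ⟨s ^ p, fun h => hs (hQp.mem_of_pow_mem _ h), ?_⟩
    rw [hφ, ← mul_pow]
    obtain ⟨c, hc⟩ := (Submodule.mem_span_range_iff_exists_fun R).1 (hst x ha)
    rw [← hc, ← frobenius_def, map_sum]
    refine Ideal.sum_mem _ fun i _ => ?_
    rw [smul_eq_mul, map_mul]
    exact Ideal.mul_mem_left _ _ (Ideal.subset_span ⟨i, rfl⟩)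
  have hpowle : Ideal.span (Set.range fun i => t i ^ p) ≤ q.map (algebraMap _ R) := by
    rw [Ideal.span_le]
    rintro _ ⟨i, rfl⟩
    exact hpow _ (htQ i)
  have hlech : LechIndep Q (fun i => t i ^ p) := by
    intro r hr i
    obtain ⟨v, hv, hvr⟩ := hflat T t r (by
      rw [Ideal.map_bot, Ideal.mem_bot, ← hr]
      simp only [frobenius_def, mul_comm])
    have h1 := hvr i
    rw [Ideal.map_bot, Ideal.mem_bot, sub_eq_zero] at h1
    obtain ⟨N, β, γ, hγ, hsβ⟩ := mem_syzSpan_iff.1 hv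
    rw [h1, hsβ]
    exact Ideal.sum_mem _ fun u _ => Ideal.mul_mem_left _ _
      (hsat (hpow _ (htind _ (by simpa using hγ u ()) i)))
  intro ι _ x
  have := Fintype.ofFinite ι
  obtain ⟨k, hk⟩ := Ideal.exists_pow_le_of_le_radical_of_fg
    (show Q ≤ (q.map (algebraMap (frobenius R p).range R)).radical from fun x hx => ⟨p, hpow x hx⟩)
    (IsNoetherian.noetherian Q)
  choose u hu F hF using fun i => exists_pow_mul_sub_aeval_mem (t := Sum.elim t y) (e₁ := Sum.inl)
    (e₂ := Sum.inr) hφ hπ hfrac (fun x => by simpa using hB.2 x) (by simpa using htQ)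
    ⟨s, hs, by simpa using hst⟩ k (x i)
  choose S f hf using fun i => exists_finset_rename (F i)
  let V : Finset (T ⊕ B) := Finset.univ.biUnion S
  have hSV : ∀ i, S i ⊆ V := fun i => Finset.subset_biUnion_of_mem S (Finset.mem_univ i)
  let U := ∏ i : ι, u i
  let W := fun i => ∏ j ∈ Finset.univ.erase i, u j
  have hUW : ∀ i, U = u i * W i := fun i => (Finset.mul_prod_erase _ _ (Finset.mem_univ i)).symm
  have hU : U ∉ Q := by
    have : U ∈ Q.primeCompl := Submonoid.prod_mem _ fun i _ => hu i
    exact this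
  refine ⟨V, inferInstance, fun k => Sum.elim t y k, fun k => φ (Sum.elim t y k), φ U,
    fun i => C (φ (W i)) * rename (fun a : S i => (⟨a, hSV i a.2⟩ : V)) (f i), fun k => hφ _, hU,
    fun i => ?_, fun g hg => ?_⟩
  · have h1 : aeval (fun k : V => Sum.elim t y k)
        (rename (fun a : S i => (⟨a, hSV i a.2⟩ : V)) (f i)) = aeval (Sum.elim t y) (F i) := by
      rw [aeval_rename, hf i, aeval_rename]; rfl
    rw [map_mul, aeval_C, h1, hφ, hφ, hUW i, mul_pow, mul_comm (u i ^ p), mul_assoc, ← mul_sub]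
    exact Ideal.mul_mem_left _ _ (hk (hF i))
  · have hp : 0 < p := (Fact.out : p.Prime).pos
    rw [mem_relIdeal_sup_iff hp, mem_map_C_iff]
    intro m
    rw [← coeff_rename_mapDomain (Subtype.val : V → T ⊕ B) Subtype.val_injective]
    refine coeff_mem_of_aeval_mem (φ := φ) (π := π) hφ hφs hπ (fun x => Iff.rfl) htQ hlech hsat hB.1
      ?_ ?_ _
    · intro w hw k
      rw [support_rename_of_injective Subtype.val_injective, Finset.mem_image] at hw
      obtain ⟨v, hv, rfl⟩ := hw
      by_cases hk : k ∈ Set.range (Subtype.val : V → T ⊕ B)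
      · obtain ⟨l, rfl⟩ := hk
        rw [Finsupp.mapDomain_apply Subtype.val_injective]
        exact normalForm_degree_lt hp _ _ hv l
      · rw [Finsupp.mapDomain_of_notMem_range _ _ hk]
        exact hp
    · rw [aeval_rename]
      have h1 := aeval_eq_zero_of_mem_relIdeal (R := R) (y := fun k : V => Sum.elim t y k)
        (fun k => hφ _) (sub_normalForm_mem p (fun k : V => φ (Sum.elim t y k)) g)
      rw [map_sub, sub_eq_zero] at h1
      have h2 := h1 ▸ hg
      exact h2

/-- Lifting of polynomial equations along `A[Y] / (Y ^ p - a) → R`. -/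
theorem liftsModulo_of_flat [IsNoetherianRing R] (hflat : FlatMod (frobenius R p) ⊥) (J : Ideal (frobenius R p).range) :
    LiftsModulo R p J := by
  have : IsNoetherianRing (frobenius R p).range :=
    isNoetherianRing_of_surjective R _ _ (frobenius R p).rangeRestrict_surjective
  have : CharP (frobenius R p).range p :=
    ((frobenius R p).range.subtype.charP_iff Subtype.val_injective p).2 inferInstance
  exact liftsModulo_of_fibreCondition Subtype.val_injective (fun x => ⟨⟨_, x, rfl⟩, rfl⟩)
    (mem_map_colon_of_flat hflat) (fibreCondition_of_flat hflat) J

end Lift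

section AlternatingSums

theorem sum_eq_zero_of_perm {n : Type} [Fintype n] {q : ℕ} {G : Type} [AddCommGroup G]
    (F : (Fin q → n) → G) (h0 : ∀ i, ¬ Function.Injective i → F i = 0)
    (h1 : ∀ j, Function.Injective j → ∑ σ : Equiv.Perm (Fin q), F (j ∘ σ) = 0) : ∑ i, F i = 0 := by
  rw [← Finset.sum_filter_add_sum_filter_not Finset.univ (fun i => Function.Injective i),
    Finset.sum_eq_zero (s := Finset.univ.filter fun i => ¬ _)
      (fun i hi => h0 i (Finset.mem_filter.1 hi).2), add_zero]
  rw [← Finset.sum_fiberwise (Finset.univ.filter fun i : Fin q → n => Function.Injective i)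
    (fun i => Set.range i)]
  refine Finset.sum_eq_zero fun S _ => ?_
  by_cases hS : ∃ j : Fin q → n, Function.Injective j ∧ Set.range j = S
  swap
  · refine Finset.sum_eq_zero fun i hi => ?_
    simp only [Finset.mem_filter, Finset.mem_univ, true_and] at hi
    exact (hS ⟨i, hi⟩).elim
  obtain ⟨j, hj, rfl⟩ := hS
  rw [← h1 j hj]
  symm
  refine Finset.sum_bij (fun σ _ => j ∘ σ) ?_ ?_ ?_ fun _ _ => rfl
  · intro σ _
    simp only [Finset.mem_filter, Finset.mem_univ, true_and]
    exact ⟨hj.comp σ.injective, by rw [Set.range_comp, Equiv.range_eq_univ, Set.image_univ]⟩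
  · intro σ _ τ _ h
    exact Equiv.ext fun x => hj (congrFun h x)
  · intro i hi
    simp only [Finset.mem_filter, Finset.mem_univ, true_and] at hi
    have h2 : ∀ t, ∃ s, j s = i t := fun t => by
      have : i t ∈ Set.range j := hi.2 ▸ ⟨t, rfl⟩
      exact this
    choose σ hσ using h2
    have hinj : Function.Injective σ := fun a b hab => hi.1 (by rw [← hσ, ← hσ, hab])
    exact ⟨Equiv.ofBijective σ (Finite.injective_iff_bijective.1 hinj), Finset.mem_univ _,
      funext fun t => hσ t⟩

theorem alternatingMap_sum_apply {n V G Λ : Type} [AddCommGroup V] [AddCommGroup G] (L : Finset Λ)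
    (f : Λ → V [⋀^n]→ₗ[ℤ] G) (v : n → V) : (∑ l ∈ L, f l) v = ∑ l ∈ L, f l v := by
  induction L using Finset.induction_on with
  | empty => simp
  | insert a L ha ih => rw [Finset.sum_insert ha, Finset.sum_insert ha, AlternatingMap.add_apply, ih]

/-- A sum of values of an alternating map is determined by the minors. -/
theorem sum_alternating_eq_zero {R κ G Λ : Type} [CommRing R] [Fintype κ] [AddCommGroup G]
    {q : ℕ} (Ψ : R →+ (κ → ℤ) [⋀^Fin q]→ₗ[ℤ] G) (L : Finset Λ) (c : Λ → R) (u : Λ → Fin q → κ → ℤ)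
    (h : ∀ j : Fin q → κ, ∑ l ∈ L, c l * ((Matrix.of fun s t => u l t (j s)).det : ℤ) = 0) :
    ∑ l ∈ L, Ψ (c l) (u l) = 0 := by
  have h1 : ∀ (c : R) (u : Fin q → κ → ℤ), Ψ c u =
      ∑ i : Fin q → κ, Ψ (c * ((∏ t, u t (i t) : ℤ) : R)) (fun t => Pi.single (i t) 1) := by
    intro c u
    have h2 : u = fun t => ∑ k, u t k • (Pi.single k 1 : κ → ℤ) := by
      funext t
      exact pi_eq_sum_univ' (u t)
    conv_lhs => rw [h2]
    rw [← AlternatingMap.coe_multilinearMap, MultilinearMap.map_sum]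
    refine Finset.sum_congr rfl fun i _ => ?_
    rw [MultilinearMap.map_smul_univ, mul_comm, ← zsmul_eq_mul, map_zsmul]
    rfl
  rw [Finset.sum_congr rfl fun l _ => h1 (c l) (u l), Finset.sum_comm]
  refine sum_eq_zero_of_perm _ ?_ ?_
  · intro i hi
    refine Finset.sum_eq_zero fun l _ => ?_
    obtain ⟨a, b, hab, hne⟩ := Function.not_injective_iff.1 hi
    exact AlternatingMap.map_eq_zero_of_eq _ _ (by simp only [hab]) hne
  · intro j _
    have h3 : ∀ σ : Equiv.Perm (Fin q), ∑ l ∈ L, Ψ (c l * ((∏ t, u l t ((j ∘ σ) t) : ℤ) : R))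
        (fun t => Pi.single ((j ∘ σ) t) 1) =
        Ψ (∑ l ∈ L, c l * (((Equiv.Perm.sign σ : ℤ) * ∏ t, u l t (j (σ t)) : ℤ) : R))
          (fun t => Pi.single (j t) 1) := by
      intro σ
      rw [map_sum, alternatingMap_sum_apply]
      refine Finset.sum_congr rfl fun l _ => ?_
      have h4 := AlternatingMap.map_perm (Ψ (c l * ((∏ t, u l t ((j ∘ σ) t) : ℤ) : R)))
        (fun t => (Pi.single (j t) 1 : κ → ℤ)) σ
      have h5 : (fun t => (Pi.single ((j ∘ σ) t) 1 : κ → ℤ)) =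
        (fun t => (Pi.single (j t) 1 : κ → ℤ)) ∘ σ := rfl
      rw [h5, h4, Units.smul_def, ← AlternatingMap.smul_apply, ← map_zsmul, zsmul_eq_mul]
      push_cast
      rw [mul_left_comm]
      rfl
    rw [Finset.sum_congr rfl fun σ _ => h3 σ, ← alternatingMap_sum_apply, ← map_sum, Finset.sum_comm]
    have h6 : ∑ l ∈ L, ∑ σ : Equiv.Perm (Fin q),
        c l * (((Equiv.Perm.sign σ : ℤ) * ∏ t, u l t (j (σ t)) : ℤ) : R) = 0 := by
      rw [← h j]
      refine Finset.sum_congr rfl fun l _ => ?_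
      rw [← Finset.mul_sum, ← Int.cast_sum, Matrix.det_apply']
      rfl
    rw [h6, map_zero, AlternatingMap.zero_apply]

end AlternatingSums

section AltDer

variable {R G : Type} [CommRing R] [AddCommGroup G] {q : ℕ}

/-- Alternating multiderivations, in the form `a db₁ ∧ ⋯ ∧ db_q ↦ Φ a b`. -/
def IsAltDer (Φ : R →+ R [⋀^Fin q]→ₗ[ℤ] G) : Prop :=
  ∀ a b i x y, Φ a (Function.update b i (x * y)) =
    Φ (a * x) (Function.update b i y) + Φ (a * y) (Function.update b i x)

variable {Φ : R →+ R [⋀^Fin q]→ₗ[ℤ] G}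

theorem IsAltDer.map_pow (h : IsAltDer Φ) (a : R) (b : Fin q → R) (i : Fin q) (x : R) (n : ℕ) :
    Φ a (Function.update b i (x ^ (n + 1))) =
      Φ ((n + 1 : ℕ) * (a * x ^ n)) (Function.update b i x) := by
  induction n generalizing a with
  | zero => simp
  | succ n ih =>
    rw [pow_succ, h, add_comm, ih, ← AlternatingMap.add_apply, ← map_add]
    congr 2
    push_cast
    ring

variable (p : ℕ) [Fact p.Prime] [CharP R p]

theorem IsAltDer.map_pow_char (h : IsAltDer Φ) (a : R) (b : Fin q → R) (i : Fin q) (x : R) :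
    Φ a (Function.update b i (x ^ p)) = 0 := by
  obtain ⟨n, hn⟩ := Nat.exists_eq_succ_of_ne_zero (Fact.out : p.Prime).ne_zero
  have h1 : ((n + 1 : ℕ) : R) = 0 := by rw [← Nat.succ_eq_add_one, ← hn]; exact CharP.cast_eq_zero R p
  rw [hn, Nat.succ_eq_add_one, h.map_pow, h1, zero_mul, _root_.map_zero, AlternatingMap.zero_apply]

theorem IsAltDer.map_pow_char_mul (h : IsAltDer Φ) (a : R) (b : Fin q → R) (i : Fin q) (e x : R) :
    Φ a (Function.update b i (e ^ p * x)) = Φ (a * e ^ p) (Function.update b i x) := by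
  rw [h, h.map_pow_char p, add_zero]

theorem IsAltDer.map_pow_char_mul_univ (h : IsAltDer Φ) (a : R) (b e : Fin q → R) :
    Φ a (fun t => e t ^ p * b t) = Φ (a * ∏ t, e t ^ p) b := by
  have key : ∀ S : Finset (Fin q), ∀ a, Φ a (fun t => if t ∈ S then e t ^ p * b t else b t) =
      Φ (a * ∏ t ∈ S, e t ^ p) b := by
    intro S
    induction S using Finset.induction_on with
    | empty => intro a; simp
    | insert i S hi ih =>
      intro a
      have h1 : (fun t => if t ∈ insert i S then e t ^ p * b t else b t) =
          Function.update (fun t => if t ∈ S then e t ^ p * b t else b t) i (e i ^ p * b i) := by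
        funext t
        by_cases ht : t = i
        · subst ht; simp
        · simp [ht]
      have h2 : Function.update (fun t => if t ∈ S then e t ^ p * b t else b t) i (b i) =
          (fun t => if t ∈ S then e t ^ p * b t else b t) := by
        funext t
        by_cases ht : t = i
        · subst ht; simp [hi]
        · simp [Function.update_of_ne ht]
      rw [h1, h.map_pow_char_mul p, h2, ih, Finset.prod_insert hi, mul_assoc]
  simpa using key Finset.univ a

variable {κ : Type} [Fintype κ] (y : κ → Rˣ)

/-- Laurent monomials in a family of units. -/
def unitMonomial (w : κ → ℤ) : Rˣ := ∏ k, y k ^ w k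

theorem unitMonomial_add (v w : κ → ℤ) :
    unitMonomial y (v + w) = unitMonomial y v * unitMonomial y w := by
  simp [unitMonomial, zpow_add, Finset.prod_mul_distrib]

theorem unitMonomial_zero : unitMonomial y 0 = 1 := by simp [unitMonomial]

theorem unitMonomial_neg (v : κ → ℤ) : unitMonomial y (-v) = (unitMonomial y v)⁻¹ := by
  simp [unitMonomial]

theorem unitMonomial_single (k : κ) : unitMonomial y (Pi.single k 1) = y k := by
  rw [unitMonomial, Finset.prod_eq_single k]
  · simp
  · intro l _ hl; simp [Pi.single_eq_of_ne hl]
  · simp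

variable (Φ)
/-- The logarithmic form of a multiderivation on Laurent monomials. -/
noncomputable def logAlt (h : IsAltDer Φ) : R →+ (κ → ℤ) [⋀^Fin q]→ₗ[ℤ] G :=
  have hadd : ∀ (c : R) (u : Fin q → κ → ℤ) (i : Fin q) (v w : κ → ℤ),
    Φ (c * unitMonomial y (-∑ t, Function.update u i (v + w) t))
      (fun t => unitMonomial y (Function.update u i (v + w) t)) =
    Φ (c * unitMonomial y (-∑ t, Function.update u i v t))
      (fun t => unitMonomial y (Function.update u i v t)) +
    Φ (c * unitMonomial y (-∑ t, Function.update u i w t))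
      (fun t => unitMonomial y (Function.update u i w t)) := by
    intro c u i v w
    have h1 : ∀ x, (fun t => (unitMonomial y (Function.update u i x t) : R)) =
        Function.update (fun t => (unitMonomial y (u t) : R)) i (unitMonomial y x) := by
      intro x
      funext t
      by_cases ht : t = i
      · subst ht; simp
      · simp [Function.update_of_ne ht]
    have h2 : ∀ x, ∑ t, Function.update u i x t = x + ∑ t ∈ Finset.univ \ {i}, u t := fun x =>
      Finset.sum_update_of_mem (Finset.mem_univ i) _ _
    simp only [h1, h2]
    rw [unitMonomial_add y v w, Units.val_mul, h, add_comm]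
    congr 3
    · rw [mul_assoc, ← Units.val_mul, ← unitMonomial_add]; congr 3; abel
    · rw [mul_assoc, ← Units.val_mul, ← unitMonomial_add]; congr 3; abel
  { toFun := fun c =>
      { toFun := fun u => Φ (c * unitMonomial y (-∑ t, u t)) (fun t => unitMonomial y (u t))
        map_update_add' := fun {inst} u i v w => by
          have := Subsingleton.elim inst (instDecidableEqFin q)
          subst this
          convert hadd c u i v w
        map_update_smul' := fun {inst} u i n v => by
          have := Subsingleton.elim inst (instDecidableEqFin q)
          subst this
          exact map_zsmul (AddMonoidHom.mk' (fun v =>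
            Φ (c * unitMonomial y (-∑ t, Function.update u i v t))
              (fun t => unitMonomial y (Function.update u i v t))) (fun v w => by convert hadd c u i v w)) n v
        map_eq_zero_of_eq' := fun u i j hij hne =>
          AlternatingMap.map_eq_zero_of_eq _ _ (by simp only [hij]) hne }
    map_zero' := by
      ext u
      change Φ (0 * _) _ = 0
      rw [zero_mul, map_zero, AlternatingMap.zero_apply]
    map_add' := fun c d => by
      ext u
      change Φ ((c + d) * _) _ = Φ _ _ + Φ _ _
      rw [add_mul, map_add, AlternatingMap.add_apply] }

theorem logAlt_apply (h : IsAltDer Φ) (c : R) (u : Fin q → κ → ℤ) : logAlt Φ y h c u =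
    Φ (c * unitMonomial y (-∑ t, u t)) (fun t => unitMonomial y (u t)) := rfl

end AltDer

section AltExpansion
open MvPolynomial

variable {R G : Type} [CommRing R] [AddCommGroup G] {q : ℕ} {κ : Type} [Fintype κ]
  {A : Type} [CommRing A] [Algebra A R]

/-- Exponents of a monomial, as integers. -/
def intExp (w : κ →₀ ℕ) : κ → ℤ := fun k => w k

theorem intExp_add (v w : κ →₀ ℕ) : intExp (v + w) = intExp v + intExp w := by
  funext k; simp [intExp]

theorem aeval_monomial_unit (y : κ → Rˣ) (w : κ →₀ ℕ) (c : A) :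
    aeval (fun k => (y k : R)) (monomial w c) = algebraMap A R c * unitMonomial y (intExp w) := by
  rw [aeval_monomial, unitMonomial, Finsupp.prod_fintype _ _ (fun k => pow_zero _)]
  simp [intExp, Units.coe_prod]

/-- The Euler derivation on a polynomial ring. -/
noncomputable def eulerDer (k : κ) (f : MvPolynomial κ A) : MvPolynomial κ A := X k * pderiv k f

theorem eulerDer_eq_sum (k : κ) (f : MvPolynomial κ A) :
    eulerDer k f = ∑ w ∈ f.support, monomial w (coeff w f) * C ((intExp w k : ℤ) : A) := by
  conv_lhs => rw [eulerDer, ← support_sum_monomial_coeff f, map_sum, Finset.mul_sum]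
  refine Finset.sum_congr rfl fun w _ => ?_
  rw [X_mul_pderiv_monomial, ← Nat.cast_smul_eq_nsmul A, smul_eq_C_mul, mul_comm]
  simp [intExp]

theorem det_eulerDer (F : Fin q → MvPolynomial κ A) (j : Fin q → κ) :
    (Matrix.of fun s t => eulerDer (j s) (F t)).det =
      ∑ w ∈ Fintype.piFinset fun t => (F t).support, monomial (∑ t, w t)
        ((∏ t, coeff (w t) (F t)) * ((Matrix.of fun s t => intExp (w t) (j s)).det : ℤ)) := by
  have h1 : ∀ M : Matrix (Fin q) (Fin q) (MvPolynomial κ A), M.det =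
      Matrix.detRowAlternating.toMultilinearMap (fun t s => M s t) := fun M =>
    (Matrix.det_transpose M).symm
  have h2 : (fun t s => (Matrix.of fun s t => eulerDer (j s) (F t)) s t) =
      fun t => ∑ w ∈ (F t).support, monomial w (coeff w (F t)) •
        (fun s => C ((intExp w (j s) : ℤ) : A)) := by
    funext t s
    rw [Finset.sum_apply, Matrix.of_apply, eulerDer_eq_sum]
    rfl
  rw [h1, h2, MultilinearMap.map_sum_finset]
  refine Finset.sum_congr rfl fun w _ => ?_
  have h3 : ∏ t, monomial (w t) (coeff (w t) (F t)) =
      monomial (∑ t, w t) (∏ t, coeff (w t) (F t)) := by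
    rw [monomial_sum_prod]
  have h4 := RingHom.map_det ((C : A →+* MvPolynomial κ A).comp (Int.castRingHom A))
    (Matrix.of fun s t => intExp (w t) (j s))
  rw [MultilinearMap.map_smul_univ, mul_comm (∏ t, coeff (w t) (F t)), ← C_mul_monomial, smul_eq_mul,
    h3, mul_comm (C _)]
  congr 1
  exact (Matrix.det_transpose _).trans h4.symm

variable (p : ℕ) [Fact p.Prime] [CharP R p] {Φ : R →+ R [⋀^Fin q]→ₗ[ℤ] G} (h : IsAltDer Φ)
  (y : κ → Rˣ) (hA : ∀ α : A, ∃ e : R, algebraMap A R α = e ^ p)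

include p hA in
theorem altDer_expand (c : R) (F : Fin q → MvPolynomial κ A) :
    Φ c (fun t => aeval (fun k => (y k : R)) (F t)) =
      ∑ w ∈ Fintype.piFinset fun t => (F t).support,
        logAlt Φ y h (c * algebraMap A R (∏ t, coeff (w t) (F t)) *
          unitMonomial y (intExp (∑ t, w t))) (fun t => intExp (w t)) := by
  have h2 : (fun t => aeval (fun k => (y k : R)) (F t)) = fun t => ∑ w ∈ (F t).support,
      algebraMap A R (coeff w (F t)) * unitMonomial y (intExp w) := by
    funext t
    conv_lhs => rw [← support_sum_monomial_coeff (F t), map_sum]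
    exact Finset.sum_congr rfl fun w _ => aeval_monomial_unit y w _
  rw [h2, ← AlternatingMap.coe_multilinearMap, MultilinearMap.map_sum_finset]
  refine Finset.sum_congr rfl fun w _ => ?_
  choose e he using fun t => hA (coeff (w t) (F t))
  simp only [he, AlternatingMap.coe_multilinearMap, map_prod]
  rw [h.map_pow_char_mul_univ p c (fun t => (unitMonomial y (intExp (w t)) : R)) e, logAlt_apply,
    mul_assoc (c * _), ← Units.val_mul, ← unitMonomial_add]
  have h3 : intExp (∑ t, w t) = ∑ t, intExp (w t) := by
    funext k; simp [intExp]
  rw [h3, add_neg_cancel, unitMonomial_zero, Units.val_one, mul_one]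

include p hA h in
/-- A sum of alternating multiderivation values vanishes if the corresponding differential form
has vanishing minors. -/
theorem sum_altDer_eq_zero {Λ : Type} (L : Finset Λ) (c : Λ → R) (F : Λ → Fin q → MvPolynomial κ A)
    (h0 : ∀ j : Fin q → κ, ∑ l ∈ L, c l * aeval (fun k => (y k : R))
      (Matrix.of fun s t => eulerDer (j s) (F l t)).det = 0) :
    ∑ l ∈ L, Φ (c l) (fun t => aeval (fun k => (y k : R)) (F l t)) = 0 := by
  simp only [altDer_expand p h y hA]
  have key := sum_alternating_eq_zero (Λ := Σ _ : Λ, (Fin q → κ →₀ ℕ)) (logAlt Φ y h)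
    (L.sigma fun l => Fintype.piFinset fun t => (F l t).support)
    (fun x => c x.1 * algebraMap A R (∏ t, coeff (x.2 t) (F x.1 t)) *
      unitMonomial y (intExp (∑ t, x.2 t))) (fun x t => intExp (x.2 t)) ?_
  · rwa [Finset.sum_sigma] at key
  intro j
  rw [← h0 j, Finset.sum_sigma]
  refine Finset.sum_congr rfl fun l _ => ?_
  rw [det_eulerDer, map_sum, Finset.mul_sum]
  refine Finset.sum_congr rfl fun w _ => ?_
  rw [aeval_monomial_unit, map_mul, map_intCast]
  ring

end AltExpansion

section AltExact
open MvPolynomial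

theorem det_eliminate {R : Type} [CommRing R] {q : ℕ} (M : Matrix (Fin (q + 1)) (Fin (q + 1)) R)
    (n : R) (hn : n * ∑ t, M 0 t = 1) :
    (Matrix.of fun s t : Fin q => M s.succ t.succ - n * M 0 t.succ * ∑ i, M s.succ i).det =
      n * M.det := by
  have h1 := Matrix.det_updateCol_sum M 0 (fun _ => 1)
  simp only [one_smul] at h1
  set M1 := M.updateCol 0 fun s => ∑ i, M s i with hM1
  let M2 : Matrix (Fin (q + 1)) (Fin (q + 1)) R := Matrix.of fun s t =>
    Fin.cases (∑ i, M s i) (fun t' => M s t'.succ - n * M 0 t'.succ * ∑ i, M s i) t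
  have h2 : M1.det = M2.det := by
    rw [← Matrix.det_transpose M1, ← Matrix.det_transpose M2]
    refine Matrix.det_eq_of_forall_row_eq_smul_add_const
      (fun t => Fin.cases 0 (fun t' => n * M 0 t'.succ) t) 0 rfl fun t s => ?_
    refine Fin.cases ?_ (fun t' => ?_) t
    · simp [M1, M2]
    · simp [M1, M2]
  rw [← h1, h2, Matrix.det_succ_row_zero, Fin.sum_univ_succ, Finset.sum_eq_zero]
  · simp only [M2, Matrix.of_apply, Fin.val_zero, pow_zero, one_mul, Fin.cases_zero, add_zero]
    rw [← mul_assoc, hn, one_mul]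
    rfl
  · intro t _
    simp only [M2, Matrix.of_apply, Fin.cases_succ]
    have : M 0 t.succ - n * M 0 t.succ * ∑ i, M 0 i = 0 := by
      linear_combination (- M 0 t.succ) * hn
    rw [this]; ring

theorem alternating_sub_smul {V G : Type} [AddCommGroup V] [AddCommGroup G] {q : ℕ}
    (ψ : V [⋀^Fin q]→ₗ[ℤ] G) (v : V) (hv : ∀ u i, ψ (Function.update u i v) = 0)
    (u : Fin q → V) (n : Fin q → ℤ) : ψ (fun t => u t - n t • v) = ψ u := by
  have key : ∀ S : Finset (Fin q), ψ (fun t => if t ∈ S then u t - n t • v else u t) = ψ u := by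
    intro S
    induction S using Finset.induction_on with
    | empty => simp
    | insert i S hi ih =>
      have h1 : (fun t => if t ∈ insert i S then u t - n t • v else u t) =
          Function.update (fun t => if t ∈ S then u t - n t • v else u t) i (u i - n i • v) := by
        funext t
        by_cases ht : t = i
        · subst ht; simp
        · simp [ht]
      have h2 : Function.update (fun t => if t ∈ S then u t - n t • v else u t) i (u i) =
          (fun t => if t ∈ S then u t - n t • v else u t) := by
        funext t
        by_cases ht : t = i
        · subst ht; simp [hi]
        · simp [Function.update_of_ne ht]
      rw [h1, AlternatingMap.map_update_sub, AlternatingMap.map_update_smul, hv, smul_zero, sub_zero,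
        h2, ih]
  simpa using key Finset.univ

variable {R G : Type} [CommRing R] [AddCommGroup G] {q : ℕ} {κ : Type} [Fintype κ]
  {A : Type} [CommRing A] [Algebra A R]
variable (p : ℕ) [Fact p.Prime] [CharP R p] {Φ : R →+ R [⋀^Fin q]→ₗ[ℤ] G} (h : IsAltDer Φ)
  (y : κ → Rˣ) (hA : ∀ α : A, ∃ e : R, algebraMap A R α = e ^ p)

include p in
theorem logAlt_update_eq_zero (hex : ∀ (b : Fin q → R) (_ : Fin q), Φ 1 b = 0) (e : R) (v : κ → ℤ)
    (u : Fin q → κ → ℤ) (i : Fin q) :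
    logAlt Φ y h (e ^ p * unitMonomial y v) (Function.update u i v) = 0 := by
  let σ := ∑ t ∈ Finset.univ \ {i}, u t
  have h0 : ∑ t, Function.update u i (v - σ) t = v := by
    rw [Finset.sum_update_of_mem (Finset.mem_univ i)]; simp [σ]
  have h1 : logAlt Φ y h (e ^ p * unitMonomial y v) (Function.update u i (v - σ)) = 0 := by
    rw [logAlt_apply, h0, mul_assoc, ← Units.val_mul, ← unitMonomial_add, add_neg_cancel,
      unitMonomial_zero, Units.val_one, mul_one]
    have h2 : (fun t => (unitMonomial y (Function.update u i (v - σ) t) : R)) =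
        Function.update (fun t => (unitMonomial y (u t) : R)) i (unitMonomial y (v - σ)) := by
      funext t
      by_cases ht : t = i
      · subst ht; simp
      · simp [Function.update_of_ne ht]
    have h3 := h.map_pow_char_mul p 1 (fun t => (unitMonomial y (u t) : R)) i e (unitMonomial y (v - σ))
    rw [hex _ i, one_mul] at h3
    rw [h2, ← h3]
  rw [AlternatingMap.map_update_sub, AlternatingMap.map_update_sum, Finset.sum_eq_zero, sub_zero] at h1
  · exact h1
  · intro t ht
    have : t ≠ i := by simpa using ht
    exact AlternatingMap.map_update_self _ _ this.symm

include p in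
theorem logAlt_pow_mem (e : R) (u : Fin q → κ → ℤ) : logAlt Φ y h (e ^ p) u ∈
    AddSubgroup.closure {x | ∃ (c : R) (e : Fin q → Rˣ),
      x = Φ (c ^ p * ∏ t, (e t : R) ^ (p - 1)) (fun t => e t)} := by
  have h2 : u = fun t => ∑ k, u t k • (Pi.single k 1 : κ → ℤ) := by
    funext t
    exact pi_eq_sum_univ' (u t)
  rw [h2, ← AlternatingMap.coe_multilinearMap, MultilinearMap.map_sum]
  refine AddSubgroup.sum_mem _ fun i _ => ?_
  rw [MultilinearMap.map_smul_univ]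
  refine AddSubgroup.zsmul_mem _ (AddSubgroup.subset_closure ?_) _
  refine ⟨e * ∏ t, ((y (i t))⁻¹ : Rˣ), fun t => y (i t), ?_⟩
  rw [AlternatingMap.coe_multilinearMap, logAlt_apply]
  simp only [unitMonomial_single]
  congr 2
  have h3 : unitMonomial y (-∑ t, Pi.single (i t) 1) = ∏ t, (y (i t))⁻¹ := by
    rw [unitMonomial_neg, Finset.prod_inv_distrib]
    congr 1
    refine Finset.induction_on (motive := fun S => unitMonomial y (∑ t ∈ S, Pi.single (i t) 1) =
      ∏ t ∈ S, y (i t)) Finset.univ (unitMonomial_zero y) ?_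
    intro t S ht ih
    rw [Finset.sum_insert ht, Finset.prod_insert ht, unitMonomial_add, ih, unitMonomial_single]
  rw [h3, Units.coe_prod, mul_pow, mul_assoc, ← Finset.prod_pow, ← Finset.prod_mul_distrib]
  congr 1
  refine Finset.prod_congr rfl fun t _ => ?_
  obtain ⟨n, hn⟩ := Nat.exists_eq_succ_of_ne_zero (Fact.out : p.Prime).ne_zero
  rw [hn, Nat.succ_eq_add_one, Nat.add_sub_cancel, pow_succ, mul_right_comm, ← mul_pow, Units.inv_mul,
    one_pow, one_mul]

include p in
theorem sum_logAlt_eq_zero_of_weight {Λ : Type} (L : Finset Λ) (c : Λ → R) (w : Λ → Fin (q + 1) → κ → ℤ)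
    (hex : ∀ (b : Fin q → R) (_ : Fin q), Φ 1 b = 0) (v : κ → ℤ)
    (hw : ∀ l ∈ L, ∀ k, ((∑ t, w l t k : ℤ) : R) = v k) (hc : ∀ l ∈ L, ∃ e, c l = e ^ p)
    (k₀ : κ) (n : ℤ) (hn : (n : R) * v k₀ = 1)
    (hdet : ∀ j : Fin (q + 1) → κ,
      ∑ l ∈ L, c l * ((Matrix.of fun s t => w l t (j s)).det : ℤ) = 0) :
    ∑ l ∈ L, logAlt Φ y h (c l * unitMonomial y v) (fun t => w l t.succ) = 0 := by
  have h1 : ∀ l ∈ L, logAlt Φ y h (c l * unitMonomial y v) (fun t => w l t.succ) =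
      logAlt Φ y h (c l * unitMonomial y v) (fun t => w l t.succ - (n * w l t.succ k₀) • v) := by
    intro l hl
    obtain ⟨e, he⟩ := hc l hl
    rw [he]
    exact (alternating_sub_smul _ v (fun u i => logAlt_update_eq_zero p h y hex e v u i) _ _).symm
  rw [Finset.sum_congr rfl h1]
  refine sum_alternating_eq_zero (logAlt Φ y h) L (fun l => c l * unitMonomial y v)
    (fun l t => w l t.succ - (n * w l t.succ k₀) • v) fun j => ?_
  have h2 : ∀ l ∈ L, c l * unitMonomial y v *
      ((Matrix.of fun s t => (w l t.succ - (n * w l t.succ k₀) • v) (j s)).det : ℤ) =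
      (unitMonomial y v * n) * (c l * ((Matrix.of fun s t => w l t
        ((Fin.cons k₀ j : Fin (q + 1) → κ) s)).det : ℤ)) := by
    intro l hl
    have h3 := det_eliminate ((Matrix.of fun s t => w l t
        ((Fin.cons k₀ j : Fin (q + 1) → κ) s)).map (Int.castRingHom R)) n (by
      rw [← hn, ← hw l hl]; simp)
    have h4 := RingHom.map_det (Int.castRingHom R) (Matrix.of fun s t => w l t
        ((Fin.cons k₀ j : Fin (q + 1) → κ) s))
    have h5 := RingHom.map_det (Int.castRingHom R)
      (Matrix.of fun s t => (w l t.succ - (n * w l t.succ k₀) • v) (j s))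
    simp only [eq_intCast] at h4 h5
    rw [RingHom.mapMatrix_apply] at h4 h5
    have h6 : ((Matrix.of fun s t => (w l t.succ - (n * w l t.succ k₀) • v) (j s)).map
        (Int.castRingHom R)).det = n * ((Matrix.of fun s t => w l t
        ((Fin.cons k₀ j : Fin (q + 1) → κ) s)).map (Int.castRingHom R)).det := by
      rw [← h3]
      congr 1
      ext s t
      have := hw l hl (j s)
      push_cast at this
      simp [this]
    rw [h5, h6, h4]
    ring
  rw [Finset.sum_congr rfl h2, ← Finset.mul_sum, hdet, mul_zero]

include p hA in
theorem altDer_expand_cons (F : Fin (q + 1) → MvPolynomial κ A) :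
    Φ (aeval (fun k => (y k : R)) (F 0)) (fun t => aeval (fun k => (y k : R)) (F t.succ)) =
      ∑ w ∈ Fintype.piFinset fun t => (F t).support,
        logAlt Φ y h (algebraMap A R (∏ t, coeff (w t) (F t)) *
          unitMonomial y (intExp (∑ t, w t))) (fun t => intExp (w t.succ)) := by
  have h1 : aeval (fun k => (y k : R)) (F 0) = ∑ w ∈ (F 0).support,
      algebraMap A R (coeff w (F 0)) * unitMonomial y (intExp w) := by
    conv_lhs => rw [← support_sum_monomial_coeff (F 0), map_sum]
    exact Finset.sum_congr rfl fun w _ => aeval_monomial_unit y w _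
  rw [altDer_expand p h y hA, h1]
  have h2 : ∀ w : Fin q → κ →₀ ℕ, logAlt Φ y h ((∑ w ∈ (F 0).support,
      algebraMap A R (coeff w (F 0)) * unitMonomial y (intExp w)) *
      algebraMap A R (∏ t, coeff (w t) (F t.succ)) * unitMonomial y (intExp (∑ t, w t)))
        (fun t => intExp (w t)) = ∑ w0 ∈ (F 0).support,
      logAlt Φ y h (algebraMap A R (coeff w0 (F 0) * ∏ t, coeff (w t) (F t.succ)) *
        unitMonomial y (intExp (w0 + ∑ t, w t))) (fun t => intExp (w t)) := by
    intro w
    rw [Finset.sum_mul, Finset.sum_mul, map_sum, alternatingMap_sum_apply]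
    refine Finset.sum_congr rfl fun w0 _ => ?_
    rw [intExp_add, unitMonomial_add, (algebraMap A R).map_mul, Units.val_mul]
    congr 2
    ring
  rw [Finset.sum_congr rfl fun w _ => h2 w, Finset.sum_comm, ← Finset.sum_product']
  refine Finset.sum_nbij' (fun x => Fin.cons x.1 x.2) (fun w => (w 0, fun t => w t.succ))
    ?_ ?_ ?_ ?_ ?_
  · rintro ⟨w0, w⟩ hw
    rw [Finset.mem_product, Fintype.mem_piFinset] at hw
    rw [Fintype.mem_piFinset]
    intro t
    refine Fin.cases ?_ (fun t => ?_) t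
    · exact hw.1
    · exact hw.2 t
  · intro w hw
    rw [Fintype.mem_piFinset] at hw
    rw [Finset.mem_product, Fintype.mem_piFinset]
    exact ⟨hw 0, fun t => hw t.succ⟩
  · rintro ⟨w0, w⟩ _
    simp
  · intro w _
    exact Fin.cons_self_tail w
  · rintro ⟨w0, w⟩ _
    simp [Fin.prod_univ_succ, Fin.sum_univ_succ]

include p hA h in
/-- A sum of alternating multiderivation values is in the image of the inverse Cartier operator if
the corresponding differential form is closed. -/
theorem sum_altDer_mem (hex : ∀ (b : Fin q → R) (_ : Fin q), Φ 1 b = 0)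
    (a : κ → A) (ha : ∀ k, algebraMap A R (a k) = (y k : R) ^ p)
    {Λ : Type} (L : Finset Λ) (F : Λ → Fin (q + 1) → MvPolynomial κ A)
    (h0 : ∀ j : Fin (q + 1) → κ,
      ∑ l ∈ L, (Matrix.of fun s t => eulerDer (j s) (F l t)).det ∈ relIdeal p a) :
    ∑ l ∈ L, Φ (aeval (fun k => (y k : R)) (F l 0)) (fun t => aeval (fun k => (y k : R)) (F l t.succ)) ∈
      AddSubgroup.closure {x | ∃ (c : R) (e : Fin q → Rˣ),
        x = Φ (c ^ p * ∏ t, (e t : R) ^ (p - 1)) (fun t => e t)} := by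
  have hp : 0 < p := (Fact.out : p.Prime).pos
  simp only [altDer_expand_cons p h y hA]
  let X : Finset (Σ _ : Λ, (Fin (q + 1) → κ →₀ ℕ)) :=
    L.sigma fun l => Fintype.piFinset fun t => (F l t).support
  let W : (Σ _ : Λ, (Fin (q + 1) → κ →₀ ℕ)) → κ →₀ ℕ := fun x => ∑ t, x.2 t
  let res : (Σ _ : Λ, (Fin (q + 1) → κ →₀ ℕ)) → κ →₀ ℕ := fun x =>
    (W x).mapRange (· % p) (Nat.zero_mod p)
  let c : (Σ _ : Λ, (Fin (q + 1) → κ →₀ ℕ)) → A := fun x => ∏ t, coeff (x.2 t) (F x.1 t)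
  let c' : (Σ _ : Λ, (Fin (q + 1) → κ →₀ ℕ)) → A := fun x =>
    c x * (W x).prod fun k n => a k ^ (n / p)
  have hc' : ∀ x, algebraMap A R (c x) * unitMonomial y (intExp (W x)) =
      algebraMap A R (c' x) * unitMonomial y (intExp (res x)) := by
    intro x
    rw [← aeval_monomial_unit, ← aeval_monomial_unit, ← normalForm_monomial, ← sub_eq_zero, ← map_sub]
    exact aeval_eq_zero_of_mem_relIdeal ha (sub_normalForm_mem p a _)
  have hsum : ∑ l ∈ L, ∑ w ∈ Fintype.piFinset fun t => (F l t).support,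
        logAlt Φ y h (algebraMap A R (∏ t, coeff (w t) (F l t)) *
          unitMonomial y (intExp (∑ t, w t))) (fun t => intExp (w t.succ)) =
      ∑ x ∈ X, logAlt Φ y h (algebraMap A R (c' x) * unitMonomial y (intExp (res x)))
        (fun t => intExp (x.2 t.succ)) := by
    rw [Finset.sum_sigma]
    refine Finset.sum_congr rfl fun l _ => Finset.sum_congr rfl fun w _ => ?_
    rw [← hc']
  rw [hsum, ← Finset.sum_fiberwise_of_maps_to (fun x hx => Finset.mem_image_of_mem res hx)]
  refine AddSubgroup.sum_mem _ fun v hv => ?_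
  have hvp : ∀ k, v k < p := by
    obtain ⟨x, _, rfl⟩ := Finset.mem_image.1 hv
    exact fun k => Nat.mod_lt _ hp
  by_cases hv0 : v = 0
  · refine AddSubgroup.sum_mem _ fun x hx => ?_
    obtain ⟨e, he⟩ := hA (c' x)
    have h1 : intExp (0 : κ →₀ ℕ) = 0 := by funext k; simp [intExp]
    rw [(Finset.mem_filter.1 hx).2, hv0, h1, unitMonomial_zero, Units.val_one, mul_one, he]
    exact logAlt_pow_mem p h y e _
  obtain ⟨k₀, hk₀⟩ : ∃ k, v k ≠ 0 := by
    by_contra! hcon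
    exact hv0 (Finsupp.ext hcon)
  have hcop : IsCoprime (v k₀ : ℤ) (p : ℤ) := by
    rw [Nat.isCoprime_iff_coprime]
    exact (((Fact.out : p.Prime).coprime_iff_not_dvd).2
      (Nat.not_dvd_of_pos_of_lt (Nat.pos_of_ne_zero hk₀) (hvp k₀))).symm
  obtain ⟨n, n', hn⟩ := hcop
  have hn' : (n : R) * ((intExp v k₀ : ℤ) : R) = 1 := by
    have := congrArg (Int.cast : ℤ → R) hn
    push_cast at this
    rw [CharP.cast_eq_zero R p, mul_zero, add_zero] at this
    simpa [intExp] using this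
  have key := sum_logAlt_eq_zero_of_weight p h y (X.filter fun x => res x = v)
    (fun x => algebraMap A R (c' x)) (fun x t => intExp (x.2 t)) hex (intExp v) ?_
    (fun x _ => hA _) k₀ n hn' ?_
  · have h2 : ∀ x ∈ X.filter fun x => res x = v,
      logAlt Φ y h (algebraMap A R (c' x) * unitMonomial y (intExp (res x)))
        (fun t => intExp (x.2 t.succ)) =
      logAlt Φ y h (algebraMap A R (c' x) * unitMonomial y (intExp v))
        (fun t => intExp (x.2 t.succ)) := fun x hx => by rw [(Finset.mem_filter.1 hx).2]
    rw [Finset.sum_congr rfl h2, key]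
    exact AddSubgroup.zero_mem _
  · intro x hx k
    rw [← (Finset.mem_filter.1 hx).2]
    have h3 : (∑ t, intExp (x.2 t) k : ℤ) = (W x k : ℤ) := by simp [intExp, W]
    rw [h3]
    change _ = (((W x k % p : ℕ) : ℤ) : R)
    rw [Int.cast_natCast, Int.cast_natCast, ← CharP.cast_eq_mod R p]
  · intro j
    have h4 := normalForm_eq_zero_of_mem hp a (h0 j)
    simp only [det_eulerDer, map_sum, normalForm_monomial] at h4
    have h5 := congrArg (coeff v) h4
    rw [Finset.sum_sigma', coeff_sum, coeff_zero] at h5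
    have h6 := congrArg (algebraMap A R) h5
    rw [map_zero, map_sum] at h6
    rw [← h6, Finset.sum_filter]
    refine Finset.sum_congr rfl fun x _ => ?_
    rw [coeff_monomial]
    by_cases hx : res x = v
    · rw [if_pos hx, if_pos hx]
      simp only [c', c, W, map_mul, map_intCast]
      ring
    · rw [if_neg hx, if_neg hx, map_zero]

end AltExact

section DualDerivations
open MvPolynomial

variable {K : Type} [Field K] {p : ℕ} [Fact p.Prime] [CharP K p] {ι : Type} {y : ι → K}

theorem eval₂_frobenius_eq_zero_iff (hy : PIndep p y) (g : MvPolynomial ι K) :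
    eval₂ (frobenius K p) y g = 0 ↔ g ∈ relIdeal p y := by
  have h1 : relIdeal p y ≤ RingHom.ker (eval₂Hom (frobenius K p) y) := by
    rw [relIdeal, Ideal.span_le]
    rintro _ ⟨k, rfl⟩
    simp [RingHom.mem_ker, frobenius_def]
  refine ⟨fun h => ?_, fun h => h1 h⟩
  have h2 := sub_normalForm_mem p y g
  have h3 := h1 h2
  rw [RingHom.mem_ker, map_sub, coe_eval₂Hom, h, zero_sub, neg_eq_zero] at h3
  rwa [hy _ (fun w hw k => normalForm_degree_lt (Fact.out : p.Prime).pos _ _ hw k) h3, sub_zero] at h2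

theorem pderiv_mem_relIdeal {A κ : Type} [CommRing A] (p : ℕ) [CharP A p] (a : κ → A) (k : κ)
    {f : MvPolynomial κ A} (hf : f ∈ relIdeal p a) : pderiv k f ∈ relIdeal p a := by
  refine Submodule.span_induction (p := fun f _ => pderiv k f ∈ relIdeal p a) ?_ ?_ ?_ ?_ hf
  · rintro _ ⟨l, rfl⟩
    rw [map_sub, pderiv_C, sub_zero, Derivation.leibniz_pow, nsmul_eq_mul, CharP.cast_eq_zero, zero_mul]
    exact Ideal.zero_mem _
  · simp
  · intro x y _ _ hx hy
    rw [map_add]; exact Ideal.add_mem _ hx hy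
  · intro c x hx' hx
    rw [smul_eq_mul, Derivation.leibniz, smul_eq_mul, smul_eq_mul]
    exact Ideal.add_mem _ (Ideal.mul_mem_left _ _ hx) (Ideal.mul_mem_right _ _ hx')

theorem exists_dual_derivation (hy : IsPBasis p y) (k : ι) : ∃ D : Derivation ℤ K K,
    ∀ g : MvPolynomial ι K, D (eval₂ (frobenius K p) y g) = eval₂ (frobenius K p) y (pderiv k g) := by
  choose s hs using hy.2
  have hwd : ∀ g, eval₂ (frobenius K p) y (pderiv k (s (eval₂ (frobenius K p) y g))) =
      eval₂ (frobenius K p) y (pderiv k g) := by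
    intro g
    rw [← sub_eq_zero, ← eval₂_sub, eval₂_frobenius_eq_zero_iff hy.1, ← map_sub]
    refine pderiv_mem_relIdeal p y k ?_
    rw [← eval₂_frobenius_eq_zero_iff hy.1, eval₂_sub, hs, sub_self]
  have hadd : ∀ x z, eval₂ (frobenius K p) y (pderiv k (s (x + z))) =
      eval₂ (frobenius K p) y (pderiv k (s x)) + eval₂ (frobenius K p) y (pderiv k (s z)) := by
    intro x z
    rw [← eval₂_add, ← map_add, ← hwd (s x + s z), eval₂_add, hs, hs]
  refine ⟨Derivation.mk' (AddMonoidHom.mk'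
    (fun x => eval₂ (frobenius K p) y (pderiv k (s x))) hadd).toIntLinearMap fun x z => ?_, hwd⟩
  change eval₂ (frobenius K p) y (pderiv k (s (x * z))) =
    x * eval₂ (frobenius K p) y (pderiv k (s z)) + z * eval₂ (frobenius K p) y (pderiv k (s x))
  have h1 := hwd (s x * s z)
  rw [eval₂_mul, hs, hs] at h1
  rw [h1, Derivation.leibniz, smul_eq_mul, smul_eq_mul, eval₂_add, eval₂_mul, eval₂_mul, hs, hs]

end DualDerivations

section UnitLifts
open MvPolynomial

variable {R : Type} [CommRing R] {p : ℕ} [Fact p.Prime] [CharP R p]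

theorem exists_unit_lift [IsLocalRing R] (h : LiftsModulo R p (⊥ : Ideal (frobenius R p).range))
    {ι : Type} [Finite ι] (x : ι → R) :
    ∃ (κ : Type) (_ : Fintype κ) (y : κ → Rˣ) (a : κ → (frobenius R p).range)
      (f : ι → MvPolynomial κ (frobenius R p).range),
      (∀ k, algebraMap (frobenius R p).range R (a k) = (y k : R) ^ p) ∧
      (∀ i, x i = aeval (fun k => (y k : R)) (f i)) ∧
      ∀ g : MvPolynomial ι (frobenius R p).range, aeval x g = 0 → bind₁ f g ∈ relIdeal p a := by
  have : CharP (frobenius R p).range p :=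
    ((frobenius R p).range.subtype.charP_iff Subtype.val_injective p).2 inferInstance
  obtain ⟨κ, _, y, a, f, ha, hf, hG⟩ := h ι x {g | aeval x g = 0} (fun g hg => by
    have h0 : aeval x g = 0 := hg
    rw [h0]; exact Ideal.zero_mem _)
  have := Fintype.ofFinite κ
  have hε : ∀ k, ∃ ε : (frobenius R p).range, ε ^ p = ε ∧ IsUnit (y k + algebraMap (frobenius R p).range R ε) := by
    intro k
    by_cases hk : IsUnit (y k)
    · exact ⟨0, by rw [zero_pow (Fact.out : p.Prime).ne_zero], by simpa using hk⟩
    · refine ⟨1, one_pow p, ?_⟩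
      rw [map_one]
      by_contra h1
      have h2 := IsLocalRing.nonunits_add (a := y k + 1) (b := - y k) h1 (by simpa using hk)
      simp at h2
  choose ε hε hu using hε
  have hy : ∀ k, y k = aeval (fun k => ((hu k).unit : R)) (X k - C (ε k)) := by
    intro k
    rw [map_sub, aeval_X, aeval_C, IsUnit.unit_spec, add_sub_cancel_right]
  refine ⟨κ, inferInstance, fun k => (hu k).unit, fun k => a k + ε k, fun i => bind₁ (fun k => X k - C (ε k)) (f i),
    fun k => ?_, fun i => ?_, fun g hg => ?_⟩
  · rw [map_add, ha, IsUnit.unit_spec, add_pow_char, ← map_pow, hε]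
  · rw [aeval_bind₁, hf]
    congr 2
    funext k
    exact hy k
  · have h1 := hG g hg
    rw [Ideal.map_bot, sup_bot_eq] at h1
    have h2 := bind₁_mem_relIdeal (R := R) (b := fun k => a k + ε k) (z := fun k => ((hu k).unit : R))
      Subtype.val_injective ha (fun k => by
        rw [map_add, ha, IsUnit.unit_spec, add_pow_char, ← map_pow, hε]) hy h1
    rwa [bind₁_bind₁] at h2

end UnitLifts

section DeterminantalLifts
open MvPolynomial

variable {R : Type} [CommRing R] [IsDomain R] [IsLocalRing R] {p : ℕ} [Fact p.Prime] [CharP R p]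

theorem derivation_aeval {A S κ : Type} [CommRing A] [CommRing S] [Algebra A S] [Fintype κ]
    (D : Derivation ℤ S S) (hD : ∀ α : A, D (algebraMap A S α) = 0) (z : κ → S)
    (G : MvPolynomial κ A) : D (aeval z G) = ∑ i, D (z i) * aeval z (pderiv i G) := by
  induction G using MvPolynomial.induction_on with
  | C α => simp [hD]
  | add f g hf hg => simp only [map_add, hf, hg, mul_add, Finset.sum_add_distrib]
  | mul_X f k hf =>
    simp only [map_mul, aeval_X, Derivation.leibniz, hf, smul_eq_mul, map_add, mul_add,
      Finset.sum_add_distrib, pderiv_X, Finset.mul_sum]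
    congr 1
    · rw [Finset.sum_eq_single k]
      · simp [mul_comm]
      · intro l _ hl
        simp [Pi.single_eq_of_ne hl.symm]
      · simp
    · exact Finset.sum_congr rfl fun i _ => by ring

theorem det_sum_rows {S κ : Type} [CommRing S] [Fintype κ] {n : ℕ} (c : Fin n → κ → S) (v : κ → Fin n → S) :
    (Matrix.of fun s t => ∑ i, c s i * v i t).det =
      ∑ I : Fin n → κ, (∏ s, c s (I s)) * (Matrix.of fun s t => v (I s) t).det := by
  have h1 : ∀ M : Matrix (Fin n) (Fin n) S, M.det =
      Matrix.detRowAlternating.toMultilinearMap (fun t s => M t s) := fun M => rfl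
  have h2 : (fun t s => (Matrix.of fun s t => ∑ i, c s i * v i t) t s) =
      fun s => ∑ i, c s i • v i := by
    funext s t
    simp
  rw [h1, h2, MultilinearMap.map_sum]
  refine Finset.sum_congr rfl fun I _ => ?_
  rw [MultilinearMap.map_smul_univ]
  rfl

theorem det_mul_rows {S : Type} [CommRing S] {n : ℕ} (c : Fin n → S) (M : Fin n → Fin n → S) :
    (Matrix.of fun s t => c s * M s t).det = (∏ s, c s) * (Matrix.of fun s t => M s t).det :=
  Matrix.det_mul_column _ _

/-- Presentation of finitely many elements by a `p`-basis, up to a common denominator. -/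
theorem exists_denominator {K : Type} [Field K] [Algebra R K] [IsFractionRing R K] [CharP K p]
    {B : Set K} (hB : B ⊆ Set.range (algebraMap R K)) (hp : IsPBasis p (fun b : B => (b : K)))
    {ι : Type} [Fintype ι] (x : ι → R) :
    ∃ (J : Finset B) (β : J → R) (α : (frobenius R p).range)
      (G : ι → MvPolynomial J (frobenius R p).range), α ≠ 0 ∧
      (∀ j, algebraMap R K (β j) = j) ∧ ∀ i, α * x i = aeval β (G i) := by
  have hinj := IsFractionRing.injective R K
  choose β hβ using fun b : B => hB b.2
  choose g hg using fun i => hp.2 (algebraMap R K (x i))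
  obtain ⟨d, hd⟩ := IsLocalization.exist_integer_multiples_of_finset (nonZeroDivisors R)
    (Finset.univ.biUnion fun i => (g i).coeffs)
  have hr : ∀ i w, ∃ r : R, algebraMap R K r = algebraMap R K d * coeff w (g i) := by
    intro i w
    by_cases hw : coeff w (g i) = 0
    · exact ⟨0, by rw [hw, map_zero, mul_zero]⟩
    obtain ⟨r, hr⟩ := hd (coeff w (g i)) (Finset.mem_biUnion.2 ⟨i, Finset.mem_univ i,
      coeff_mem_coeffs w hw⟩)
    exact ⟨r, by rw [hr, Algebra.smul_def]⟩
  choose r hr using hr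
  let G : ι → MvPolynomial B (frobenius R p).range := fun i =>
    ∑ w ∈ (g i).support, monomial w ((frobenius R p).rangeRestrict (r i w))
  choose S f hf using fun i => exists_finset_rename (G i)
  let J : Finset B := Finset.univ.biUnion S
  have hSJ : ∀ i, S i ⊆ J := fun i => Finset.subset_biUnion_of_mem S (Finset.mem_univ i)
  refine ⟨J, fun j => β j, (frobenius R p).rangeRestrict d,
    fun i => rename (fun a : S i => (⟨a, hSJ i a.2⟩ : J)) (f i), ?_, fun j => hβ j, fun i => ?_⟩
  · intro h0
    have h1 : (d : R) ^ p = 0 := congrArg Subtype.val h0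
    exact nonZeroDivisors.ne_zero d.2 (pow_eq_zero_iff (Fact.out : p.Prime).ne_zero |>.1 h1)
  · have h1 : aeval (fun j : J => β j) (rename (fun a : S i => (⟨a, hSJ i a.2⟩ : J)) (f i)) =
        aeval β (G i) := by
      rw [aeval_rename, hf i, aeval_rename]; rfl
    rw [h1]
    apply hinj
    change algebraMap R K ((d : R) ^ p * x i) = _
    rw [map_mul, ← hg i, map_sum, map_sum, eval₂_eq, Finset.mul_sum]
    refine Finset.sum_congr rfl fun w _ => ?_
    rw [aeval_monomial]
    change _ = algebraMap R K ((r i w) ^ p * _)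
    rw [map_mul, map_pow, map_pow, hr, mul_pow, mul_assoc, frobenius_def, Finsupp.prod, map_prod]
    simp only [map_pow, hβ]

theorem exists_determinantal_lift (K : Type) [Field K] [Algebra R K] [IsFractionRing R K] (h : LiftsModulo R p (⊥ : Ideal (frobenius R p).range))
    {Λ : Type} [Fintype Λ] (n : ℕ) (c : Λ → R) (b : Λ → Fin n → R)
    (h0 : ∀ Δ : Fin n → Derivation ℤ K K,
      ∑ l, algebraMap R K (c l) *
        (Matrix.of fun s t => Δ s (algebraMap R K (b l t))).det = 0) :
    ∃ (κ : Type) (_ : Fintype κ) (y : κ → Rˣ) (a : κ → (frobenius R p).range)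
      (C : Λ → MvPolynomial κ (frobenius R p).range)
      (F : Λ → Fin n → MvPolynomial κ (frobenius R p).range),
      (∀ k, algebraMap (frobenius R p).range R (a k) = (y k : R) ^ p) ∧
      (∀ l, c l = aeval (fun k => (y k : R)) (C l)) ∧
      (∀ l t, b l t = aeval (fun k => (y k : R)) (F l t)) ∧
      (∀ l, c l = 1 → C l - 1 ∈ relIdeal p a) ∧
      ∀ j : Fin n → κ, ∑ l, C l * (Matrix.of fun s t => eulerDer (j s) (F l t)).det ∈ relIdeal p a := by
  let A := (frobenius R p).range
  have : CharP A p := ((frobenius R p).range.subtype.charP_iff Subtype.val_injective p).2 inferInstance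
  have : CharP K p := ((algebraMap R K).charP_iff (IsFractionRing.injective R K) p).1 inferInstance
  have hinj := IsFractionRing.injective R K
  obtain ⟨B, hB, hp⟩ := exists_isPBasis (p := p) (Set.range (algebraMap R K)) (by
    intro x
    obtain ⟨u, v, _, rfl⟩ := IsFractionRing.div_surjective (A := R) x
    exact ⟨_, ⟨u, rfl⟩, _, ⟨v, rfl⟩, rfl⟩)
  obtain ⟨J, β, α, G, hα, hβ, hG⟩ := exists_denominator hB hp (fun i : Λ × Fin n => b i.1 i.2)
  obtain ⟨κ, _, y, a, f, ha, hf, hrel⟩ := exists_unit_lift h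
    (Sum.elim (fun i : Λ × Fin n => b i.1 i.2) (Sum.elim c β))
  let i₁ : Λ × Fin n → (Λ × Fin n) ⊕ (Λ ⊕ J) := Sum.inl
  let i₂ : Λ → (Λ × Fin n) ⊕ (Λ ⊕ J) := fun l => Sum.inr (Sum.inl l)
  let i₃ : J → (Λ × Fin n) ⊕ (Λ ⊕ J) := fun l => Sum.inr (Sum.inr l)
  have h1 : ∀ i, C α * f (i₁ i) - bind₁ (fun j => f (i₃ j)) (G i) ∈ relIdeal p a := by
    intro i
    have := hrel (C α * X (i₁ i) - rename i₃ (G i)) (by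
      rw [map_sub, map_mul, aeval_C, aeval_X, aeval_rename, sub_eq_zero]
      exact hG i)
    rwa [map_sub, map_mul, bind₁_X_right, bind₁_C_right, bind₁_rename] at this
  have hpow : ∀ (D : Derivation ℤ K K) (α : A), D (algebraMap R K α) = 0 := by
    rintro D ⟨_, e, rfl⟩
    change D (algebraMap R K (e ^ p)) = 0
    rw [map_pow, Derivation.leibniz_pow, ← Nat.cast_smul_eq_nsmul K, CharP.cast_eq_zero, zero_smul]
  choose D hD using fun j : J => exists_dual_derivation hp (j : B)
  have hDX : ∀ i j : J, D i (algebraMap R K (β j)) = if j = i then 1 else 0 := by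
    intro i j
    have := hD i (X (j : B))
    rw [eval₂_X, pderiv_X] at this
    rw [hβ, this]
    by_cases hij : j = i
    · subst hij; simp
    · rw [if_neg hij, Pi.single_eq_of_ne (fun h => hij (Subtype.ext h)), eval₂_zero]
  have hDG : ∀ i l, algebraMap R K α * D i (algebraMap R K (b l.1 l.2)) =
      algebraMap R K (aeval β (pderiv i (G l))) := by
    intro i l
    have h3 := derivation_aeval (A := A) (D i) (fun α => hpow (D i) α)
      (fun j => algebraMap R K (β j)) (G l)
    rw [Finset.sum_eq_single i (fun k _ hk => by rw [hDX, if_neg hk, zero_mul])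
      (fun h => (h (Finset.mem_univ _)).elim), hDX, if_pos rfl, one_mul] at h3
    have h4 : ∀ P : MvPolynomial J A, aeval (fun j => algebraMap R K (β j)) P =
        algebraMap R K (aeval β P) := fun P => aeval_algebraMap_apply K β P
    rw [h4, h4, ← hG, map_mul, Derivation.leibniz, hpow, smul_zero, add_zero, smul_eq_mul] at h3
    exact h3
  have h2 : ∀ I : Fin n → J, ∑ l, f (i₂ l) * (Matrix.of fun s t =>
      bind₁ (fun j => f (i₃ j)) (pderiv (I s) (G (l, t)))).det ∈ relIdeal p a := by
    intro I
    have h3 := hrel (∑ l, X (i₂ l) * (Matrix.of fun s t => rename i₃ (pderiv (I s) (G (l, t)))).det) (by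
      apply hinj
      rw [map_zero, map_sum, map_sum, ← mul_zero (∏ _ : Fin n, algebraMap R K α),
        ← h0 (fun s => D (I s)), Finset.mul_sum]
      refine Finset.sum_congr rfl fun l _ => ?_
      rw [map_mul, aeval_X, map_mul, AlgHom.map_det, RingHom.map_det, mul_left_comm, ← det_mul_rows]
      congr 2
      ext s t
      rw [Matrix.of_apply, hDG (I s) (l, t)]
      simp only [RingHom.mapMatrix_apply, AlgHom.mapMatrix_apply, Matrix.map_apply, Matrix.of_apply,
        aeval_rename]
      rfl)
    rw [map_sum] at h3
    convert h3 using 2 with l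
    rw [map_mul, bind₁_X_right, AlgHom.map_det]
    congr 2
    ext s t : 2
    simp only [AlgHom.mapMatrix_apply, Matrix.map_apply, Matrix.of_apply, bind₁_rename]
    rfl
  refine ⟨κ, inferInstance, y, a, fun l => f (i₂ l), fun l t => f (i₁ (l, t)), ha,
    fun l => hf (i₂ l), fun l t => hf (i₁ (l, t)), fun l hl => ?_, fun j => ?_⟩
  · have := hrel (X (i₂ l) - 1) (by rw [map_sub, aeval_X, map_one, sub_eq_zero]; exact hl)
    rwa [map_sub, bind₁_X_right, map_one] at this
  let I := relIdeal p a
  let π := Ideal.Quotient.mk I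
  have h4 : ∀ (k : κ) (i : Λ × Fin n), π (C α * pderiv k (f (i₁ i))) =
      ∑ l, π (pderiv k (f (i₃ l))) * π (bind₁ (fun j => f (i₃ j)) (pderiv l (G i))) := by
    intro k i
    have h5 := derivation_aeval (A := A) ((pderiv k : Derivation A (MvPolynomial κ A) _).restrictScalars ℤ)
      (fun α => pderiv_C) (fun l => f (i₃ l)) (G i)
    have h6 := pderiv_mem_relIdeal p a k (h1 i)
    rw [map_sub, Derivation.leibniz, pderiv_C, smul_zero, add_zero, smul_eq_mul] at h6
    have h7 := (Ideal.Quotient.eq).2 h6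
    rw [h7]
    simp only [← map_mul, ← map_sum]
    exact congrArg _ h5
  have h8 : C (α ^ n) * ∑ l, f (i₂ l) * (Matrix.of fun s t => pderiv (j s) (f (i₁ (l, t)))).det ∈ I := by
    rw [← Ideal.Quotient.eq_zero_iff_mem, map_mul, map_sum, Finset.mul_sum]
    have h9 : ∀ l, π (C (α ^ n)) * π (f (i₂ l) * (Matrix.of fun s t => pderiv (j s) (f (i₁ (l, t)))).det) =
        ∑ J : Fin n → J, (∏ s, π (pderiv (j s) (f (i₃ (J s))))) * π (f (i₂ l) * (Matrix.of fun s t =>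
          bind₁ (fun j => f (i₃ j)) (pderiv (J s) (G (l, t)))).det) := by
      intro l
      have h10 : π (C (α ^ n)) * π (Matrix.of fun s t => pderiv (j s) (f (i₁ (l, t)))).det =
          (Matrix.of fun s t => π (C α * pderiv (j s) (f (i₁ (l, t))))).det := by
        rw [RingHom.map_det, C_pow, map_pow]
        have := det_mul_rows (fun _ : Fin n => π (C α)) (fun s t => π (pderiv (j s) (f (i₁ (l, t)))))
        rw [Finset.prod_const, Finset.card_univ, Fintype.card_fin] at this
        simp only [map_mul]
        rw [this]
        rfl
      simp only [h4] at h10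
      rw [det_sum_rows (fun s i => π (pderiv (j s) (f (i₃ i)))) (fun i t => π (bind₁ (fun j => f (i₃ j)) (pderiv i (G (l, t)))))] at h10
      rw [map_mul, mul_left_comm, h10, Finset.mul_sum]
      refine Finset.sum_congr rfl fun J _ => ?_
      rw [map_mul, RingHom.map_det, mul_left_comm]
      rfl
    rw [Finset.sum_congr rfl fun l _ => h9 l, Finset.sum_comm]
    refine Finset.sum_eq_zero fun J _ => ?_
    rw [← Finset.mul_sum, ← map_sum, Ideal.Quotient.eq_zero_iff_mem.2 (h2 J), mul_zero]
  have h11 := mem_relIdeal_sup_of_C_mul_mem (Fact.out : p.Prime).pos a (⊥ : Ideal A) (c := α ^ n)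
    (fun h => pow_ne_zero n hα h) (by rw [Ideal.map_bot, sup_bot_eq]; exact h8)
  rw [Ideal.map_bot, sup_bot_eq] at h11
  have h12 : ∀ l, f (i₂ l) * (Matrix.of fun s t => eulerDer (j s) (f (i₁ (l, t)))).det =
      (∏ s, X (j s)) * (f (i₂ l) * (Matrix.of fun s t => pderiv (j s) (f (i₁ (l, t)))).det) := by
    intro l
    rw [mul_left_comm, ← det_mul_rows]
    rfl
  rw [Finset.sum_congr rfl fun l _ => h12 l, ← Finset.mul_sum]
  exact Ideal.mul_mem_left _ _ h11

end DeterminantalLifts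

section FormsOverRegular
open MvPolynomial

variable {R : Type} [CommRing R] [IsDomain R] [IsLocalRing R] {p : ℕ} [Fact p.Prime] [CharP R p]
  (K : Type) [Field K] [Algebra R K] [IsFractionRing R K]
  (hL : LiftsModulo R p (⊥ : Ideal (frobenius R p).range)) {G : Type} [AddCommGroup G] {q : ℕ}
  {Φ : R →+ R [⋀^Fin q]→ₗ[ℤ] G} (h : IsAltDer Φ) {Λ : Type} [Fintype Λ]

include hL h
theorem altDer_sum_eq_zero (c : Λ → R) (b : Λ → Fin q → R)
    (h0 : ∀ Δ : Fin q → Derivation ℤ K K,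
      ∑ l, algebraMap R K (c l) * (Matrix.of fun s t => Δ s (algebraMap R K (b l t))).det = 0) :
    ∑ l, Φ (c l) (b l) = 0 := by
  obtain ⟨κ, _, y, a, C, F, ha, hC, hF, -, hdet⟩ := exists_determinantal_lift K hL q c b h0
  have h1 := sum_altDer_eq_zero p h y (A := (frobenius R p).range) (fun ⟨_, e, he⟩ => ⟨e, he.symm⟩)
    Finset.univ c F (fun j => by
      have h2 := aeval_eq_zero_of_mem_relIdeal ha (hdet j)
      rw [map_sum] at h2
      rw [← h2]
      exact Finset.sum_congr rfl fun l _ => by rw [map_mul, ← hC])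
  rw [← h1]
  refine Finset.sum_congr rfl fun l _ => ?_
  congr 1
  funext t
  exact hF l t

theorem altDer_sum_mem (hex : ∀ (b : Fin q → R) (_ : Fin q), Φ 1 b = 0) (b : Λ → Fin (q + 1) → R)
    (h0 : ∀ Δ : Fin (q + 1) → Derivation ℤ K K,
      ∑ l, (Matrix.of fun s t => Δ s (algebraMap R K (b l t))).det = 0) :
    ∑ l, Φ (b l 0) (fun t => b l t.succ) ∈ AddSubgroup.closure {x | ∃ (c : R) (e : Fin q → Rˣ),
        x = Φ (c ^ p * ∏ t, (e t : R) ^ (p - 1)) (fun t => e t)} := by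
  obtain ⟨κ, _, y, a, C, F, ha, hC, hF, hone, hdet⟩ := exists_determinantal_lift K hL (q + 1)
    (fun _ => 1) b (by simpa using h0)
  simp only [hF]
  refine sum_altDer_mem p h y (A := (frobenius R p).range) (fun ⟨_, e, he⟩ => ⟨e, he.symm⟩) hex a ha
    Finset.univ F fun j => ?_
  have h1 : ∑ l, (C l - 1) * (Matrix.of fun s t => eulerDer (j s) (F l t)).det ∈ relIdeal p a :=
    Ideal.sum_mem _ fun l _ => Ideal.mul_mem_right _ _ (hone l rfl)
  have h2 := Ideal.sub_mem _ (hdet j) h1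
  rw [← Finset.sum_sub_distrib] at h2
  convert h2 using 2 with l
  ring

end FormsOverRegular

section LaurentUnits
open PowerSeries

variable {R : Type} [CommRing R]

/-- Invertible power series as invertible Laurent series. -/
noncomputable def serUnit : R⟦X⟧ˣ →* (LaurentSeries R)ˣ :=
  Units.map (HahnSeries.ofPowerSeries ℤ R).toMonoidHom

theorem serUnit_val (u : R⟦X⟧ˣ) : (serUnit u : LaurentSeries R) = HahnSeries.ofPowerSeries ℤ R u := rfl

variable (R) in
/-- The uniformizer as an invertible Laurent series. -/
noncomputable def tau : (LaurentSeries R)ˣ where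
  val := HahnSeries.single 1 1
  inv := HahnSeries.single (-1) 1
  val_inv := by rw [HahnSeries.single_mul_single]; simp
  inv_val := by rw [HahnSeries.single_mul_single]; simp

theorem tau_pow_val (n : ℕ) : ((tau R ^ n : (LaurentSeries R)ˣ) : LaurentSeries R) =
    HahnSeries.ofPowerSeries ℤ R (X ^ n) := by
  induction n with
  | zero => simp
  | succ n ih => rw [pow_succ, Units.val_mul, ih, pow_succ, map_mul, HahnSeries.ofPowerSeries_X]; rfl

theorem tau_zpow_val (n : ℤ) : ((tau R ^ n : (LaurentSeries R)ˣ) : LaurentSeries R) =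
    HahnSeries.single n 1 := by
  have h1 : ∀ n : ℕ, ((tau R ^ n : (LaurentSeries R)ˣ) : LaurentSeries R) =
    HahnSeries.single (n : ℤ) 1 := fun n => by rw [tau_pow_val, HahnSeries.ofPowerSeries_X_pow]
  obtain ⟨n, rfl | rfl⟩ := n.eq_nat_or_neg
  · rw [zpow_natCast, h1]
  · rw [zpow_neg, zpow_natCast]
    refine Units.inv_eq_of_mul_eq_one_right ?_
    rw [h1, HahnSeries.single_mul_single]; simp

theorem exists_tau_zpow_mul_serUnit [IsDomain R] (x : (LaurentSeries R)ˣ) :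
    ∃ (n : ℤ) (u : R⟦X⟧ˣ), x = tau R ^ n * serUnit u := by
  have h1 := HahnSeries.isUnit_iff.1 x.isUnit
  have h2 : IsUnit (x : LaurentSeries R).powerSeriesPart := by
    rw [PowerSeries.isUnit_iff_constantCoeff, ← PowerSeries.coeff_zero_eq_constantCoeff_apply,
      LaurentSeries.powerSeriesPart_coeff]
    simpa [HahnSeries.leadingCoeff_eq] using h1
  refine ⟨(x : LaurentSeries R).order, h2.unit, Units.ext ?_⟩
  rw [Units.val_mul, tau_zpow_val, serUnit_val, IsUnit.unit_spec,
    LaurentSeries.single_order_mul_powerSeriesPart]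

variable (R) in
/-- The higher unit groups of the ring of power series. -/
def oneUnits (m : ℕ) : Subgroup R⟦X⟧ˣ where
  carrier := {u | X ^ m ∣ (u : R⟦X⟧) - 1}
  mul_mem' {u v} hu hv := by
    have : ((u * v : R⟦X⟧ˣ) : R⟦X⟧) - 1 = (u - 1) * v + (v - 1) := by push_cast; ring
    show (X : R⟦X⟧) ^ m ∣ ((u * v : R⟦X⟧ˣ) : R⟦X⟧) - 1
    rw [this]
    exact dvd_add (Dvd.dvd.mul_right hu _) hv
  one_mem' := by show X ^ m ∣ ((1 : R⟦X⟧ˣ) : R⟦X⟧) - 1; simp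
  inv_mem' {u} hu := by
    have : ((u⁻¹ : R⟦X⟧ˣ) : R⟦X⟧) - 1 = (u - 1) * (-(u⁻¹ : R⟦X⟧ˣ)) := by
      rw [sub_mul, one_mul, mul_neg, Units.mul_inv]; ring
    show (X : R⟦X⟧) ^ m ∣ ((u⁻¹ : R⟦X⟧ˣ) : R⟦X⟧) - 1
    rw [this]
    exact Dvd.dvd.mul_right hu _

theorem mem_oneUnits {m : ℕ} {u : R⟦X⟧ˣ} : u ∈ oneUnits R m ↔ X ^ m ∣ (u : R⟦X⟧) - 1 := Iff.rfl

theorem oneUnits_anti {m n : ℕ} (h : m ≤ n) : oneUnits R n ≤ oneUnits R m := fun _ hu =>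
  (pow_dvd_pow X h).trans hu

theorem isUnit_one_add {m : ℕ} (hm : 1 ≤ m) (h : R⟦X⟧) : IsUnit (1 + X ^ m * h) := by
  rw [PowerSeries.isUnit_iff_constantCoeff]
  simp [zero_pow (by omega : m ≠ 0)]

/-- The invertible power series `1 + h T ^ m`, for `m ≥ 1`. -/
noncomputable def oneAdd (m : ℕ) (h : R⟦X⟧) : R⟦X⟧ˣ :=
  if hu : IsUnit (1 + X ^ m * h) then hu.unit else 1

theorem oneAdd_val {m : ℕ} (hm : 1 ≤ m) (h : R⟦X⟧) : (oneAdd m h : R⟦X⟧) = 1 + X ^ m * h := by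
  rw [oneAdd, dif_pos (isUnit_one_add hm h), IsUnit.unit_spec]

theorem oneAdd_mem {m : ℕ} (hm : 1 ≤ m) (h : R⟦X⟧) : oneAdd m h ∈ oneUnits R m := by
  rw [mem_oneUnits, oneAdd_val hm]; simp

theorem exists_eq_oneAdd {m : ℕ} (hm : 1 ≤ m) {u : R⟦X⟧ˣ} (hu : u ∈ oneUnits R m) :
    ∃ h, u = oneAdd m h := by
  obtain ⟨h, hh⟩ := hu
  exact ⟨h, Units.ext (by rw [oneAdd_val hm, ← hh]; ring)⟩

/-- Two invertible power series congruent modulo `T ^ M` differ by a higher unit. -/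
theorem mul_inv_mem_oneUnits {M : ℕ} {u v : R⟦X⟧ˣ} (h : X ^ M ∣ (u : R⟦X⟧) - (v : R⟦X⟧)) :
    u * v⁻¹ ∈ oneUnits R M := by
  rw [mem_oneUnits]
  have : ((u * v⁻¹ : R⟦X⟧ˣ) : R⟦X⟧) - 1 = ((u : R⟦X⟧) - (v : R⟦X⟧)) * (v⁻¹ : R⟦X⟧ˣ) := by
    rw [sub_mul, Units.mul_inv, Units.val_mul]
  rw [this]
  exact Dvd.dvd.mul_right h _

/-- Invertible constants. -/
noncomputable def cstUnit : Rˣ →* R⟦X⟧ˣ := Units.map (PowerSeries.C (R := R)).toMonoidHom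

theorem cstUnit_val (c : Rˣ) : (cstUnit c : R⟦X⟧) = PowerSeries.C (c : R) := rfl

theorem exists_cstUnit_mul (u : R⟦X⟧ˣ) : ∃ (c : Rˣ), ∃ v ∈ oneUnits R 1, u = cstUnit c * v := by
  have h1 := PowerSeries.isUnit_iff_constantCoeff.1 u.isUnit
  refine ⟨h1.unit, u * (cstUnit h1.unit)⁻¹, mul_inv_mem_oneUnits ?_, by rw [mul_comm, inv_mul_cancel_right]⟩
  rw [pow_one, PowerSeries.X_dvd_iff, cstUnit_val]
  simp

end LaurentUnits

section Steinberg

/-- Bimultiplicative maps satisfying the Steinberg relation. -/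
structure IsSteinberg {F G : Type} [CommRing F] [AddCommGroup G] (B : Fˣ → Fˣ → G) : Prop where
  mul_left : ∀ x y z, B (x * y) z = B x z + B y z
  mul_right : ∀ x y z, B x (y * z) = B x y + B x z
  steinberg : ∀ x y : Fˣ, (x : F) + y = 1 → B x y = 0

namespace IsSteinberg

variable {F G : Type} [CommRing F] [AddCommGroup G] {B : Fˣ → Fˣ → G} (h : IsSteinberg B)
include h

theorem one_left (x : Fˣ) : B 1 x = 0 := by simpa using h.mul_left 1 1 x

theorem one_right (x : Fˣ) : B x 1 = 0 := by simpa using h.mul_right x 1 1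

theorem inv_left (x y : Fˣ) : B x⁻¹ y = - B x y := by
  rw [eq_neg_iff_add_eq_zero, ← h.mul_left, inv_mul_cancel, h.one_left]

theorem inv_right (x y : Fˣ) : B x y⁻¹ = - B x y := by
  rw [eq_neg_iff_add_eq_zero, ← h.mul_right, inv_mul_cancel, h.one_right]

theorem apply_neg_of_isUnit {x : Fˣ} (hx : IsUnit (1 - (x : F))) : B x (-x) = 0 := by
  have h1 : IsUnit (1 - ((x⁻¹ : Fˣ) : F)) := by
    have : 1 - ((x⁻¹ : Fˣ) : F) = (1 - (x : F)) * ((-x⁻¹ : Fˣ) : F) := by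
      rw [Units.val_neg, mul_neg, sub_mul, Units.mul_inv]; ring
    rw [this]
    exact hx.mul (Units.isUnit _)
  have h2 : -x = hx.unit * h1.unit⁻¹ := by
    rw [eq_mul_inv_iff_mul_eq]
    refine Units.ext ?_
    rw [Units.val_mul, IsUnit.unit_spec, IsUnit.unit_spec, Units.val_neg, mul_sub]
    linear_combination Units.mul_inv x
  have h3 : B x⁻¹ h1.unit = 0 := h.steinberg _ _ (by rw [IsUnit.unit_spec]; ring)
  rw [h.inv_left, neg_eq_zero] at h3
  rw [h2, h.mul_right, h.inv_right, h3, neg_zero, add_zero]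
  exact h.steinberg _ _ (by rw [IsUnit.unit_spec]; ring)

theorem apply_neg_inv {x : Fˣ} (hx : B x⁻¹ (-x⁻¹) = 0) : B x (-x) = 0 := by
  have h1 : -x⁻¹ = (-x)⁻¹ := by simp
  rwa [h1, h.inv_left, h.inv_right, neg_neg] at hx

theorem swap_of_apply_neg (h0 : ∀ x, B x (-x) = 0) (x y : Fˣ) : B x y = - B y x := by
  have h1 := h0 (x * y)
  have h2 : -(x * y) = -x * y := by simp
  have h3 : B y (-(x * y)) = B y x := by
    rw [show -(x * y) = x * -y by simp, h.mul_right, h0, add_zero]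
  rw [h.mul_left, h3, h2, h.mul_right, h0, zero_add] at h1
  exact eq_neg_of_add_eq_zero_left h1

end IsSteinberg

open PowerSeries

variable {R G : Type} [CommRing R] [IsDomain R] [AddCommGroup G]
  {B : (LaurentSeries R)ˣ → (LaurentSeries R)ˣ → G} (h : IsSteinberg B)
include h

namespace IsSteinberg

theorem apply_neg_of_pos {n : ℕ} (hn : 1 ≤ n) (u : R⟦X⟧ˣ) :
    B (tau R ^ n * serUnit u) (-(tau R ^ n * serUnit u)) = 0 := by
  refine h.apply_neg_of_isUnit ?_
  rw [Units.val_mul, tau_pow_val, serUnit_val, ← map_mul, ← map_one (HahnSeries.ofPowerSeries ℤ R), ← map_sub]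
  refine IsUnit.map _ ?_
  have := isUnit_one_add hn (-(u : R⟦X⟧))
  rwa [mul_neg, ← sub_eq_add_neg] at this

theorem apply_neg (x : (LaurentSeries R)ˣ) : B x (-x) = 0 := by
  obtain ⟨n, u, rfl⟩ := exists_tau_zpow_mul_serUnit x
  rcases lt_trichotomy n 0 with hn | hn | hn
  · apply h.apply_neg_inv
    obtain ⟨k, hk⟩ := Int.eq_ofNat_of_zero_le (a := -n) (by omega)
    have := h.apply_neg_of_pos (n := k) (by omega) u⁻¹
    rw [mul_inv, ← zpow_neg, hk, zpow_natCast, ← map_inv]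
    exact this
  · subst hn
    rw [zpow_zero, one_mul]
    set x := serUnit u
    have key : ∀ n : ℕ, 1 ≤ n → B x (-x) + n • (B x (tau R) + B (tau R) x) = 0 := by
      intro n hn
      have h1 := h.apply_neg_of_pos hn u
      have h2 := h.apply_neg_of_pos hn 1
      rw [map_one, mul_one] at h2
      have hl : ∀ y, B (tau R ^ n) y = n • B (tau R) y := by
        intro y
        clear * - h
        induction n with
        | zero => simp [h.one_left]
        | succ n ih => rw [pow_succ, h.mul_left, ih, succ_nsmul]
      have hr : ∀ y, B y (tau R ^ n) = n • B y (tau R) := by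
        intro y
        clear * - h
        induction n with
        | zero => simp [h.one_right]
        | succ n ih => rw [pow_succ, h.mul_right, ih, succ_nsmul]
      rw [h.mul_left] at h1
      have e1 : -(tau R ^ n * serUnit u) = -(tau R ^ n) * x := by simp [x]
      have e2 : -(tau R ^ n * serUnit u) = tau R ^ n * -x := by simp [x]
      nth_rw 1 [e1] at h1
      rw [e2] at h1
      rw [h.mul_right, h2, hl, h.mul_right, hr] at h1
      rw [smul_add, ← h1]
      abel
    have h1 := key 1 le_rfl
    have h2 := key 2 (by norm_num)
    rw [one_smul] at h1
    rw [two_smul] at h2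
    rw [eq_neg_of_add_eq_zero_right h1] at h2
    simpa using h2
  · obtain ⟨k, rfl⟩ := Int.eq_ofNat_of_zero_le hn.le
    rw [zpow_natCast]
    exact h.apply_neg_of_pos (by omega) u

theorem swap (x y : (LaurentSeries R)ˣ) : B x y = - B y x := h.swap_of_apply_neg h.apply_neg x y

/-- The product of two higher unit groups, in a quotient where sufficiently high units vanish. -/
theorem oneUnits_oneUnits [IsLocalRing R] {m n : ℕ} (hm : 1 ≤ m) (hn : 1 ≤ n)
    (hv : ∀ u ∈ oneUnits R (m + n), ∀ y, B (serUnit u) y = 0)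
    {u v : R⟦X⟧ˣ} (hu : u ∈ oneUnits R m) (hv' : v ∈ oneUnits R n) : B (serUnit u) (serUnit v) = 0 := by
  have hvr : ∀ u ∈ oneUnits R (m + n), ∀ y, B y (serUnit u) = 0 := fun u hu y => by
    rw [h.swap, hv u hu, neg_zero]
  have key : ∀ a : R⟦X⟧ˣ, B (serUnit (oneAdd m a)) (serUnit v) = 0 := by
    intro a
    obtain ⟨b, rfl⟩ := exists_eq_oneAdd hn hv'
    set w := oneAdd (m + n) (-((a : R⟦X⟧) * b))
    have hw : w ∈ oneUnits R (m + n) := oneAdd_mem (by omega) _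
    have hw' : (w : R⟦X⟧) = 1 - (X ^ m * (a : R⟦X⟧)) * (X ^ n * b) := by rw [oneAdd_val (by omega)]; ring
    have h1 : B (serUnit (oneAdd m a * w⁻¹)) (-(tau R ^ m * serUnit a) * serUnit (oneAdd n b * w⁻¹)) = 0 := by
      apply h.steinberg
      rw [Units.val_mul, Units.val_neg, Units.val_mul, tau_pow_val]
      simp only [serUnit_val]
      rw [← map_mul, ← map_neg, ← map_mul, ← map_add, ← map_one (HahnSeries.ofPowerSeries ℤ R)]
      congr 1
      rw [Units.val_mul, Units.val_mul, oneAdd_val hm, oneAdd_val hn]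
      have h3 := Units.mul_inv w
      rw [hw'] at h3
      linear_combination h3
    have h2 : B (serUnit (oneAdd m a)) (-(tau R ^ m * serUnit a)) = 0 := by
      apply h.steinberg
      rw [Units.val_neg, Units.val_mul, tau_pow_val, serUnit_val, serUnit_val, oneAdd_val hm, map_add, map_mul,
        map_one]
      ring
    rw [map_mul, h.mul_left, hv _ (inv_mem hw), add_zero, h.mul_right, h2, zero_add, map_mul, h.mul_right,
      hvr _ (inv_mem hw), add_zero] at h1
    exact h1
  obtain ⟨a, rfl⟩ := exists_eq_oneAdd hm hu
  by_cases ha : IsUnit a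
  · exact key ha.unit
  · have h1 : ¬ IsUnit (PowerSeries.constantCoeff a) := fun h => ha (PowerSeries.isUnit_iff_constantCoeff.2 h)
    have h2 : IsUnit (a - 1) := by
      rw [PowerSeries.isUnit_iff_constantCoeff, map_sub, map_one]
      exact (IsLocalRing.isUnit_or_isUnit_one_sub_self _).resolve_left h1 |>.neg |> (by simpa using ·)
    have h3 : oneAdd m a = oneAdd m ((1 : R⟦X⟧ˣ) : R⟦X⟧) * oneAdd m ((h2.unit * (oneAdd m 1)⁻¹ : R⟦X⟧ˣ) : R⟦X⟧) := by
      refine Units.ext ?_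
      rw [Units.val_mul, oneAdd_val hm, oneAdd_val hm, oneAdd_val hm, Units.val_one, Units.val_mul,
        IsUnit.unit_spec]
      have h4 := Units.mul_inv (oneAdd m (1 : R⟦X⟧))
      rw [oneAdd_val hm] at h4
      linear_combination (-(X ^ m * (a - 1))) * h4
    rw [h3, map_mul, h.mul_left, key, key, add_zero]

end IsSteinberg

end Steinberg

section Symbols

/-- Multiplicative maps satisfying the Steinberg relation in any two slots. -/
structure IsSymbolMap {F G : Type} [CommRing F] [AddCommGroup G] {k : ℕ} (S : (Fin k → Fˣ) → G) : Prop where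
  mul : ∀ a i x y, S (Function.update a i (x * y)) = S (Function.update a i x) + S (Function.update a i y)
  steinberg : ∀ a i j, i ≠ j → (a i : F) + a j = 1 → S a = 0

variable {F G : Type} [CommRing F] [AddCommGroup G] {k : ℕ}

theorem MilnorK.symbol_mul (a : Fin k → Fˣ) (i : Fin k) (x y : Fˣ) :
    MilnorK.symbol (Function.update a i (x * y)) =
      MilnorK.symbol (Function.update a i x) + MilnorK.symbol (Function.update a i y) := by
  have h1 : FreeAbelianGroup.of (Function.update a i (x * y)) - FreeAbelianGroup.of (Function.update a i x) -
      FreeAbelianGroup.of (Function.update a i y) ∈ milnorRel F k := by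
    refine AddSubgroup.subset_closure (Or.inl ⟨Function.update a i x, Function.update a i y, i, ?_, ?_⟩)
    · intro j hj
      rw [Function.update_of_ne hj, Function.update_of_ne hj]
    · simp
  have h2 := (QuotientAddGroup.eq_zero_iff _).2 h1
  rw [QuotientAddGroup.mk_sub, QuotientAddGroup.mk_sub, sub_sub, sub_eq_zero] at h2
  exact h2

theorem MilnorK.symbol_steinberg (a : Fin k → Fˣ) {i j : Fin k} (hij : (i : ℕ) + 1 = j)
    (h : (a i : F) + a j = 1) : MilnorK.symbol a = 0 :=
  (QuotientAddGroup.eq_zero_iff _).2 (AddSubgroup.subset_closure (Or.inr ⟨a, i, j, hij, h, rfl⟩))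

theorem isSteinberg_of_slots {S : (Fin k → Fˣ) → G}
    (hmul : ∀ a i x y, S (Function.update a i (x * y)) = S (Function.update a i x) + S (Function.update a i y))
    {i j : Fin k} (hij : i ≠ j) (hst : ∀ a, (a i : F) + a j = 1 → S a = 0) (a : Fin k → Fˣ) :
    IsSteinberg fun x y => S (Function.update (Function.update a i x) j y) where
  mul_left x y z := by
    simp only [Function.update_comm hij]
    exact hmul _ _ _ _
  mul_right x y z := hmul _ _ _ _
  steinberg x y h := hst _ (by simpa [Function.update_of_ne hij] using h)

namespace IsSymbolMap

variable {S : (Fin k → Fˣ) → G} (h : IsSymbolMap S)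
include h

theorem isSteinberg {i j : Fin k} (hij : i ≠ j) (a : Fin k → Fˣ) :
    IsSteinberg fun x y => S (Function.update (Function.update a i x) j y) :=
  isSteinberg_of_slots h.mul hij (fun a => h.steinberg a i j hij) a

theorem one (a : Fin k → Fˣ) (i : Fin k) : S (Function.update a i 1) = 0 := by
  simpa using h.mul a i 1 1

/-- The symbol as an additive function of one slot. -/
noncomputable def slot (a : Fin k → Fˣ) (i : Fin k) : Additive Fˣ →+ G where
  toFun x := S (Function.update a i x.toMul)
  map_zero' := h.one a i
  map_add' _ _ := h.mul a i _ _

theorem inv (a : Fin k → Fˣ) (i : Fin k) (x : Fˣ) :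
    S (Function.update a i x⁻¹) = - S (Function.update a i x) :=
  map_neg (h.slot a i) (Additive.ofMul x)

theorem zpow (a : Fin k → Fˣ) (i : Fin k) (x : Fˣ) (n : ℤ) :
    S (Function.update a i (x ^ n)) = n • S (Function.update a i x) :=
  map_zsmul (h.slot a i) n (Additive.ofMul x)

theorem pow (a : Fin k → Fˣ) (i : Fin k) (x : Fˣ) (n : ℕ) :
    S (Function.update a i (x ^ n)) = n • S (Function.update a i x) :=
  map_nsmul (h.slot a i) n (Additive.ofMul x)

theorem prod (a : Fin k → Fˣ) (i : Fin k) {ι : Type} (s : Finset ι) (x : ι → Fˣ) :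
    S (Function.update a i (∏ j ∈ s, x j)) = ∑ j ∈ s, S (Function.update a i (x j)) :=
  map_sum (h.slot a i) (fun j => Additive.ofMul (x j)) s

end IsSymbolMap

end Symbols

section LaurentSymbols
open PowerSeries

variable {R G : Type} [CommRing R] [IsDomain R] [AddCommGroup G] {k : ℕ}

theorem MilnorK.symbol_swap (a : Fin k → (LaurentSeries R)ˣ) {i j : Fin k} (hij : (i : ℕ) + 1 = j) :
    MilnorK.symbol (a ∘ Equiv.swap i j) = - MilnorK.symbol a := by
  have hne : i ≠ j := by rintro rfl; omega
  have h1 := (isSteinberg_of_slots (S := MilnorK.symbol) MilnorK.symbol_mul hne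
    (fun a h => MilnorK.symbol_steinberg a hij h) a).swap (a j) (a i)
  simp only [Function.update_eq_self] at h1
  rw [show a ∘ Equiv.swap i j = Function.update (Function.update a i (a j)) j (a i) from ?_, h1]
  · funext t
    by_cases htj : t = j
    · subst htj; simp
    · by_cases hti : t = i
      · subst hti; simp [Function.update_of_ne hne]
      · simp [Function.update_of_ne htj, Function.update_of_ne hti, Equiv.swap_apply_of_ne_of_ne hti htj]

theorem MilnorK.symbol_perm (a : Fin k → (LaurentSeries R)ˣ) (σ : Equiv.Perm (Fin k)) :
    MilnorK.symbol (a ∘ σ) = (Equiv.Perm.sign σ : ℤ) • MilnorK.symbol a := by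
  cases k with
  | zero =>
    have : σ = 1 := Subsingleton.elim _ _
    subst this
    simp
  | succ n =>
    have hσ : σ ∈ Submonoid.closure (Set.range fun i : Fin n => Equiv.swap i.castSucc i.succ) := by
      rw [Equiv.Perm.mclosure_swap_castSucc_succ]; trivial
    induction hσ using Submonoid.closure_induction generalizing a with
    | mem σ h =>
      obtain ⟨i, rfl⟩ := h
      rw [MilnorK.symbol_swap a (by simp), Equiv.Perm.sign_swap (by simp [Fin.ext_iff])]
      simp
    | one => simp
    | mul σ τ _ _ h1 h2 =>
      have : a ∘ (σ * τ : Equiv.Perm _) = (a ∘ σ) ∘ τ := rfl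
      rw [this, h2, h1, smul_smul, Equiv.Perm.sign_mul]
      congr 1
      push_cast
      ring

theorem isSymbolMap_symbol : IsSymbolMap (MilnorK.symbol (F := LaurentSeries R) (r := k)) where
  mul := MilnorK.symbol_mul
  steinberg a i j hij h := by
    obtain ⟨n, rfl⟩ : ∃ n, k = n + 2 := ⟨k - 2, by have := i.2; have := j.2; have : (i : ℕ) ≠ j := fun h => hij (Fin.ext h); omega⟩
    obtain ⟨σ, h0, h1⟩ : ∃ σ : Equiv.Perm (Fin (n + 2)), σ 0 = i ∧ σ 1 = j := by
      have h01 : (0 : Fin (n + 2)) ≠ 1 := by simp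
      refine ⟨Equiv.swap (Equiv.swap 0 i 1) j * Equiv.swap 0 i, ?_, ?_⟩
      · have : i ≠ Equiv.swap 0 i 1 := by
          intro h2
          have h3 : Equiv.swap 0 i 0 = Equiv.swap 0 i 1 := by rw [Equiv.swap_apply_left]; exact h2
          exact h01 (Equiv.injective _ h3)
        simp [Equiv.swap_apply_of_ne_of_ne this hij]
      · simp
    have h2 := MilnorK.symbol_perm a σ
    rw [MilnorK.symbol_steinberg (a ∘ σ) (i := 0) (j := 1) (by simp) (by simpa [h0, h1] using h)] at h2
    rcases Int.units_eq_one_or (Equiv.Perm.sign σ) with h3 | h3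
    · rw [h3] at h2; simpa using h2.symm
    · rw [h3] at h2; simpa using h2.symm

namespace IsSymbolMap

variable {S : (Fin k → (LaurentSeries R)ˣ) → G} (h : IsSymbolMap S)

omit [IsDomain R] in
include h in
theorem comp {G' : Type} [AddCommGroup G'] (f : G →+ G') : IsSymbolMap fun a => f (S a) where
  mul a i x y := by rw [h.mul, map_add]
  steinberg a i j hij hs := by rw [h.steinberg a i j hij hs, map_zero]

include h
theorem eq_zero_of_neg (a : Fin k → (LaurentSeries R)ˣ) {i j : Fin k} (hij : i ≠ j) (ha : a j = -a i) :
    S a = 0 := by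
  have := (h.isSteinberg hij a).apply_neg (a i)
  rwa [← ha, Function.update_eq_self, Function.update_eq_self] at this

/-- A symbol with a repeated entry is unchanged if one of the two is replaced by `-1`. -/
theorem eq_update_neg_one (a : Fin k → (LaurentSeries R)ˣ) {i j : Fin k} (hij : i ≠ j) (ha : a j = a i) :
    S a = S (Function.update a j (-1)) := by
  have h1 := h.eq_zero_of_neg (Function.update a j (-1 * a i)) hij (by simp [Function.update_of_ne hij])
  rw [h.mul, ← ha, Function.update_eq_self] at h1
  have h2 : 2 • S (Function.update a j (-1)) = 0 := by
    rw [← h.pow, neg_one_sq, h.one]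
  rw [two_nsmul] at h2
  have := h1.trans h2.symm
  exact add_left_cancel this

theorem two_nsmul_neg_one (a : Fin k → (LaurentSeries R)ˣ) (i : Fin k) :
    2 • S (Function.update a i (-1)) = 0 := by
  rw [← h.pow, neg_one_sq, h.one]

/-- Exchanging two entries changes the sign. -/
theorem swap (a : Fin k → (LaurentSeries R)ˣ) {i j : Fin k} (hij : i ≠ j) (x y : (LaurentSeries R)ˣ) :
    S (Function.update (Function.update a i x) j y) = - S (Function.update (Function.update a i y) j x) :=
  (h.isSteinberg hij a).swap x y

end IsSymbolMap

theorem symbol_mem_UT {m : ℕ} (hm : 1 ≤ m) (a : Fin k → (LaurentSeries R)ˣ) (i : Fin k) {u : R⟦X⟧ˣ}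
    (hu : u ∈ oneUnits R m) (ha : a i = serUnit u) : MilnorK.symbol a ∈ UT R m k := by
  have hk : 0 < k := i.pos
  have key : ∀ a : Fin k → (LaurentSeries R)ˣ, a ⟨0, hk⟩ = serUnit u → MilnorK.symbol a ∈ UT R m k := by
    intro a ha
    obtain ⟨h, rfl⟩ := exists_eq_oneAdd hm hu
    refine AddSubgroup.subset_closure ⟨hk, a, h, ?_, rfl⟩
    rw [ha, serUnit_val, oneAdd_val hm, ← HahnSeries.ofPowerSeries_X_pow, ← map_mul, map_add, map_one, mul_comm]
  have h1 := MilnorK.symbol_perm a (Equiv.swap ⟨0, hk⟩ i)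
  have h2 := key (a ∘ Equiv.swap ⟨0, hk⟩ i) (by simpa using ha)
  rw [h1] at h2
  have h3 := AddSubgroup.zsmul_mem _ h2 (Equiv.Perm.sign (Equiv.swap ⟨0, hk⟩ i) : ℤ)
  rw [smul_smul] at h3
  simpa using h3

omit [IsDomain R] in
theorem UT_eq_closure {m : ℕ} (hm : 1 ≤ m) (n : ℕ) :
    UT R m (n + 1) = AddSubgroup.closure {z | ∃ (a : Fin (n + 1) → (LaurentSeries R)ˣ),
      ∃ u ∈ oneUnits R m, a 0 = serUnit u ∧ z = MilnorK.symbol a} := by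
  refine le_antisymm ((AddSubgroup.closure_le _).2 ?_) ((AddSubgroup.closure_le _).2 ?_)
  · rintro z ⟨hr, a, x, hx, rfl⟩
    refine AddSubgroup.subset_closure ⟨a, oneAdd m x, oneAdd_mem hm x, Units.ext ?_, rfl⟩
    rw [← HahnSeries.ofPowerSeries_X_pow] at hx
    rw [serUnit_val, oneAdd_val hm, map_add, map_one, map_mul, mul_comm]
    exact hx
  · rintro z ⟨a, u, hu, ha, rfl⟩
    obtain ⟨h, rfl⟩ := exists_eq_oneAdd hm hu
    refine AddSubgroup.subset_closure ⟨n.succ_pos, a, h, ?_, rfl⟩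
    have : (⟨0, n.succ_pos⟩ : Fin (n + 1)) = 0 := rfl
    rw [this, ha, serUnit_val, oneAdd_val hm, ← HahnSeries.ofPowerSeries_X_pow, ← map_mul, map_add, map_one, mul_comm]

theorem UT_anti {m M : ℕ} (hm : 1 ≤ m) (h : m ≤ M) (n : ℕ) : UT R M (n + 1) ≤ UT R m (n + 1) := by
  rw [UT_eq_closure (hm.trans h), AddSubgroup.closure_le]
  rintro z ⟨a, u, hu, ha, rfl⟩
  exact symbol_mem_UT hm a 0 (oneUnits_anti h hu) ha

omit [IsDomain R] in
theorem pow_mem_oneUnits {p : ℕ} [Fact p.Prime] [CharP R p] {m : ℕ} {u : R⟦X⟧ˣ} (hu : u ∈ oneUnits R m) :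
    u ^ p ∈ oneUnits R (p * m) := by
  have : CharP R⟦X⟧ p := charP_of_injective_ringHom PowerSeries.C_injective p
  have : ExpChar R⟦X⟧ p := ExpChar.prime Fact.out
  rw [mem_oneUnits, Units.val_pow_eq_pow_val, ← one_pow (M := R⟦X⟧) p, ← sub_pow_expChar, mul_comm, pow_mul]
  exact pow_dvd_pow_of_dvd hu p

theorem nsmul_mem_UT {p : ℕ} [Fact p.Prime] [CharP R p] {m : ℕ} (hm : 1 ≤ m) (n : ℕ) {x}
    (hx : x ∈ UT R m (n + 1)) : p • x ∈ UT R (p * m) (n + 1) := by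
  have hpm : 1 ≤ p * m := Nat.mul_pos (Fact.out : p.Prime).pos hm
  rw [UT_eq_closure hm] at hx
  induction hx using AddSubgroup.closure_induction with
  | mem x hx =>
    obtain ⟨a, u, hu, ha, rfl⟩ := hx
    have h1 := isSymbolMap_symbol.pow a 0 (a 0) p
    rw [Function.update_eq_self] at h1
    rw [← h1]
    exact symbol_mem_UT hpm _ 0 (pow_mem_oneUnits hu) (by simp [ha])
  | zero => simp
  | add x y _ _ hx hy => rw [nsmul_add]; exact add_mem hx hy
  | neg x _ hx => rw [neg_nsmul]; exact neg_mem hx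

end LaurentSymbols

section Graded
open PowerSeries

/-- Symbol maps vanishing as soon as one entry lies in the `M`-th unit group. -/
structure IsGradedSymbolMap {R G : Type} [CommRing R] [AddCommGroup G] (M : ℕ) {k : ℕ}
    (S : (Fin k → (LaurentSeries R)ˣ) → G) : Prop extends IsSymbolMap S where
  vanish : ∀ a i, ∀ u ∈ oneUnits R M, a i = serUnit u → S a = 0

variable {R G : Type} [CommRing R] [AddCommGroup G]

/-- Additive maps out of a local ring are determined by their values on units. -/
theorem addMonoidHom_ext_units [IsLocalRing R] {f g : R →+ G} (h : ∀ x : Rˣ, f x = g x) : f = g := by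
  have h1 : ∀ x : R, IsUnit x → f x = g x := fun x hx => h hx.unit
  ext x
  by_cases hx : IsUnit x
  · exact h1 x hx
  · have h2 : IsUnit (1 - x) := (IsLocalRing.isUnit_or_isUnit_one_sub_self x).resolve_left hx
    have h3 := h1 _ h2
    rw [map_sub, map_sub, h1 1 isUnit_one] at h3
    exact sub_right_injective h3

/-- A unit attached to an element of a local ring. -/
noncomputable def hatUnit [IsLocalRing R] (x : R) : Rˣ := if h : IsUnit x then h.unit else
  ((IsLocalRing.isUnit_or_isUnit_one_sub_self x).resolve_left h).neg.unit

theorem hatUnit_unit [IsLocalRing R] (x : Rˣ) : hatUnit (x : R) = x := by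
  rw [hatUnit, dif_pos x.isUnit]; exact Units.ext rfl

theorem hatUnit_eq_or [IsLocalRing R] (x : R) : (hatUnit x : R) = x ∨ x = hatUnit x + 1 := by
  rw [hatUnit]
  split_ifs with h
  · exact Or.inl rfl
  · right; rw [IsUnit.unit_spec]; ring

/-- Constants as Laurent series. -/
noncomputable def cst : Rˣ →* (LaurentSeries R)ˣ := serUnit.comp cstUnit

/-- The unit `1 + a T ^ m`. -/
noncomputable def oneE (m : ℕ) (a : R) : (LaurentSeries R)ˣ := serUnit (oneAdd m (C a))

/-- The symbol `{1 + a T ^ m, u₁, …, uₙ}` for constants `uᵢ`. -/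
noncomputable def cstSymbol (m : ℕ) {n : ℕ} (S : (Fin (n + 1) → (LaurentSeries R)ˣ) → G) (a : R) (u : Fin n → Rˣ) : G :=
  S (Fin.cons (oneE m a) fun t => cst (u t))

theorem comp_update' {α β : Type} {n : ℕ} (f : α → β) (u : Fin n → α) (i : Fin n) (x : α) :
    (fun t => f (Function.update u i x t)) = Function.update (fun t => f (u t)) i (f x) := by
  funext t
  by_cases h : t = i
  · subst h; simp
  · simp [Function.update_of_ne h]

variable [IsDomain R] {m n : ℕ} {S : (Fin (n + 1) → (LaurentSeries R)ˣ) → G}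

namespace IsGradedSymbolMap

theorem cons_add (hm : 1 ≤ m) (h : IsGradedSymbolMap (m + 1) S) (a b : R) (y : Fin n → (LaurentSeries R)ˣ) :
    S (Fin.cons (oneE m (a + b)) y) = S (Fin.cons (oneE m a) y) + S (Fin.cons (oneE m b) y) := by
  set u : R⟦X⟧ˣ := oneAdd m (C (a + b))
  set v : R⟦X⟧ˣ := oneAdd m (C a) * oneAdd m (C b)
  have h1 : u * v⁻¹ ∈ oneUnits R (m + 1) := by
    apply mul_inv_mem_oneUnits
    refine ⟨-(X ^ (m - 1) * C a * C b), ?_⟩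
    rw [Units.val_mul, oneAdd_val hm, oneAdd_val hm, oneAdd_val hm, map_add]
    have : (X : R⟦X⟧) ^ m = X * X ^ (m - 1) := by rw [← pow_succ', Nat.sub_add_cancel hm]
    rw [pow_succ, this]
    ring
  have h2 := h.vanish (Function.update (Fin.cons 1 y) 0 (serUnit (u * v⁻¹))) 0 _ h1 (by simp)
  rw [map_mul, h.mul, map_inv, h.inv, map_mul, h.mul] at h2
  simp only [Fin.update_cons_zero] at h2
  exact eq_of_sub_eq_zero (by rw [sub_eq_add_neg]; exact h2)

/-- The symbol `{1 + a T ^ m, y}` as an additive function of `a`. -/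
noncomputable def consHom (hm : 1 ≤ m) (h : IsGradedSymbolMap (m + 1) S) (y : Fin n → (LaurentSeries R)ˣ) : R →+ G :=
  AddMonoidHom.mk' (fun a => S (Fin.cons (oneE m a) y)) fun a b => h.cons_add hm a b y

variable {p : ℕ} [Fact p.Prime] [CharP R p]

theorem cons_torsion (hm : 1 ≤ m) (h : IsGradedSymbolMap (m + 1) S) (a : R) (y : Fin n → (LaurentSeries R)ˣ) :
    p • S (Fin.cons (oneE m a) y) = 0 := by
  have := map_nsmul (h.consHom hm y) p a
  rw [nsmul_eq_mul, CharP.cast_eq_zero, zero_mul, map_zero] at this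
  exact this.symm

include p in
theorem cons_neg_one (hm : 1 ≤ m) (h : IsGradedSymbolMap (m + 1) S) (a : R) (y : Fin n → (LaurentSeries R)ˣ)
    (i : Fin n) : S (Fin.cons (oneE m a) (Function.update y i (-1))) = 0 := by
  rcases (Fact.out : p.Prime).eq_two_or_odd' with rfl | hp
  · have h1 : (-1 : (LaurentSeries R)ˣ) = 1 := by
      have : (-1 : R) = 1 := by
        have h2 : (2 : R) = 0 := by exact_mod_cast CharP.cast_eq_zero R 2
        linear_combination -h2
      refine Units.ext ?_
      rw [Units.val_neg, Units.val_one, ← map_one (HahnSeries.C (Γ := ℤ) (R := R)), ← map_neg, this]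
    rw [h1, Fin.cons_update]
    exact h.one _ _
  · obtain ⟨k, hk⟩ := hp
    have h1 := h.cons_torsion (p := p) hm a (Function.update y i (-1))
    have h2 := h.two_nsmul_neg_one (Fin.cons (oneE m a) y) i.succ
    rw [Fin.cons_update] at h1 ⊢
    rwa [hk, add_smul, mul_comm, mul_smul, h2, smul_zero, zero_add, one_smul] at h1

include p in
theorem cons_repeat (hm : 1 ≤ m) (h : IsGradedSymbolMap (m + 1) S) (a : R) (y : Fin n → (LaurentSeries R)ˣ)
    {i j : Fin n} (hij : i ≠ j) (hy : y j = y i) : S (Fin.cons (oneE m a) y) = 0 := by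
  rw [h.eq_update_neg_one (i := i.succ) (j := j.succ) _ (by simpa using hij) (by simpa using hy), ← Fin.cons_update]
  exact h.cons_neg_one (p := p) hm _ _ _

omit [IsDomain R] in
theorem cons_mul (h : IsGradedSymbolMap (m + 1) S) (a : (LaurentSeries R)ˣ) (y : Fin n → (LaurentSeries R)ˣ) (i : Fin n)
    (x x' : (LaurentSeries R)ˣ) : S (Fin.cons a (Function.update y i (x * x'))) =
    S (Fin.cons a (Function.update y i x)) + S (Fin.cons a (Function.update y i x')) := by
  simp only [Fin.cons_update]
  exact h.mul _ _ _ _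

omit [IsDomain R] in
theorem cons_steinberg (hm : 1 ≤ m) (h : IsGradedSymbolMap (m + 1) S) (a : Rˣ) (y : Fin n → (LaurentSeries R)ˣ) (i : Fin n) :
    S (Fin.cons (oneE m (a : R)) (Function.update y i (cst (-a)))) +
      m • S (Fin.cons (oneE m (a : R)) (Function.update y i (tau R))) = 0 := by
  have h1 : S (Fin.cons (oneE m (a : R)) (Function.update y i (cst (-a) * tau R ^ m))) = 0 := by
    refine h.steinberg _ 0 i.succ (Fin.succ_ne_zero i).symm ?_
    rw [Fin.cons_zero, Fin.cons_succ, Function.update_self, Units.val_mul, tau_pow_val, oneE, serUnit_val, cst,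
      MonoidHom.comp_apply, serUnit_val, oneAdd_val hm, cstUnit_val, ← map_mul, ← map_add, Units.val_neg, map_neg]
    rw [← map_one (HahnSeries.ofPowerSeries ℤ R)]
    congr 1
    ring
  rw [h.cons_mul] at h1
  rw [Fin.cons_update, Fin.cons_update] at h1
  rw [Fin.cons_update, Fin.cons_update]
  rwa [h.pow] at h1

include p in
theorem cons_cst_neg (hm : 1 ≤ m) (h : IsGradedSymbolMap (m + 1) S) (a : R) (y : Fin n → (LaurentSeries R)ˣ)
    (i : Fin n) (x : Rˣ) : S (Fin.cons (oneE m a) (Function.update y i (cst (-x)))) =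
      S (Fin.cons (oneE m a) (Function.update y i (cst x))) := by
  have : cst (-x) = -1 * cst x := by
    refine Units.ext ?_
    simp [cst, serUnit_val, cstUnit_val]
  rw [this, h.cons_mul, h.cons_neg_one (p := p) hm, zero_add]

variable [IsLocalRing R]

theorem exists_slotHom (hm : 1 ≤ m) (h : IsGradedSymbolMap (m + 1) S) (e : R) (u : Fin n → Rˣ) (i : Fin n) :
    ∃ f : R →+ G, ∀ x : Rˣ, f x = cstSymbol m S (e * x) (Function.update u i x) := by
  have key : ∀ e : Rˣ, ∃ f : R →+ G, ∀ x : Rˣ, f x = cstSymbol m S (e * x) (Function.update u i x) := by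
    intro e
    refine ⟨(-(m • h.consHom hm (Function.update (fun t => cst (u t)) i (tau R))) -
      h.consHom hm (Function.update (fun t => cst (u t)) i (cst (-e)))).comp (AddMonoidHom.mulLeft (e : R)), fun x => ?_⟩
    have h1 := h.cons_steinberg hm (e * x) (fun t => cst (u t)) i
    rw [← neg_mul, map_mul, h.cons_mul] at h1
    rw [cstSymbol, comp_update']
    simp only [AddMonoidHom.comp_apply, AddMonoidHom.sub_apply, AddMonoidHom.neg_apply, AddMonoidHom.smul_apply,
      AddMonoidHom.coe_mulLeft]
    simp only [consHom, AddMonoidHom.mk'_apply]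
    rw [← Units.val_mul]
    rw [add_comm] at h1
    rw [eq_comm, eq_sub_iff_add_eq, eq_neg_iff_add_eq_zero, ← h1]
    abel
  by_cases he : IsUnit e
  · exact key he.unit
  · obtain ⟨f, hf⟩ := key ((IsLocalRing.isUnit_or_isUnit_one_sub_self e).resolve_left he).unit
    obtain ⟨g, hg⟩ := key 1
    refine ⟨g - f, fun x => ?_⟩
    rw [AddMonoidHom.sub_apply, hf, hg, sub_eq_iff_eq_add]
    simp only [cstSymbol]
    rw [← h.cons_add hm]
    congr 3
    rw [Units.val_one, IsUnit.unit_spec]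
    ring

theorem exists_slotHom_hat (hm : 1 ≤ m) (h : IsGradedSymbolMap (m + 1) S) (e : R) (u : Fin n → Rˣ) (i : Fin n) :
    ∃ f : R →+ G, ∀ x : R, f x = cstSymbol m S (e * hatUnit x) (Function.update u i (hatUnit x)) := by
  obtain ⟨f, hf⟩ := h.exists_slotHom hm e u i
  refine ⟨f, fun x => ?_⟩
  have h1 : f 1 = 0 := by
    have := hf 1
    rw [Units.val_one] at this
    rw [this, cstSymbol, comp_update', map_one, Fin.cons_update]
    exact h.one _ _
  rw [← hf]
  rcases hatUnit_eq_or x with h2 | h2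
  · rw [h2]
  · nth_rw 1 [h2]
    rw [map_add, h1, add_zero]

end IsGradedSymbolMap

variable [IsLocalRing R] {p : ℕ} [Fact p.Prime] [CharP R p]

/-- The value at `a db₁ ∧ ⋯ ∧ dbₙ` of the map from forms to the graded quotient. -/
noncomputable def rhoFun (m : ℕ) (S : (Fin (n + 1) → (LaurentSeries R)ˣ) → G) (a : R) (b : Fin n → R) : G :=
  cstSymbol m S (a * ∏ t, (hatUnit (b t) : R)) fun t => hatUnit (b t)

omit [IsDomain R] in
theorem rhoFun_update (a : R) (b : Fin n → R) (i : Fin n) (x : R) :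
    rhoFun m S a (Function.update b i x) =
      cstSymbol m S ((a * ∏ t ∈ Finset.univ \ {i}, (hatUnit (b t) : R)) * hatUnit x)
        (Function.update (fun t => hatUnit (b t)) i (hatUnit x)) := by
  rw [rhoFun, comp_update' hatUnit]
  congr 1
  have h1 : ∀ t, ((hatUnit (Function.update b i x t) : Rˣ) : R) =
      Function.update (fun t => (hatUnit (b t) : R)) i (hatUnit x : R) t := by
    intro t
    by_cases h : t = i
    · subst h; simp
    · simp [Function.update_of_ne h]
  rw [Finset.prod_congr rfl fun t _ => h1 t, Finset.prod_update_of_mem (Finset.mem_univ i)]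
  ring

theorem rhoFun_update_hom (hm : 1 ≤ m) (h : IsGradedSymbolMap (m + 1) S) (a : R) (b : Fin n → R) (i : Fin n) :
    ∃ f : R →+ G, ∀ x, f x = rhoFun m S a (Function.update b i x) := by
  obtain ⟨f, hf⟩ := h.exists_slotHom_hat hm (a * ∏ t ∈ Finset.univ \ {i}, (hatUnit (b t) : R))
    (fun t => hatUnit (b t)) i
  exact ⟨f, fun x => by rw [hf, rhoFun_update]⟩

theorem rhoFun_add (hm : 1 ≤ m) (h : IsGradedSymbolMap (m + 1) S) (a a' : R) (b : Fin n → R) :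
    rhoFun m S (a + a') b = rhoFun m S a b + rhoFun m S a' b := by
  simp only [rhoFun, cstSymbol]
  rw [← h.cons_add hm, add_mul]

/-- The map from forms to the graded quotient attached to a symbol map. -/
noncomputable def rho (p : ℕ) [Fact p.Prime] [CharP R p] (hm : 1 ≤ m) (h : IsGradedSymbolMap (m + 1) S) :
    R →+ R [⋀^Fin n]→ₗ[ℤ] G :=
  AddMonoidHom.mk' (fun a =>
    { toFun := rhoFun m S a
      map_update_add' := fun {inst} b i x y => by
        have := Subsingleton.elim inst (instDecidableEqFin n)
        subst this
        obtain ⟨f, hf⟩ := rhoFun_update_hom hm h a b i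
        have h1 := map_add f x y
        rw [hf, hf, hf] at h1
        convert h1
      map_update_smul' := fun {inst} b i c x => by
        have := Subsingleton.elim inst (instDecidableEqFin n)
        subst this
        obtain ⟨f, hf⟩ := rhoFun_update_hom hm h a b i
        have h1 := map_zsmul f c x
        rw [hf, hf] at h1
        convert h1
      map_eq_zero_of_eq' := fun b i j hb hij => by
        refine h.cons_repeat (p := p) hm _ _ hij ?_
        simp only [hb] })
    fun a a' => by
      ext b
      exact rhoFun_add hm h a a' b

theorem rho_apply (hm : 1 ≤ m) (h : IsGradedSymbolMap (m + 1) S) (a : R) (b : Fin n → R) :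
    rho p hm h a b = rhoFun m S a b := rfl

theorem rho_unit (hm : 1 ≤ m) (h : IsGradedSymbolMap (m + 1) S) (a : R) (u : Fin n → Rˣ) :
    rho p hm h a (fun t => u t) = cstSymbol m S (a * ∏ t, (u t : R)) u := by
  simp [rho_apply, rhoFun, hatUnit_unit]

theorem isAltDer_rho (hm : 1 ≤ m) (h : IsGradedSymbolMap (m + 1) S) : IsAltDer (rho p hm h) := by
  intro a b i x y
  simp only [rho_apply]
  obtain ⟨f, hf⟩ := rhoFun_update_hom hm h a b i
  have hA : ∀ y, ∃ f₁ : R →+ G, ∀ x, f₁ x = rhoFun m S (a * x) (Function.update b i y) := fun y =>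
    ⟨AddMonoidHom.mk' (fun x => rhoFun m S (a * x) (Function.update b i y)) fun x x' => by
      rw [mul_add, rhoFun_add hm h], fun x => rfl⟩
  have key : ∀ y : Rˣ, ∀ x, rhoFun m S a (Function.update b i (x * y)) =
      rhoFun m S (a * x) (Function.update b i y) + rhoFun m S (a * y) (Function.update b i x) := by
    intro y x
    obtain ⟨f₁, hf₁⟩ := hA y
    obtain ⟨f₂, hf₂⟩ := rhoFun_update_hom hm h (a * y) b i
    have h1 : f.comp (AddMonoidHom.mulRight (y : R)) = f₁ + f₂ := by
      refine addMonoidHom_ext_units fun x => ?_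
      simp only [AddMonoidHom.comp_apply, AddMonoidHom.coe_mulRight, AddMonoidHom.add_apply]
      rw [hf, hf₁, hf₂, rhoFun_update, rhoFun_update, rhoFun_update, ← Units.val_mul, hatUnit_unit, hatUnit_unit,
        hatUnit_unit]
      set E := ∏ t ∈ Finset.univ \ {i}, (hatUnit (b t) : R)
      simp only [cstSymbol, comp_update']
      rw [map_mul, h.cons_mul, add_comm, Units.val_mul]
      congr 4 <;> ring
    have h2 := DFunLike.congr_fun h1 x
    simp only [AddMonoidHom.comp_apply, AddMonoidHom.coe_mulRight, AddMonoidHom.add_apply] at h2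
    rwa [hf, hf₁, hf₂] at h2
  obtain ⟨f₁, hf₁⟩ := rhoFun_update_hom hm h (a * x) b i
  obtain ⟨f₂, hf₂⟩ := hA x
  have h1 : f.comp (AddMonoidHom.mulLeft x) = f₁ + f₂ := by
    refine addMonoidHom_ext_units fun y => ?_
    simp only [AddMonoidHom.comp_apply, AddMonoidHom.coe_mulLeft, AddMonoidHom.add_apply]
    rw [hf, hf₁, hf₂]
    exact key y x
  have h2 := DFunLike.congr_fun h1 y
  simp only [AddMonoidHom.comp_apply, AddMonoidHom.coe_mulLeft, AddMonoidHom.add_apply] at h2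
  rwa [hf, hf₁, hf₂] at h2

/-- Exact forms are killed in degrees divisible by the characteristic. -/
theorem rho_one_eq_zero (hm : 1 ≤ m) (h : IsGradedSymbolMap (m + 1) S) (hpm : p ∣ m) (b : Fin n → R) (i : Fin n) :
    rho p hm h 1 b = 0 := by
  rw [rho_apply, rhoFun, one_mul, cstSymbol]
  set u : Fin n → Rˣ := fun t => hatUnit (b t)
  have h0 : ∏ t, ((hatUnit (b t) : Rˣ) : R) = ((∏ t, u t : Rˣ) : R) := by simp [u]
  rw [h0]
  set e : Rˣ := ∏ t, u t
  obtain ⟨k, rfl⟩ := hpm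
  have h1 := h.cons_steinberg hm e (fun t => cst (u t)) i
  have h3 : ∀ z : G, p • z = 0 → (p * k) • z = 0 := fun z hz => by rw [mul_comm, mul_smul, hz, smul_zero]
  rw [h3 _ (h.cons_torsion hm _ _), add_zero, h.cons_cst_neg (p := p) hm] at h1
  have h2 : cst e = ∏ t, cst (u t) := by simp [e, map_prod]
  rw [h2, Fin.cons_update, h.prod, Finset.sum_eq_single i] at h1
  · simpa [← Fin.cons_update] using h1
  · intro j _ hj
    rw [← Fin.cons_update]
    exact h.cons_repeat (p := p) hm _ _ (i := i) (j := j) hj.symm (by simp [Function.update_of_ne hj])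
  · simp

end Graded

section Generation
open PowerSeries

/-- Elements of the subgroup generated by a family closed under negation are sums over the family. -/
theorem exists_sum_of_mem_closure_range {ι G : Type} [AddCommGroup G] {f : ι → G}
    (hf : ∀ i, ∃ j, f j = - f i) {x : G} (hx : x ∈ AddSubgroup.closure (Set.range f)) :
    ∃ (n : ℕ) (g : Fin n → ι), x = ∑ k, f (g k) := by
  induction hx using AddSubgroup.closure_induction with
  | mem x hx => obtain ⟨i, rfl⟩ := hx; exact ⟨1, fun _ => i, by simp⟩
  | zero => exact ⟨0, Fin.elim0, by simp⟩
  | add x y _ _ hx hy =>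
    obtain ⟨n, g, rfl⟩ := hx
    obtain ⟨n', g', rfl⟩ := hy
    exact ⟨n + n', Fin.append g g', by rw [Fin.sum_univ_add]; simp⟩
  | neg x _ hx =>
    obtain ⟨n, g, rfl⟩ := hx
    choose j hj using hf
    exact ⟨n, fun k => j (g k), by simp [hj]⟩

variable {R : Type} [CommRing R] [IsDomain R]

theorem isGradedSymbolMap_quotient {m : ℕ} (hm : 1 ≤ m) (k : ℕ) :
    IsGradedSymbolMap m (fun a : Fin k → (LaurentSeries R)ˣ =>
      (QuotientAddGroup.mk' (UT R m k)) (MilnorK.symbol a)) where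
  toIsSymbolMap := IsSymbolMap.comp (G' := MilnorK k (LaurentSeries R) ⧸ UT R m k) isSymbolMap_symbol
    (QuotientAddGroup.mk' (UT R m k))
  vanish a i _ hu ha := (QuotientAddGroup.eq_zero_iff _).2 (symbol_mem_UT hm a i hu ha)

variable {G : Type} [AddCommGroup G]

omit [IsDomain R] in
/-- Freezing the last entry of a symbol map. -/
theorem IsGradedSymbolMap.snoc {M k : ℕ} {S : (Fin (k + 1) → (LaurentSeries R)ˣ) → G} (h : IsGradedSymbolMap M S)
    (x : (LaurentSeries R)ˣ) : IsGradedSymbolMap M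
      fun a : Fin k → (LaurentSeries R)ˣ => S (Fin.snoc (α := fun _ => (LaurentSeries R)ˣ) a x) where
  mul a i y z := by
    simp only [Fin.snoc_update]
    exact h.mul _ _ _ _
  steinberg a i j hij ha := h.steinberg _ i.castSucc j.castSucc (by simpa using hij) (by simpa using ha)
  vanish a i u hu ha := h.vanish _ i.castSucc u hu (by simpa using ha)

variable {m n : ℕ} {S : (Fin (n + 1) → (LaurentSeries R)ˣ) → G}

/-- The values of a symbol map with constant entries. -/
def cstValues (m : ℕ) (S : (Fin (n + 1) → (LaurentSeries R)ˣ) → G) : AddSubgroup G :=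
  AddSubgroup.closure (Set.range fun w : R × (Fin n → Rˣ) => cstSymbol m S w.1 w.2)

/-- The values of a symbol map with one uniformizer entry and constant entries otherwise. -/
def tauValues (m : ℕ) (S : (Fin (n + 1) → (LaurentSeries R)ˣ) → G) : AddSubgroup G :=
  AddSubgroup.closure (Set.range fun w : R × (Fin n → Rˣ) × Fin n =>
    S (Fin.cons (oneE m w.1) (Function.update (fun t => cst (w.2.1 t)) w.2.2 (tau R))))

variable [IsLocalRing R] {p : ℕ} [Fact p.Prime] [CharP R p]

include p in
theorem IsGradedSymbolMap.mem_values (hm : 1 ≤ m) (h : IsGradedSymbolMap (m + 1) S)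
    (a : Fin (n + 1) → (LaurentSeries R)ˣ) {u : R⟦X⟧ˣ} (hu : u ∈ oneUnits R m) (ha : a 0 = serUnit u) :
    S a ∈ cstValues m S ⊔ tauValues m S := by
  have base : ∀ (c : R) (y : Fin n → (LaurentSeries R)ˣ), (∀ t, (∃ b, y t = cst b) ∨ y t = tau R) →
      S (Fin.cons (oneE m c) y) ∈ cstValues m S ⊔ tauValues m S := by
    intro c y hy
    by_cases h1 : ∃ i j, i ≠ j ∧ y i = tau R ∧ y j = tau R
    · obtain ⟨i, j, hij, hi, hj⟩ := h1
      rw [h.cons_repeat (p := p) hm c y hij (hj.trans hi.symm)]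
      exact zero_mem _
    push Not at h1
    by_cases h2 : ∃ i, y i = tau R
    · obtain ⟨i, hi⟩ := h2
      have h3 : ∀ t, ∃ b, t ≠ i → y t = cst b := by
        intro t
        rcases hy t with ⟨b, hb⟩ | hb
        · exact ⟨b, fun _ => hb⟩
        · exact ⟨1, fun ht => absurd hb (h1 i t ht.symm hi)⟩
      choose b hb using h3
      refine AddSubgroup.mem_sup_right (AddSubgroup.subset_closure ⟨(c, b, i), ?_⟩)
      show S _ = S _
      congr 2
      funext t
      by_cases ht : t = i
      · subst ht; simp [hi]
      · simp [Function.update_of_ne ht, hb t ht]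
    · push Not at h2
      choose b hb using fun t => (hy t).resolve_right (h2 t)
      refine AddSubgroup.mem_sup_left (AddSubgroup.subset_closure ⟨(c, b), ?_⟩)
      show S _ = S _
      congr 2
      funext t
      exact (hb t).symm
  have key : ∀ (s : Finset (Fin n)) (c : R) (y : Fin n → (LaurentSeries R)ˣ),
      (∀ t, t ∉ s → (∃ b, y t = cst b) ∨ y t = tau R) →
      S (Fin.cons (oneE m c) y) ∈ cstValues m S ⊔ tauValues m S := by
    intro s c
    induction s using Finset.induction_on with
    | empty => exact fun y hy => base c y fun t => hy t (Finset.notMem_empty t)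
    | insert i s hi ih =>
      intro y hy
      have hupd : ∀ x, ((∃ b, x = cst b) ∨ x = tau R) →
          S (Fin.cons (oneE m c) (Function.update y i x)) ∈ cstValues m S ⊔ tauValues m S := by
        intro x hx
        refine ih _ fun t ht => ?_
        by_cases hti : t = i
        · subst hti; simpa using hx
        · rw [Function.update_of_ne hti]
          exact hy t (by simp [hti, ht])
      obtain ⟨k, v, hv⟩ := exists_tau_zpow_mul_serUnit (y i)
      obtain ⟨d, w, hw, rfl⟩ := exists_cstUnit_mul v
      have h1 : S (Fin.cons (oneE m c) (Function.update y i (serUnit w))) = 0 := by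
        have h2 := (h.isSteinberg (Fin.succ_ne_zero i).symm (Fin.cons 1 y)).oneUnits_oneUnits hm le_rfl
          (fun u hu z => h.vanish _ 0 u hu (by simp [Function.update_of_ne (Fin.succ_ne_zero i).symm]))
          (oneAdd_mem hm (C c)) hw
        rwa [Fin.update_cons_zero, ← Fin.cons_update] at h2
      rw [← Function.update_eq_self i y, hv, h.cons_mul, map_mul, h.cons_mul, h1, add_zero]
      refine add_mem ?_ (hupd _ (Or.inl ⟨d, rfl⟩))
      rw [Fin.cons_update, h.zpow, ← Fin.cons_update]
      exact AddSubgroup.zsmul_mem _ (hupd _ (Or.inr rfl)) k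
  obtain ⟨f, rfl⟩ := exists_eq_oneAdd hm hu
  set c := constantCoeff f
  have h1 : oneAdd m f * (oneAdd m (C c))⁻¹ ∈ oneUnits R (m + 1) := by
    apply mul_inv_mem_oneUnits
    obtain ⟨g, hg⟩ : X ∣ f - C c := by rw [X_dvd_iff]; simp [c]
    rw [oneAdd_val hm, oneAdd_val hm]
    exact ⟨g, by rw [pow_succ]; linear_combination X ^ m * hg⟩
  have h2 := h.vanish (Function.update a 0 (serUnit (oneAdd m f * (oneAdd m (C c))⁻¹))) 0 _ h1 (by simp)
  rw [map_mul, h.mul, map_inv, h.inv, ← ha, Function.update_eq_self, ← sub_eq_add_neg, sub_eq_zero] at h2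
  rw [h2]
  have h3 := key Finset.univ c (fun t => a t.succ) (by simp)
  rwa [show Function.update a 0 (serUnit (oneAdd m (C c))) = Fin.cons (oneE m c) (fun t => a t.succ) from ?_]
  rw [← Fin.cons_self_tail a, Fin.update_cons_zero]
  rfl

theorem IsGradedSymbolMap.tauValues_le (hm : 1 ≤ m) (h : IsGradedSymbolMap (m + 1) S) (hpm : ¬ p ∣ m) :
    tauValues m S ≤ cstValues m S := by
  refine (AddSubgroup.closure_le _).2 ?_
  rintro _ ⟨⟨a, u, i⟩, rfl⟩
  show S (Fin.cons (oneE m a) (Function.update (fun t => cst (u t)) i (tau R))) ∈ cstValues m S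
  have key : ∀ e : Rˣ, S (Fin.cons (oneE m (e : R)) (Function.update (fun t => cst (u t)) i (tau R))) ∈
      cstValues m S := by
    intro e
    set z := S (Fin.cons (oneE m (e : R)) (Function.update (fun t => cst (u t)) i (tau R)))
    have h1 := h.cons_steinberg hm e (fun t => cst (u t)) i
    have h2 : m • z ∈ cstValues m S := by
      rw [eq_neg_of_add_eq_zero_right h1, ← comp_update']
      exact neg_mem (AddSubgroup.subset_closure ⟨(↑e, _), rfl⟩)
    have h3 : p • z = 0 := h.cons_torsion hm _ _
    have h4 : IsCoprime (m : ℤ) (p : ℤ) := by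
      rw [Nat.isCoprime_iff_coprime, Nat.coprime_comm]
      exact (Fact.out : p.Prime).coprime_iff_not_dvd.2 hpm
    obtain ⟨x, y, hxy⟩ := h4
    have h5 : z = x • (m • z) + y • (p • z) := by
      rw [← natCast_zsmul, ← natCast_zsmul, smul_smul, smul_smul, ← add_smul, hxy, one_smul]
    rw [h5, h3, smul_zero, add_zero]
    exact AddSubgroup.zsmul_mem _ h2 x
  by_cases ha : IsUnit a
  · exact key ha.unit
  · have h1 := key ((IsLocalRing.isUnit_or_isUnit_one_sub_self a).resolve_left ha).unit
    have h2 := key 1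
    rw [IsUnit.unit_spec] at h1
    have h3 := h.cons_add hm a (1 - a) (Function.update (fun t => cst (u t)) i (tau R))
    rw [add_sub_cancel] at h3
    rw [Units.val_one, h3] at h2
    exact (AddSubgroup.add_mem_cancel_right _ h1).1 h2

theorem IsGradedSymbolMap.exists_sum_rho (hm : 1 ≤ m) (h : IsGradedSymbolMap (m + 1) S) {x : G}
    (hx : x ∈ cstValues m S) : ∃ (N : ℕ) (a : Fin N → R) (u : Fin N → Fin n → Rˣ),
      x = ∑ l, cstSymbol m S (a l) (u l) := by
  obtain ⟨N, g, hg⟩ := exists_sum_of_mem_closure_range (fun w : R × (Fin n → Rˣ) => ⟨(-w.1, w.2),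
    map_neg (h.consHom hm (fun t => cst (w.2 t))) w.1⟩) hx
  exact ⟨N, fun l => (g l).1, fun l => (g l).2, hg⟩

include p in
theorem IsGradedSymbolMap.tauValues_le_snoc {n : ℕ} {S : (Fin (n + 2) → (LaurentSeries R)ˣ) → G}
    (hm : 1 ≤ m) (h : IsGradedSymbolMap (m + 1) S) :
    tauValues m S ≤ cstValues m (fun a : Fin (n + 1) → (LaurentSeries R)ˣ =>
      S (Fin.snoc (α := fun _ => (LaurentSeries R)ˣ) a (tau R))) := by
  refine (AddSubgroup.closure_le _).2 ?_
  rintro _ ⟨⟨a, u, i⟩, rfl⟩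
  set T := cstValues m (fun a : Fin (n + 1) → (LaurentSeries R)ˣ =>
      S (Fin.snoc (α := fun _ => (LaurentSeries R)ˣ) a (tau R)))
  have base : ∀ v : Fin n → Rˣ, S (Fin.cons (oneE m a) (Fin.snoc (α := fun _ => (LaurentSeries R)ˣ)
      (fun t => cst (v t)) (tau R))) ∈ T := by
    intro v
    refine AddSubgroup.subset_closure ⟨(a, v), ?_⟩
    show S _ = S _
    rw [Fin.cons_snoc_eq_snoc_cons]
  have hlast : ∀ u : Fin (n + 1) → Rˣ, S (Fin.cons (oneE m a)
      (Function.update (fun t => cst (u t)) (Fin.last n) (tau R))) ∈ T := by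
    intro u
    have := base (fun t => u t.castSucc)
    convert this using 3
    funext t
    refine Fin.lastCases ?_ (fun t => ?_) t
    · simp
    · simp
  by_cases hi : i = Fin.last n
  · subst hi; exact hlast u
  · show S (Fin.cons (oneE m a) (Function.update (fun t => cst (u t)) i (tau R))) ∈ T
    have h1 := h.swap (Fin.cons (oneE m a) fun t => cst (u t)) (i := i.succ) (j := (Fin.last n).succ)
      (by simpa using hi) (tau R) (cst (u (Fin.last n)))
    have h2 : Function.update (Fin.cons (oneE m a) fun t => cst (u t) : Fin (n + 2) → (LaurentSeries R)ˣ) i.succ (tau R) (Fin.last n).succ =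
        cst (u (Fin.last n)) := by
      rw [Function.update_of_ne (fun h => hi (Fin.succ_injective _ h).symm)]; rfl
    rw [← h2, Function.update_eq_self, h2] at h1
    simp only [← Fin.cons_update] at h1
    rw [h1, ← comp_update']
    exact neg_mem (hlast _)

end Generation

section TestHom
open MvPolynomial

variable {K : Type} [Field K] (p : ℕ) [Fact p.Prime] [CharP K p]

theorem exists_squareZero_lift {S : Type} [CommRing S] (hS : ((p : ℕ) : S) = 0) (I : Ideal S) (hI : I ^ 2 = ⊥)
    (f : K →+* S ⧸ I) : ∃ g : K →+* S, (Ideal.Quotient.mk I).comp g = f := by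
  by_cases hS' : Nontrivial S
  swap
  · have : Subsingleton S := not_nontrivial_iff_subsingleton.1 hS'
    have h1 : Subsingleton (S ⧸ I) := (Ideal.Quotient.mk_surjective (I := I)).subsingleton
    exact ⟨⟨⟨⟨fun _ => 0, Subsingleton.elim _ _⟩, fun _ _ => Subsingleton.elim _ _⟩,
      Subsingleton.elim _ _, fun _ _ => Subsingleton.elim _ _⟩, RingHom.ext fun _ => Subsingleton.elim _ _⟩
  have hc : CharP S p := (CharP.charP_iff_prime_eq_zero Fact.out).2 hS
  obtain ⟨B, -, hB⟩ := exists_isPBasis (K := K) (p := p) Set.univ (fun x => ⟨x, trivial, 1, trivial, by simp⟩)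
  have hp : 2 ≤ p := (Fact.out : p.Prime).two_le
  have hker : ∀ a ∈ I, frobenius S p a = 0 := fun a ha => by
    have : a ^ p ∈ I ^ 2 := Ideal.pow_le_pow_right hp (Ideal.pow_mem_pow ha p)
    rwa [hI] at this
  let Ψ : K →+* S := (Ideal.Quotient.lift I (frobenius S p) hker).comp f
  choose y hy using fun b : B => Ideal.Quotient.mk_surjective (f b)
  have hΨ : ∀ b : B, y b ^ p = Ψ b := fun b => by
    simp only [Ψ, RingHom.comp_apply, ← hy, Ideal.Quotient.lift_mk, frobenius_def]
  have hΨ' : ∀ c, Ideal.Quotient.mk I (Ψ c) = f c ^ p := fun c => by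
    obtain ⟨s, hs⟩ := Ideal.Quotient.mk_surjective (f c)
    simp only [Ψ, RingHom.comp_apply, ← hs, Ideal.Quotient.lift_mk, frobenius_def, map_pow]
  let e : MvPolynomial B K →+* K := eval₂Hom (frobenius K p) (fun b => (b : K))
  have he : Function.Surjective e := hB.2
  let g' : MvPolynomial B K →+* S := eval₂Hom Ψ y
  have hle : RingHom.ker e ≤ RingHom.ker g' := by
    intro q hq
    have h1 : q ∈ relIdeal p (fun b : B => (b : K)) := (eval₂_frobenius_eq_zero_iff hB.1 q).1 hq
    refine (Ideal.span_le.2 ?_ : relIdeal p (fun b : B => (b : K)) ≤ RingHom.ker g') h1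
    rintro _ ⟨k, rfl⟩
    simp [RingHom.mem_ker, g', hΨ]
  refine ⟨e.liftOfSurjective he ⟨g', hle⟩, ?_⟩
  have h2 : ((Ideal.Quotient.mk I).comp g') = f.comp e := by
    refine MvPolynomial.ringHom_ext (fun c => ?_) (fun b => ?_)
    · simp [g', e, hΨ', frobenius_def]
    · simp [g', e, hy]
  ext a
  obtain ⟨q, rfl⟩ := he a
  have h3 := RingHom.liftOfRightInverse_comp_apply e _ (Function.rightInverse_surjInv he) ⟨g', hle⟩ q
  exact (congrArg (Ideal.Quotient.mk I) h3).trans (RingHom.congr_fun h2 q)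

theorem factor_evalₐ {S : Type} [CommRing S] (I : Ideal S) {m n : ℕ} (h : m ≤ n) (x : AdicCompletion I S) :
    Ideal.Quotient.factor (Ideal.pow_le_pow_right h) (AdicCompletion.evalₐ I n x) = AdicCompletion.evalₐ I m x := by
  obtain ⟨c, rfl⟩ := AdicCompletion.mk_surjective I S x
  rw [AdicCompletion.evalₐ_mk, AdicCompletion.evalₐ_mk, Ideal.Quotient.factor_mk, eq_comm, Ideal.Quotient.eq]
  have := SModEq.sub_mem.1 (c.property h)
  simpa using this

theorem formallySmooth_zmod [Algebra (ZMod p) K] : Algebra.FormallySmooth (ZMod p) K := by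
  refine Algebra.FormallySmooth.of_comp_surjective fun S _ _ I hI f => ?_
  have hS : ((p : ℕ) : S) = 0 := by
    rw [← map_natCast (algebraMap (ZMod p) S), CharP.cast_eq_zero, map_zero]
  obtain ⟨g, hg⟩ := exists_squareZero_lift p hS I hI f.toRingHom
  refine ⟨⟨g, fun r => ?_⟩, ?_⟩
  · exact RingHom.congr_fun (Subsingleton.elim (g.comp (algebraMap (ZMod p) K)) (algebraMap (ZMod p) S)) r
  · ext a
    exact RingHom.congr_fun hg a

include p in
/-- A field of characteristic `p` has a Taylor expansion with prescribed first order terms. -/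
theorem exists_testHom {r : ℕ} (Δ : Fin r → Derivation ℤ K K) : ∃ H : K →+* MvPowerSeries (Fin r) K,
    ∀ a, MvPowerSeries.constantCoeff (H a) = a ∧
      ∀ s, MvPowerSeries.coeff (Finsupp.single s 1) (H a) = Δ s a := by
  let S := MvPolynomial (Fin r) K
  let J : Ideal S := idealOfVars (Fin r) K
  let _ : Algebra (ZMod p) K := ZMod.algebra K p
  have := formallySmooth_zmod (K := K) p
  let f0 : K → S := fun a => C a + ∑ s, C (Δ s a) * X s
  have hX : ∀ s, (X s : S) ∈ J := fun s => Ideal.subset_span ⟨s, rfl⟩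
  have hJ : ∀ a, ∑ s, C (Δ s a) * X s ∈ J := fun a =>
    Ideal.sum_mem _ fun s _ => Ideal.mul_mem_left _ _ (hX s)
  let f : K →+* S ⧸ J ^ 2 :=
    { toFun := fun a => Ideal.Quotient.mk _ (f0 a)
      map_one' := by simp [f0]
      map_zero' := by simp [f0]
      map_add' := fun a b => by
        rw [← map_add]; congr 1
        simp only [f0, map_add, add_mul, Finset.sum_add_distrib]; ring
      map_mul' := fun a b => by
        rw [← map_mul, Ideal.Quotient.eq]
        have : f0 (a * b) - f0 a * f0 b = - ((∑ s, C (Δ s a) * X s) * (∑ s, C (Δ s b) * X s)) := by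
          simp only [f0, Derivation.leibniz, smul_eq_mul, map_add, map_mul, add_mul,
            Finset.sum_add_distrib, mul_assoc, ← Finset.mul_sum]
          ring
        rw [this, pow_two]
        exact (Ideal.neg_mem_iff _).2 (Ideal.mul_mem_mul (hJ a) (hJ b)) }
  let fA : K →ₐ[ZMod p] S ⧸ J ^ 2 := ⟨f, fun r =>
    RingHom.congr_fun (Subsingleton.elim (f.comp (algebraMap (ZMod p) K)) (algebraMap (ZMod p) _)) r⟩
  obtain ⟨g, hg⟩ := Algebra.FormallySmooth.exists_adicCompletionEvalOneₐ_comp_eq fA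
  have hle : ∀ n : ℕ, (J ^ 2) ^ n ≤ J ^ n := fun n => by
    rw [← pow_mul]; exact Ideal.pow_le_pow_right (by omega)
  let G : AdicCompletion (J ^ 2) S →+* AdicCompletion J S := AdicCompletion.liftRingHom J
    (fun n => (Ideal.Quotient.factor (hle n)).comp (AdicCompletion.evalₐ (J ^ 2) n).toRingHom) (by
      intro m n hmn
      refine RingHom.ext fun x => ?_
      obtain ⟨y, hy⟩ := Ideal.Quotient.mk_surjective (AdicCompletion.evalₐ (J ^ 2) n x)
      have h1 := factor_evalₐ (J ^ 2) hmn x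
      rw [← hy, Ideal.Quotient.factor_mk] at h1
      change Ideal.Quotient.factor (Ideal.pow_le_pow_right hmn) (Ideal.Quotient.factor (hle n) (AdicCompletion.evalₐ (J ^ 2) n x)) =
        Ideal.Quotient.factor (hle m) (AdicCompletion.evalₐ (J ^ 2) m x)
      rw [← hy, ← h1]
      rfl)
  let e := MvPowerSeries.toAdicCompletionAlgEquiv (Fin r) K
  refine ⟨(e.symm.toRingEquiv.toRingHom.comp G).comp g.toRingHom, fun a => ?_⟩
  set F : MvPowerSeries (Fin r) K := ((e.symm.toRingEquiv.toRingHom.comp G).comp g.toRingHom) a with hF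
  have h1 : e F = G (g a) := e.apply_symm_apply (G (g a))
  have h2 : AdicCompletion.evalₐ J 2 (G (g a)) = Ideal.Quotient.mk _ (MvPowerSeries.truncTotal 2 F) := by
    rw [← h1]
    change AdicCompletion.evalₐ J 2 (MvPowerSeries.toAdicCompletion (Fin r) K F) = _
    rw [MvPowerSeries.toAdicCompletion]
    rw [AdicCompletion.evalₐ_liftAlgHom]
    · rfl
    · exact fun h => AlgHom.ext fun F' => Ideal.Quotient.eq.2
        (MvPowerSeries.truncTotal_sub_truncTotal_mem_pow_idealOfVars (σ := Fin r) (R := K) h le_rfl F')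
  obtain ⟨y, hy⟩ := Ideal.Quotient.mk_surjective (AdicCompletion.evalₐ (J ^ 2) 2 (g a))
  have h3 : AdicCompletion.evalₐ J 2 (G (g a)) = Ideal.Quotient.mk _ y := by
    have : AdicCompletion.evalₐ J 2 (G (g a)) =
        Ideal.Quotient.factor (hle 2) (AdicCompletion.evalₐ (J ^ 2) 2 (g a)) :=
      AdicCompletion.evalₐ_liftRingHom J _ _ 2 (g a)
    rw [this, ← hy]; rfl
  have h4 : Ideal.Quotient.mk (J ^ 2) y = Ideal.Quotient.mk _ (f0 a) := by
    have h5 := factor_evalₐ (J ^ 2) (one_le_two) (g a)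
    rw [← hy, Ideal.Quotient.factor_mk] at h5
    have h6 : AdicCompletion.evalOneₐ (J ^ 2) (g a) = Ideal.Quotient.mk _ (f0 a) :=
      DFunLike.congr_fun hg a
    rw [← AdicCompletion.factorₐ_evalₐ_one, ← h5, Ideal.Quotient.factor_mk] at h6
    exact h6
  have h7 : MvPowerSeries.truncTotal 2 F - f0 a ∈ J ^ 2 := Ideal.Quotient.eq.1 (h2.symm.trans (h3.trans h4))
  have h8 := (mem_pow_idealOfVars_iff' 2 _).1 h7
  have h9 : ∀ x : Fin r →₀ ℕ, x.degree < 2 → MvPowerSeries.coeff x F = (f0 a).coeff x := fun x hx => by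
    have := h8 x hx
    rw [MvPolynomial.coeff_sub, MvPowerSeries.coeff_truncTotal _ hx, sub_eq_zero] at this
    exact this
  constructor
  · rw [← MvPowerSeries.coeff_zero_eq_constantCoeff_apply, h9 0 (by simp)]
    change MvPolynomial.coeff 0 (C a + ∑ s, C (Δ s a) * X s : MvPolynomial (Fin r) K) = a
    simp [MvPolynomial.coeff_sum, MvPolynomial.coeff_C_mul]
  · intro s
    rw [h9 _ (by simp)]
    change MvPolynomial.coeff _ (C a + ∑ s, C (Δ s a) * X s : MvPolynomial (Fin r) K) = _
    have h0 : (0 : Fin r →₀ ℕ) ≠ Finsupp.single s 1 := by simp [eq_comm]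
    rw [MvPolynomial.coeff_add, MvPolynomial.coeff_C, if_neg h0, MvPolynomial.coeff_sum]
    simp [MvPolynomial.coeff_C_mul, MvPolynomial.coeff_X, Finsupp.single_left_inj]

end TestHom

section Piola
variable {k C : Type} [CommRing k] [CommRing C] [Algebra k C]

theorem derivation_prod {ι : Type} [DecidableEq ι] (D : Derivation k C C) (f : ι → C) (s : Finset ι) :
    D (∏ i ∈ s, f i) = ∑ i ∈ s, ∏ j ∈ s, Function.update f i (D (f i)) j := by
  induction s using Finset.induction_on with
  | empty => simp
  | insert a s ha ih =>
    rw [Finset.prod_insert ha, Derivation.leibniz, ih, Finset.sum_insert ha, Finset.prod_insert ha,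
      add_comm, smul_eq_mul, smul_eq_mul, Finset.mul_sum, Function.update_self]
    congr 1
    · rw [mul_comm]
      congr 1
      refine Finset.prod_congr rfl fun j hj => ?_
      rw [Function.update_of_ne (by rintro rfl; exact ha hj)]
    · refine Finset.sum_congr rfl fun i hi => ?_
      rw [Finset.prod_insert ha, Function.update_of_ne (by rintro rfl; exact ha hi)]

theorem derivation_det {n : Type} [Fintype n] [DecidableEq n] (D : Derivation k C C) (N : Matrix n n C) :
    D N.det = ∑ t, (N.updateRow t fun s => D (N t s)).det := by
  rw [← Matrix.det_transpose, Matrix.det_apply, map_sum]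
  simp_rw [← Matrix.det_transpose (Matrix.updateRow _ _ _), Matrix.det_apply]
  rw [Finset.sum_comm]
  refine Finset.sum_congr rfl fun σ _ => ?_
  rw [Units.smul_def, map_zsmul, derivation_prod, Finset.smul_sum]
  refine Finset.sum_congr rfl fun t _ => ?_
  rw [Units.smul_def]
  congr 1
  refine Finset.prod_congr rfl fun j _ => ?_
  by_cases h : j = t
  · subst h; simp
  · simp [Function.update_of_ne h, Matrix.updateRow_ne h]

theorem sum_symm_mul_alt_eq_zero {n : Type} [Fintype n] [DecidableEq n] (a b : n → n → C)
    (ha : ∀ s s', a s s' = a s' s) (hb : ∀ s, b s s = 0) (hb' : ∀ s s', b s s' = - b s' s) :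
    ∑ s, ∑ s', a s s' * b s s' = 0 := by
  rw [← Finset.univ.sum_product' Finset.univ]
  refine Finset.sum_involution (fun x _ => x.swap) (fun x _ => ?_) (fun x _ hx hs => hx ?_)
    (fun _ _ => Finset.mem_univ _) (fun x _ => Prod.swap_swap x)
  · simp only [Prod.fst_swap, Prod.snd_swap]
    rw [ha x.2 x.1, hb' x.2 x.1]; ring
  · have : x.2 = x.1 := congrArg Prod.fst hs
    rw [this, hb, mul_zero]

variable {n : Type} [Fintype n] [DecidableEq n] (θ : n → Derivation k C C)

/-- The divergence of a row of cofactors of a matrix with closed rows vanishes. -/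
theorem sum_derivation_cofactor_eq_zero (M : Matrix n n C) (t : n)
    (hM : ∀ t' ≠ t, ∀ s s', θ s (M t' s') = θ s' (M t' s)) :
    ∑ s, θ s (M.updateRow t (Pi.single s 1)).det = 0 := by
  simp_rw [derivation_det]
  rw [Finset.sum_comm]
  refine Finset.sum_eq_zero fun t' _ => ?_
  by_cases h : t' = t
  · subst h
    refine Finset.sum_eq_zero fun s _ => Matrix.det_eq_zero_of_row_eq_zero t' fun j => ?_
    rw [Matrix.updateRow_self, Matrix.updateRow_self, Pi.single_apply]
    split_ifs <;> simp
  · have key : ∀ s, ((M.updateRow t (Pi.single s 1)).updateRow t' fun j =>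
        θ s (M.updateRow t (Pi.single s 1) t' j)).det =
        ∑ s', θ s (M t' s') * ((M.updateRow t (Pi.single s 1)).updateRow t' (Pi.single s' 1)).det := by
      intro s
      have h1 : (fun j => θ s (M.updateRow t (Pi.single s 1) t' j)) =
          ∑ s', θ s (M t' s') • (Pi.single s' (1 : C) : n → C) := by
        funext j
        simp [Matrix.updateRow_ne h, Finset.sum_apply, Pi.single_apply]
      rw [h1]
      have h2 : ∀ v : n → C, ((M.updateRow t (Pi.single s 1)).updateRow t' v).det =
        Matrix.detRowAlternating.toMultilinearMap.toLinearMap (M.updateRow t (Pi.single s 1)) t' v :=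
          fun v => rfl
      simp_rw [h2, map_sum, map_smul, smul_eq_mul]
    simp_rw [key]
    refine sum_symm_mul_alt_eq_zero _ _ (fun s s' => hM t' h s s') (fun s => ?_) fun s s' => ?_
    · refine Matrix.det_zero_of_row_eq h ?_
      rw [Matrix.updateRow_self, Matrix.updateRow_ne (Ne.symm h), Matrix.updateRow_self]
    · have : ((M.updateRow t (Pi.single s 1)).updateRow t' (Pi.single s' 1)) =
          ((M.updateRow t (Pi.single s' 1)).updateRow t' (Pi.single s 1)).submatrix (Equiv.swap t t') id := by
        ext i j
        rw [Matrix.submatrix_apply, id]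
        by_cases hi : i = t
        · subst hi
          rw [Equiv.swap_apply_left, Matrix.updateRow_ne (Ne.symm h), Matrix.updateRow_self, Matrix.updateRow_self]
        · by_cases hi' : i = t'
          · subst hi'
            rw [Equiv.swap_apply_right, Matrix.updateRow_self, Matrix.updateRow_ne (Ne.symm h), Matrix.updateRow_self]
          · rw [Equiv.swap_apply_of_ne_of_ne hi hi', Matrix.updateRow_ne hi', Matrix.updateRow_ne hi,
              Matrix.updateRow_ne hi', Matrix.updateRow_ne hi]
      rw [this, Matrix.det_permute, Equiv.Perm.sign_swap (Ne.symm h)]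
      simp

theorem det_updateRow_derivation (M : Matrix n n C) (t : n) (g : C)
    (hM : ∀ t' ≠ t, ∀ s s', θ s (M t' s') = θ s' (M t' s)) :
    (M.updateRow t fun s => θ s g).det = ∑ s, θ s (g * (M.updateRow t (Pi.single s 1)).det) := by
  simp_rw [Derivation.leibniz]
  rw [Finset.sum_add_distrib]
  simp_rw [smul_eq_mul, ← Finset.mul_sum, sum_derivation_cofactor_eq_zero θ M t hM, mul_zero, zero_add]
  have h1 : (fun s => θ s g) = ∑ s', θ s' g • (Pi.single s' (1 : C) : n → C) := by
    funext j
    simp [Finset.sum_apply, Pi.single_apply]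
  have h2 : ∀ v : n → C, (M.updateRow t v).det =
      Matrix.detRowAlternating.toMultilinearMap.toLinearMap M t v := fun v => rfl
  rw [h1]
  simp_rw [h2, map_sum, map_smul, smul_eq_mul]
  exact Finset.sum_congr rfl fun s _ => mul_comm _ _

/-- Changing closed rows by exact ones changes the determinant by a divergence. -/
theorem exists_det_eq_add_sum_derivation (hθ : ∀ s s' x, θ s (θ s' x) = θ s' (θ s x))
    (M M' : Matrix n n C) (g : n → C) (a : ℕ)
    (hM : ∀ t s s', θ s (M t s') = θ s' (M t s)) (h : ∀ t s, M' t s = M t s + a * θ s (g t)) :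
    ∃ h : n → C, M'.det = M.det + a * ∑ s, θ s (h s) := by
  have hM' : ∀ t s s', θ s (M' t s') = θ s' (M' t s) := fun t s s' => by
    simp only [h, map_add, Derivation.leibniz, hM t s s', hθ s s', Derivation.map_natCast, smul_zero]
  have key : ∀ T : Finset n, ∃ h : n → C,
      (Matrix.of fun t s => if t ∈ T then M' t s else M t s).det = M.det + a * ∑ s, θ s (h s) := by
    intro T
    induction T using Finset.induction_on with
    | empty => exact ⟨0, by simp; rfl⟩
    | insert t T ht ih =>
      obtain ⟨h1, hh1⟩ := ih
      set N : Matrix n n C := Matrix.of fun t s => if t ∈ T then M' t s else M t s with hN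
      have e1 : (Matrix.of fun t' s => if t' ∈ insert t T then M' t' s else M t' s) =
          N.updateRow t ((fun s => M t s) + (a : C) • fun s => θ s (g t)) := by
        ext i j
        by_cases hi : i = t
        · subst hi
          simp [Matrix.updateRow_self, h]
        · rw [Matrix.updateRow_ne hi]
          simp [hN, hi]
      have e2 : N.updateRow t (fun s => M t s) = N := by
        ext i j
        by_cases hi : i = t
        · subst hi
          simp [hN, ht]
        · rw [Matrix.updateRow_ne hi]
      have hNc : ∀ t s s', θ s (N t s') = θ s' (N t s) := fun t s s' => by
        simp only [hN, Matrix.of_apply]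
        split_ifs
        · exact hM' t s s'
        · exact hM t s s'
      rw [e1, Matrix.det_updateRow_add, e2, Matrix.det_updateRow_smul, hh1,
        det_updateRow_derivation θ N t (g t) fun t' _ => hNc t']
      refine ⟨fun s => h1 s + g t * (N.updateRow t (Pi.single s 1)).det, ?_⟩
      simp only [map_add, Finset.sum_add_distrib]
      ring
  obtain ⟨h1, hh1⟩ := key Finset.univ
  exact ⟨h1, by rw [← hh1]; congr 1; ext; simp⟩

end Piola

theorem exists_natCast_mul_eq_pow {C : Type} [CommRing C] {p n : ℕ} (hp : p.Prime)
    (hn : (p : C) ^ n = 0) (k : ℕ) : ∃ z : ℤ, ((k + 1 : ℕ) : C) * z = (p : C) ^ k := by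
  obtain ⟨a, u, hu, hk⟩ := Nat.exists_eq_pow_mul_and_not_dvd (Nat.succ_ne_zero k) p hp.ne_one
  have hak : a ≤ k := by
    have h1 : p ^ a ≤ k + 1 := Nat.le_of_dvd (Nat.succ_pos k) ⟨u, hk⟩
    have h2 : a < p ^ a := Nat.lt_pow_self hp.one_lt
    omega
  have hc : IsCoprime (u : ℤ) ((p ^ n : ℕ) : ℤ) :=
    Nat.isCoprime_iff_coprime.2 (Nat.Coprime.pow_right n ((Nat.Prime.coprime_iff_not_dvd hp).2 hu).symm)
  obtain ⟨x, y, hxy⟩ := hc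
  refine ⟨x * p ^ (k - a), ?_⟩
  have h3 : (x : C) * u = 1 := by
    have := congrArg (Int.cast : ℤ → C) hxy
    push_cast at this
    rwa [hn, mul_zero, add_zero] at this
  rw [← Nat.succ_eq_add_one, hk]
  push_cast
  calc (p : C) ^ a * u * (x * p ^ (k - a)) = (p ^ a * p ^ (k - a)) * (x * u) := by ring
    _ = _ := by rw [h3, mul_one, ← pow_add]; congr 1; omega

section Dlog
variable {k C : Type} [CommRing k] [CommRing C] [Algebra k C] {r : ℕ} (θ : Fin r → Derivation k C C)

/-- The determinant of the logarithmic derivatives of a family of units. -/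
noncomputable def dlogDet (F : Fin r → Cˣ) : C :=
  (Matrix.of fun t s => ((F t)⁻¹ : Cˣ) * θ s (F t)).det

theorem dlog_mul (d : Derivation k C C) (x y : Cˣ) :
    ((x * y)⁻¹ : Cˣ) * d ((x * y : Cˣ) : C) = (x⁻¹ : Cˣ) * d x + (y⁻¹ : Cˣ) * d y := by
  rw [mul_inv, Units.val_mul, Units.val_mul, Derivation.leibniz, smul_eq_mul, smul_eq_mul]
  linear_combination ((x⁻¹ : Cˣ) * d (x : C)) * (y.inv_mul) + ((y⁻¹ : Cˣ) * d (y : C)) * x.inv_mul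

theorem dlog_closed {d e : Derivation k C C} (h : ∀ x, d (e x) = e (d x)) (u : Cˣ) :
    d ((u⁻¹ : Cˣ) * e u) = e ((u⁻¹ : Cˣ) * d u) := by
  rw [Derivation.leibniz, Derivation.leibniz, d.leibniz_of_mul_eq_one u.inv_mul,
    e.leibniz_of_mul_eq_one u.inv_mul, h]
  simp only [smul_eq_mul]
  ring

theorem dlogDet_update_mul (F : Fin r → Cˣ) (i : Fin r) (x y : Cˣ) :
    dlogDet θ (Function.update F i (x * y)) =
      dlogDet θ (Function.update F i x) + dlogDet θ (Function.update F i y) := by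
  have key : ∀ z, (Matrix.of fun t s => ((Function.update F i z t)⁻¹ : Cˣ) *
      θ s (Function.update F i z t)) =
      (Matrix.of fun t s => ((F t)⁻¹ : Cˣ) * θ s (F t)).updateRow i fun s => (z⁻¹ : Cˣ) * θ s z := by
    intro z
    ext t s
    by_cases ht : t = i
    · subst ht; simp
    · simp [Matrix.updateRow_ne ht, Function.update_of_ne ht]
  unfold dlogDet
  rw [key, key, key, ← Matrix.det_updateRow_add]
  congr 2
  funext s
  exact dlog_mul (θ s) x y

theorem dlogDet_eq_zero (F : Fin r → Cˣ) {i j : Fin r} (hij : i ≠ j) (a : C)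
    (h : ∀ s, θ s (F j) = a * θ s (F i)) : dlogDet θ F = 0 := by
  unfold dlogDet
  set N : Matrix (Fin r) (Fin r) C := Matrix.of fun t s => ((F t)⁻¹ : Cˣ) * θ s (F t)
  have : N = N.updateRow j ((((F j)⁻¹ : Cˣ) * a * F i) • N i) := by
    ext t s
    by_cases ht : t = j
    · subst ht
      simp only [N, Matrix.of_apply, h, Matrix.updateRow_self, Pi.smul_apply, smul_eq_mul]
      linear_combination - (((F t)⁻¹ : Cˣ) * a * θ s (F i)) * (F i).mul_inv
    · rw [Matrix.updateRow_ne ht]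
  rw [this, Matrix.det_updateRow_smul, Matrix.det_zero_of_row_eq hij, mul_zero]
  rw [Matrix.updateRow_self, Matrix.updateRow_ne hij]

theorem exists_dlog_eq_add (k : Type) [CommRing k] [Algebra k C] {p n : ℕ} (hp : p.Prime) (hn : (p : C) ^ n = 0) {x y : Cˣ}
    {g : C} (h : (y : C) = x * (1 + p * g)) :
    ∃ l : C, ∀ d : Derivation k C C, (y⁻¹ : Cˣ) * d y = (x⁻¹ : Cˣ) * d x + p * d l := by
  choose z hz using exists_natCast_mul_eq_pow (C := C) hp hn
  refine ⟨∑ k ∈ Finset.range n, (-1) ^ k * z k * g ^ (k + 1), fun d => ?_⟩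
  have hd : d (∑ k ∈ Finset.range n, (-1) ^ k * z k * g ^ (k + 1)) =
      (∑ k ∈ Finset.range n, (-(p * g)) ^ k) * d g := by
    rw [map_sum, Finset.sum_mul]
    refine Finset.sum_congr rfl fun k _ => ?_
    have h1 : d ((-1) ^ k * (z k : C)) = 0 := by
      have : ((-1) ^ k * (z k : C)) = (((-1) ^ k * z k : ℤ) : C) := by push_cast; rfl
      rw [this, Derivation.map_intCast]
    rw [Derivation.leibniz, h1, smul_zero, add_zero, Derivation.leibniz_pow, Nat.add_sub_cancel]
    simp only [smul_eq_mul, nsmul_eq_mul]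
    rw [neg_pow ((p : C) * g), mul_pow (p : C), ← hz k]
    ring
  have h2 : (1 + p * g) * ∑ k ∈ Finset.range n, (-(p * g)) ^ k = 1 := by
    have := mul_neg_geom_sum (-(p * g)) n
    rwa [sub_neg_eq_add, neg_pow, mul_pow, hn, zero_mul, mul_zero, sub_zero] at this
  have h3 : d (y : C) = x * (p * d g) + (1 + p * g) * d x := by
    rw [h, Derivation.leibniz, map_add, Derivation.map_one_eq_zero, Derivation.leibniz,
      Derivation.map_natCast]
    simp
  rw [hd, h3]
  have h4 := y.inv_mul
  have h5 := x.inv_mul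
  rw [h] at h4
  set S := ∑ k ∈ Finset.range n, (-(p * g)) ^ k
  have h6 : ((y⁻¹ : Cˣ) : C) = (x⁻¹ : Cˣ) * S := by
    calc ((y⁻¹ : Cˣ) : C) = (y⁻¹ : Cˣ) * ((x⁻¹ : Cˣ) * x) * ((1 + p * g) * S) := by rw [h5, h2]; ring
      _ = ((y⁻¹ : Cˣ) * (x * (1 + p * g))) * ((x⁻¹ : Cˣ) * S) := by ring
      _ = _ := by rw [h4, one_mul]
  rw [h6]
  linear_combination (S * p * d g) * h5 + ((x⁻¹ : Cˣ) * d x) * h2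

/-- A quotient map with nilpotent kernel generated by `p`, and a functional which kills
divergences up to `p`-torsion. -/
structure IsResidueData (p n : ℕ) {D A : Type} [CommRing D] [AddCommGroup A] (red : C →+* D)
    (θ : Fin r → Derivation k C C) (c : C →+ A) : Prop where
  prime : p.Prime
  surjective : Function.Surjective red
  ker : ∀ x, red x = 0 → ∃ y, x = p * y
  nilpotent : (p : C) ^ n = 0
  comm : ∀ s s' x, θ s (θ s' x) = θ s' (θ s x)
  divergence : ∀ s x, c (p * θ s x) = 0

namespace IsResidueData
variable {θ} {p n : ℕ} {D A : Type} [CommRing D] [AddCommGroup A] {red : C →+* D} {c : C →+ A}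
  (h : IsResidueData p n red θ c)
include h

theorem exists_unit (f : Dˣ) : ∃ F : Cˣ, Units.map (red : C →* D) F = f := by
  obtain ⟨x, hx⟩ := h.surjective f
  obtain ⟨y, hy⟩ := h.surjective (f⁻¹ : Dˣ)
  obtain ⟨z, hz⟩ := h.ker (x * y - 1) (by rw [map_sub, map_mul, hx, hy]; simp)
  have hu : IsUnit (x * y) := by
    rw [show x * y = p * z + 1 by rw [← hz]; ring]
    refine IsNilpotent.isUnit_add_one ⟨n, ?_⟩
    rw [mul_pow, h.nilpotent, zero_mul]
  have hx' : IsUnit x := isUnit_of_mul_isUnit_left hu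
  exact ⟨hx'.unit, Units.ext hx⟩

theorem eq_of_map_eq (F F' : Fin r → Cˣ) (hF : ∀ t, red (F t) = red (F' t)) :
    c (dlogDet θ F) = c (dlogDet θ F') := by
  have h1 : ∀ t, ∃ g : C, ∀ s, ((F' t)⁻¹ : Cˣ) * θ s (F' t) = ((F t)⁻¹ : Cˣ) * θ s (F t) + p * θ s g := by
    intro t
    obtain ⟨y, hy⟩ := h.ker (F' t - F t) (by rw [map_sub, hF, sub_self])
    obtain ⟨l, hl⟩ := exists_dlog_eq_add k h.prime h.nilpotent (x := F t) (y := F' t)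
      (g := ((F t)⁻¹ : Cˣ) * y) (by
        linear_combination hy - (p * y) * (F t).mul_inv)
    exact ⟨l, fun s => hl (θ s)⟩
  choose g hg using h1
  obtain ⟨e, he⟩ := exists_det_eq_add_sum_derivation θ h.comm
    (Matrix.of fun t s => ((F t)⁻¹ : Cˣ) * θ s (F t))
    (Matrix.of fun t s => ((F' t)⁻¹ : Cˣ) * θ s (F' t)) g p
    (fun t s s' => dlog_closed (h.comm s s') (F t)) hg
  change dlogDet θ F' = dlogDet θ F + _ at he
  rw [he, map_add, Finset.mul_sum, map_sum, Finset.sum_eq_zero fun s _ => h.divergence s _, add_zero]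

/-- The residue of the determinant of the logarithmic derivatives of lifts. -/
noncomputable def res (f : Fin r → Dˣ) : A :=
  c (dlogDet θ fun t => (h.exists_unit (f t)).choose)

theorem res_eq (f : Fin r → Dˣ) (F : Fin r → Cˣ) (hF : ∀ t, red (F t) = f t) :
    h.res f = c (dlogDet θ F) :=
  h.eq_of_map_eq _ _ fun t => by
    rw [hF]
    exact congrArg Units.val (h.exists_unit (f t)).choose_spec

theorem res_update_mul (f : Fin r → Dˣ) (i : Fin r) (x y : Dˣ) :
    h.res (Function.update f i (x * y)) =
      h.res (Function.update f i x) + h.res (Function.update f i y) := by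
  choose F hF using fun t => h.exists_unit (f t)
  obtain ⟨X, hX⟩ := h.exists_unit x
  obtain ⟨Y, hY⟩ := h.exists_unit y
  have key : ∀ z Z, Units.map (red : C →* D) Z = z →
      h.res (Function.update f i z) = c (dlogDet θ (Function.update F i Z)) := by
    intro z Z hz
    refine h.res_eq _ _ fun t => ?_
    by_cases ht : t = i
    · subst ht
      simp [← hz]
    · simp [Function.update_of_ne ht, ← hF]
  rw [key _ (X * Y) (by rw [map_mul, hX, hY]), key x X hX, key y Y hY, dlogDet_update_mul, map_add]

theorem res_eq_zero (f : Fin r → Dˣ) {i j : Fin r} (hij : i ≠ j) (a b : C)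
    (ha : ∀ s, θ s a = 0) (hb : ∀ s, θ s b = 0) (hab : (f j : D) = red b - red a * f i) :
    h.res f = 0 := by
  choose F hF using fun t => h.exists_unit (f t)
  have hF' : ∀ t, red (F t) = f t := fun t => congrArg Units.val (hF t)
  have hu : IsUnit (b - a * F i) := by
    obtain ⟨z, hz⟩ := h.ker (b - a * F i - F j) (by
      rw [map_sub, map_sub, map_mul, hF', hF', hab, sub_self])
    rw [show b - a * F i = F j + p * z by rw [← hz]; ring]
    refine IsNilpotent.isUnit_add_left_of_commute ⟨n, ?_⟩ (F j).isUnit (Commute.all _ _)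
    rw [mul_pow, h.nilpotent, zero_mul]
  rw [h.res_eq f (Function.update F j hu.unit) fun t => ?_,
    dlogDet_eq_zero θ _ hij (-a) fun s => ?_, map_zero]
  · rw [Function.update_self, Function.update_of_ne hij, IsUnit.unit_spec, map_sub, hb,
      Derivation.leibniz, ha]
    simp
  · by_cases ht : t = j
    · subst ht
      rw [Function.update_self, IsUnit.unit_spec, map_sub, map_mul, hF', hab]
    · rw [Function.update_of_ne ht, hF']

end IsResidueData
end Dlog

section

open PowerSeries

/-- The homomorphism on Milnor K-theory induced by a symbol map. -/
noncomputable def IsSymbolMap.lift {F G : Type} [CommRing F] [AddCommGroup G] {k : ℕ}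
    {S : (Fin k → Fˣ) → G} (h : IsSymbolMap S) : MilnorK k F →+ G :=
  QuotientAddGroup.lift (milnorRel F k) (FreeAbelianGroup.lift S) (by
    rw [milnorRel, AddSubgroup.closure_le]
    rintro _ (⟨a, b, i, hab, rfl⟩ | ⟨a, i, j, hij, hs, rfl⟩)
    · have hb : Function.update a i (b i) = b := by
        funext t
        by_cases ht : t = i
        · subst ht; simp
        · rw [Function.update_of_ne ht, hab t ht]
      have h1 := h.mul a i (a i) (b i)
      rw [Function.update_eq_self, hb] at h1
      simp [AddMonoidHom.mem_ker, h1]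
    · simp [AddMonoidHom.mem_ker, h.steinberg a i j (by rintro rfl; omega) hs])

theorem IsSymbolMap.lift_symbol {F G : Type} [CommRing F] [AddCommGroup G] {k : ℕ}
    {S : (Fin k → Fˣ) → G} (h : IsSymbolMap S) (a : Fin k → Fˣ) :
    h.lift (MilnorK.symbol a) = S a := by
  change FreeAbelianGroup.lift S (FreeAbelianGroup.of a) = S a
  simp

section Lead
variable {Q : Type} [CommRing Q] [IsDomain Q]

theorem tau_zpow_mul_serUnit_eq_one {n : ℤ} {u : Q⟦X⟧ˣ} (h : tau Q ^ n * serUnit u = 1) : u = 1 := by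
  have key : ∀ (k : ℕ) (w : Q⟦X⟧ˣ), tau Q ^ k = serUnit w → w = 1 := by
    intro k w hk
    have h1 := congrArg Units.val hk
    rw [tau_pow_val, serUnit_val] at h1
    have h2 := HahnSeries.ofPowerSeries_injective h1
    have h3 := PowerSeries.isUnit_iff_constantCoeff.1 w.isUnit
    rw [← h2] at h3
    rcases Nat.eq_zero_or_pos k with rfl | hk0
    · exact Units.ext (by rw [← h2, pow_zero, Units.val_one])
    · rw [map_pow, PowerSeries.constantCoeff_X, zero_pow hk0.ne'] at h3
      exact absurd h3 not_isUnit_zero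
  rcases le_total 0 n with hn | hn
  · obtain ⟨k, rfl⟩ := Int.eq_ofNat_of_zero_le hn
    rw [zpow_natCast] at h
    have := key k u⁻¹ (by rw [map_inv]; exact eq_inv_of_mul_eq_one_left h)
    rwa [inv_eq_one] at this
  · obtain ⟨k, hk⟩ := Int.eq_ofNat_of_zero_le (neg_nonneg.2 hn)
    obtain rfl : n = -(k : ℤ) := by rw [← neg_neg n, hk]
    rw [zpow_neg, zpow_natCast] at h
    exact key k u ((inv_mul_eq_one).1 h)

/-- The leading unit of an invertible Laurent series. -/
noncomputable def lead : (LaurentSeries Q)ˣ →* Q⟦X⟧ˣ where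
  toFun x := (exists_tau_zpow_mul_serUnit x).choose_spec.choose
  map_one' :=
    tau_zpow_mul_serUnit_eq_one (exists_tau_zpow_mul_serUnit (1 : (LaurentSeries Q)ˣ)).choose_spec.choose_spec.symm
  map_mul' x y := by
    have h1 := (exists_tau_zpow_mul_serUnit (x * y)).choose_spec.choose_spec
    have h2 := (exists_tau_zpow_mul_serUnit x).choose_spec.choose_spec
    have h3 := (exists_tau_zpow_mul_serUnit y).choose_spec.choose_spec
    set i := (exists_tau_zpow_mul_serUnit (x * y)).choose
    set j := (exists_tau_zpow_mul_serUnit x).choose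
    set k := (exists_tau_zpow_mul_serUnit y).choose
    set u := (exists_tau_zpow_mul_serUnit (x * y)).choose_spec.choose
    set v := (exists_tau_zpow_mul_serUnit x).choose_spec.choose
    set w := (exists_tau_zpow_mul_serUnit y).choose_spec.choose
    have h4 : tau Q ^ (i - j - k) * serUnit (u * (v * w)⁻¹) = 1 := by
      have : tau Q ^ (i - j - k) * serUnit (u * (v * w)⁻¹) =
          (tau Q ^ i * serUnit u) * ((tau Q ^ j * serUnit v) * (tau Q ^ k * serUnit w))⁻¹ := by
        simp only [map_mul, map_inv, zpow_sub, mul_inv]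
        ac_rfl
      rw [this, ← h1, ← h2, ← h3, mul_inv_cancel]
    exact mul_inv_eq_one.1 (tau_zpow_mul_serUnit_eq_one h4)

theorem exists_eq_tau_zpow_mul_lead (x : (LaurentSeries Q)ˣ) : ∃ n : ℤ, x = tau Q ^ n * serUnit (lead x) :=
  ⟨_, (exists_tau_zpow_mul_serUnit x).choose_spec.choose_spec⟩

theorem lead_serUnit (u : Q⟦X⟧ˣ) : lead (serUnit u) = u := by
  obtain ⟨n, hn⟩ := exists_eq_tau_zpow_mul_lead (serUnit u)
  have : tau Q ^ n * serUnit (lead (serUnit u) * u⁻¹) = 1 := by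
    rw [map_mul, ← mul_assoc, ← hn, map_inv, mul_inv_cancel]
  exact mul_inv_eq_one.1 (tau_zpow_mul_serUnit_eq_one this)

theorem lead_tau : lead (tau Q) = 1 := by
  obtain ⟨n, hn⟩ := exists_eq_tau_zpow_mul_lead (tau Q)
  have : tau Q ^ (n - 1) * serUnit (lead (tau Q)) = 1 := by
    rw [zpow_sub_one, mul_assoc, mul_comm _ (serUnit _), ← mul_assoc, ← hn, mul_inv_cancel]
  exact tau_zpow_mul_serUnit_eq_one this

theorem lead_of_add_eq_one {a b : (LaurentSeries Q)ˣ} (h : (a : LaurentSeries Q) + b = 1) :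
    (∃ i j : ℕ, (lead b : Q⟦X⟧) = (X : Q⟦X⟧) ^ i - X ^ j * (lead a : Q⟦X⟧)) ∨
      ∃ i j : ℕ, (lead a : Q⟦X⟧) = (X : Q⟦X⟧) ^ i - X ^ j * (lead b : Q⟦X⟧) := by
  obtain ⟨n, hn⟩ := exists_eq_tau_zpow_mul_lead a
  obtain ⟨k, hk⟩ := exists_eq_tau_zpow_mul_lead b
  have key : ∀ (a b : (LaurentSeries Q)ˣ) (n k : ℤ), (a : LaurentSeries Q) + b = 1 →
      a = tau Q ^ n * serUnit (lead a) → b = tau Q ^ k * serUnit (lead b) → n ≤ k → n ≤ 0 →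
      ∃ i j : ℕ, (lead a : Q⟦X⟧) = (X : Q⟦X⟧) ^ i - X ^ j * (lead b : Q⟦X⟧) := by
    intro a b n k h hn hk hnk hn0
    obtain ⟨i, hi⟩ := Int.eq_ofNat_of_zero_le (neg_nonneg.2 hn0)
    obtain ⟨j, hj⟩ := Int.eq_ofNat_of_zero_le (sub_nonneg.2 hnk)
    refine ⟨i, j, eq_sub_of_add_eq (HahnSeries.ofPowerSeries_injective (Γ := ℤ) (R := Q) ?_)⟩
    have h2 := congrArg (fun z => ((tau Q ^ (-n) : (LaurentSeries Q)ˣ) : LaurentSeries Q) * z) h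
    simp only [mul_add, mul_one] at h2
    rw [← Units.val_mul, ← Units.val_mul] at h2
    nth_rw 1 [hn] at h2
    nth_rw 1 [hk] at h2
    rw [← mul_assoc, ← mul_assoc, ← zpow_add, ← zpow_add, neg_add_cancel, zpow_zero, one_mul,
      neg_add_eq_sub, hj, hi] at h2
    simp only [zpow_natCast, Units.val_mul, tau_pow_val, serUnit_val] at h2
    rw [map_add, map_mul, h2]
  rcases le_or_gt n 0 with h1 | h1
  · rcases le_total n k with h2 | h2
    · exact Or.inr (key a b n k h hn hk h2 h1)
    · exact Or.inl (key b a k n (by rw [add_comm, h]) hk hn h2 (h2.trans h1))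
  · rcases le_or_gt k 0 with h2 | h2
    · exact Or.inl (key b a k n (by rw [add_comm, h]) hk hn (h2.trans h1.le) h2)
    · exfalso
      obtain ⟨i, rfl⟩ := Int.eq_ofNat_of_zero_le h1.le
      obtain ⟨j, rfl⟩ := Int.eq_ofNat_of_zero_le h2.le
      simp only [zpow_natCast] at *
      rw [hn, hk, Units.val_mul, Units.val_mul, tau_pow_val, tau_pow_val, serUnit_val, serUnit_val,
        ← map_mul, ← map_mul, ← map_add, ← map_one (HahnSeries.ofPowerSeries ℤ Q)] at h
      have h3 := congrArg (PowerSeries.constantCoeff (R := Q)) (HahnSeries.ofPowerSeries_injective h)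
      have hi : i ≠ 0 := by omega
      have hj : j ≠ 0 := by omega
      simp [zero_pow hi, zero_pow hj] at h3

end Lead

section Target
variable {R Q : Type} [CommRing R] [CommRing Q] (H : R →+* Q) (v : Qˣ)

/-- The homomorphism of power series rings induced by `H`, with `X` going to `v X`. -/
noncomputable def serHom : R⟦X⟧ →+* Q⟦X⟧ := (PowerSeries.rescale (v : Q)).comp (PowerSeries.map H)

theorem serHom_X : serHom H v X = PowerSeries.C (v : Q) * X := by
  simp [serHom, PowerSeries.rescale_X]

theorem serHom_C (a : R) : serHom H v (PowerSeries.C a) = PowerSeries.C (H a) := by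
  ext n
  simp only [serHom, RingHom.comp_apply, PowerSeries.map_C, PowerSeries.coeff_rescale, PowerSeries.coeff_C]
  split_ifs with h <;> simp [h]

theorem isUnit_ofPowerSeries_serHom (y : Submonoid.powers (X : R⟦X⟧)) :
    IsUnit ((HahnSeries.ofPowerSeries ℤ Q).comp (serHom H v) y) := by
  obtain ⟨_, n, rfl⟩ := y
  have : (HahnSeries.ofPowerSeries ℤ Q).comp (serHom H v) (X ^ n) =
      ((serUnit (cstUnit v) * tau Q) ^ n : (LaurentSeries Q)ˣ) := by
    rw [map_pow, Units.val_pow_eq_pow_val, Units.val_mul, serUnit_val, cstUnit_val, RingHom.comp_apply,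
      serHom_X, map_mul, ← pow_one (tau Q), tau_pow_val, pow_one]
  simp only [this]
  exact Units.isUnit _

/-- The homomorphism of Laurent series rings induced by `H`, with `X` going to `v X`. -/
noncomputable def laurentHom : LaurentSeries R →+* LaurentSeries Q :=
  IsLocalization.lift (M := Submonoid.powers (X : R⟦X⟧)) (isUnit_ofPowerSeries_serHom H v)

theorem laurentHom_ofPowerSeries (f : R⟦X⟧) :
    laurentHom H v (HahnSeries.ofPowerSeries ℤ R f) = HahnSeries.ofPowerSeries ℤ Q (serHom H v f) :=
  IsLocalization.lift_eq (isUnit_ofPowerSeries_serHom H v) f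

theorem laurentHom_serUnit (u : R⟦X⟧ˣ) :
    Units.map (laurentHom H v : LaurentSeries R →* LaurentSeries Q) (serUnit u) =
      serUnit (Units.map (serHom H v : R⟦X⟧ →* Q⟦X⟧) u) :=
  Units.ext (laurentHom_ofPowerSeries H v u)

theorem laurentHom_tau :
    Units.map (laurentHom H v : LaurentSeries R →* LaurentSeries Q) (tau R) =
      serUnit (cstUnit v) * tau Q := by
  refine Units.ext ?_
  rw [Units.coe_map, ← pow_one (tau R), tau_pow_val, pow_one]
  change laurentHom H v _ = _
  rw [laurentHom_ofPowerSeries, serHom_X, map_mul, Units.val_mul, ← pow_one (tau Q), tau_pow_val, pow_one]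
  rfl

theorem serHom_dvd {m : ℕ} {f : R⟦X⟧} (h : X ^ m ∣ f) : X ^ m ∣ serHom H v f := by
  obtain ⟨g, rfl⟩ := h
  rw [map_mul, map_pow, serHom_X, mul_pow, mul_comm (_ ^ m), mul_assoc]
  exact Dvd.intro _ rfl

end Target

end

section Theta
variable {A : Type} [CommRing A] {r : ℕ}

variable (A) in
/-- The logarithmic partial derivatives of power series. -/
noncomputable def theta (s : Fin r) : Derivation A (MvPowerSeries (Fin r) A) (MvPowerSeries (Fin r) A) :=
  (MvPowerSeries.X s : MvPowerSeries (Fin r) A) • MvPowerSeries.pderiv A s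

theorem theta_apply (s : Fin r) (f : MvPowerSeries (Fin r) A) :
    theta A s f = MvPowerSeries.X s * MvPowerSeries.pderiv A s f := rfl

theorem coeff_theta (s : Fin r) (f : MvPowerSeries (Fin r) A) (d : Fin r →₀ ℕ) :
    MvPowerSeries.coeff d (theta A s f) = d s * MvPowerSeries.coeff d f := by
  rw [theta_apply]
  by_cases h : d s = 0
  · rw [MvPowerSeries.X_dvd_iff.1 (Dvd.intro _ rfl) d h, h, Nat.cast_zero, zero_mul]
  · obtain ⟨e, rfl⟩ : ∃ e, d = Finsupp.single s 1 + e :=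
      ⟨d - Finsupp.single s 1, by rw [add_tsub_cancel_of_le]; simpa using Nat.one_le_iff_ne_zero.2 h⟩
    rw [MvPowerSeries.X, MvPowerSeries.coeff_add_monomial_mul, MvPowerSeries.coeff_pderiv]
    simp [add_comm, mul_comm]

theorem theta_comm (s s' : Fin r) (f : MvPowerSeries (Fin r) A) :
    theta A s (theta A s' f) = theta A s' (theta A s f) := by
  ext d
  simp only [coeff_theta]
  ring

theorem map_theta {B : Type} [CommRing B] (φ : A →+* B) (s : Fin r) (f : MvPowerSeries (Fin r) A) :
    MvPowerSeries.map φ (theta A s f) = theta B s (MvPowerSeries.map φ f) := by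
  ext d
  simp [coeff_theta]

variable {k B : Type} [CommRing k] [CommRing B] [Algebra k B] (D : Derivation k B B)

/-- The coefficientwise extension of a derivation to power series. -/
noncomputable def serDer : Derivation k (PowerSeries B) (PowerSeries B) :=
  Derivation.mk'
    { toFun := fun f => PowerSeries.mk fun n => D (PowerSeries.coeff n f)
      map_smul' := fun c f => by ext n; simp
      map_add' := fun f g => by ext n; simp }
    (fun f g => by
      ext n
      simp only [LinearMap.coe_mk, AddHom.coe_mk, PowerSeries.coeff_mk, smul_eq_mul, map_add,
        PowerSeries.coeff_mul, map_sum, Derivation.leibniz, Finset.sum_add_distrib]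
      congr 1
      rw [← Finset.Nat.sum_antidiagonal_swap]
      rfl)

theorem coeff_serDer (f : PowerSeries B) (n : ℕ) :
    PowerSeries.coeff n (serDer D f) = D (PowerSeries.coeff n f) := by
  simp [serDer]

theorem serDer_C (b : B) : serDer D (PowerSeries.C b) = PowerSeries.C (D b) := by
  ext n
  rw [coeff_serDer, PowerSeries.coeff_C, PowerSeries.coeff_C]
  split_ifs <;> simp

theorem serDer_X_pow (n : ℕ) : serDer D (PowerSeries.X ^ n) = 0 := by
  ext m
  rw [coeff_serDer, PowerSeries.coeff_X_pow]
  split_ifs <;> simp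

/-- The exponent with all entries equal to `N`. -/
noncomputable def diagExp (r N : ℕ) : Fin r →₀ ℕ := Finsupp.equivFunOnFinite.symm fun _ => N

theorem diagExp_apply (N : ℕ) (s : Fin r) : diagExp r N s = N := rfl

variable (A r) in
/-- The coefficient of `X ^ M` and of the `N`-th power of the product of all the variables. -/
noncomputable def diagCoeff (M N : ℕ) : PowerSeries (MvPowerSeries (Fin r) A) →+ A :=
  (MvPowerSeries.coeff (R := A) (diagExp r N)).toAddMonoidHom.comp
    (PowerSeries.coeff (R := MvPowerSeries (Fin r) A) M).toAddMonoidHom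

theorem diagCoeff_apply (M N : ℕ) (f : PowerSeries (MvPowerSeries (Fin r) A)) :
    diagCoeff A r M N f = MvPowerSeries.coeff (diagExp r N) (PowerSeries.coeff M f) := rfl

theorem exists_coeff_coeff_eq (a : ℕ → (Fin r →₀ ℕ) → A) :
    ∃ f : PowerSeries (MvPowerSeries (Fin r) A),
      ∀ n d, MvPowerSeries.coeff d (PowerSeries.coeff n f) = a n d :=
  ⟨PowerSeries.mk fun n => (show MvPowerSeries (Fin r) A from a n),
    fun n d => by rw [PowerSeries.coeff_mk]; rfl⟩

theorem isResidueData_diagCoeff {P : Type} [CommRing P] {p : ℕ} (hp : p.Prime) (π : A →+* P)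
    (hs : Function.Surjective π) (hk : ∀ x, π x = 0 → ∃ y, x = p * y) (j : ℕ)
    (hn : (p : A) ^ (j + 1) = 0) (M : ℕ) :
    IsResidueData p (j + 1) (PowerSeries.map (MvPowerSeries.map (σ := Fin r) π))
      (fun s => serDer (theta A s)) (diagCoeff A r M (p ^ j)) where
  prime := hp
  surjective := by
    intro f
    choose g hg using hs
    obtain ⟨F, hF⟩ := exists_coeff_coeff_eq fun n d => g (MvPowerSeries.coeff d (PowerSeries.coeff n f))
    refine ⟨F, ?_⟩
    ext n d
    rw [PowerSeries.coeff_map, MvPowerSeries.coeff_map, hF, hg]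
  ker := by
    intro f hf
    have h1 : ∀ n d, ∃ y, MvPowerSeries.coeff d (PowerSeries.coeff n f) = p * y := fun n d => hk _ (by
      rw [← MvPowerSeries.coeff_map, ← PowerSeries.coeff_map, hf, map_zero, map_zero])
    choose y hy using h1
    obtain ⟨F, hF⟩ := exists_coeff_coeff_eq y
    refine ⟨F, ?_⟩
    ext n d
    rw [hy, ← nsmul_eq_mul, ← nsmul_eq_mul, map_nsmul, map_nsmul, hF]
  nilpotent := by
    have := congrArg (PowerSeries.C.comp (MvPowerSeries.C (σ := Fin r) (R := A))) hn
    rw [map_zero, map_pow, map_natCast] at this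
    exact this
  comm s s' f := by
    ext n : 1
    simp only [coeff_serDer]
    exact theta_comm s s' _
  divergence s f := by
    rw [← nsmul_eq_mul, map_nsmul, diagCoeff_apply, coeff_serDer, coeff_theta, diagExp_apply,
      nsmul_eq_mul, ← mul_assoc]
    push_cast
    rw [← pow_succ', hn, zero_mul]

end Theta

section Cartier
variable {P : Type} [Field P] (p : ℕ) [Fact p.Prime] [CharP P p] {r : ℕ}

theorem theta_expand_frobenius (f : MvPowerSeries (Fin r) (WittVector p P)) (s : Fin r) :
    theta _ s ((MvPowerSeries.map WittVector.frobenius f).expand p (Fact.out : p.Prime).ne_zero) =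
      p * (MvPowerSeries.map WittVector.frobenius (theta _ s f)).expand p
        (Fact.out : p.Prime).ne_zero := by
  ext d : 1
  rw [coeff_theta, ← nsmul_eq_mul p, map_nsmul]
  by_cases hd : ∀ i, p ∣ d i
  · choose e he using hd
    obtain rfl : d = p • Finsupp.equivFunOnFinite.symm e := by ext i; simp [he]
    rw [MvPowerSeries.coeff_expand_smul, MvPowerSeries.coeff_expand_smul, MvPowerSeries.coeff_map,
      MvPowerSeries.coeff_map, coeff_theta, map_mul, map_natCast]
    simp [mul_assoc]
  · push Not at hd
    obtain ⟨i, hi⟩ := hd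
    rw [MvPowerSeries.coeff_expand_of_not_dvd p _ _ hi,
      MvPowerSeries.coeff_expand_of_not_dvd p _ _ hi, mul_zero, smul_zero]

theorem map_constantCoeff_expand_frobenius (f : MvPowerSeries (Fin r) (WittVector p P)) :
    MvPowerSeries.map WittVector.constantCoeff
      ((MvPowerSeries.map WittVector.frobenius f).expand p (Fact.out : p.Prime).ne_zero) =
      MvPowerSeries.map WittVector.constantCoeff f ^ p := by
  rw [← MvPowerSeries.map_frobenius_expand p (Fact.out : p.Prime).ne_zero,
    ← MvPowerSeries.map_expand, ← MvPowerSeries.map_expand]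
  ext d
  simp only [MvPowerSeries.coeff_map, WittVector.constantCoeff_apply,
    WittVector.coeff_frobenius_charP, frobenius_def]

variable [PerfectRing P p]

theorem exists_theta_pow_eq (h : MvPowerSeries (Fin r) P) :
    ∃ g, ∀ s, theta P s h ^ p = h ^ (p - 1) * theta P s h + theta P s g := by
  have hsurj : Function.Surjective (MvPowerSeries.map (σ := Fin r)
      (WittVector.constantCoeff (p := p) (R := P))) := by
    intro f
    choose l hl using WittVector.constantCoeff_surjective (R := P) p
    exact ⟨fun d => l (MvPowerSeries.coeff d f), by ext d; exact hl _⟩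
  obtain ⟨h, rfl⟩ := hsurj h
  have hker : ∀ f : MvPowerSeries (Fin r) (WittVector p P),
      MvPowerSeries.map WittVector.constantCoeff f = 0 → ∃ g, f = p * g := by
    intro f hf
    have h1 : ∀ d, ∃ y, MvPowerSeries.coeff d f = p * y := fun d => by
      have : MvPowerSeries.coeff d f ∈ RingHom.ker (WittVector.constantCoeff (p := p) (R := P)) := by
        rw [RingHom.mem_ker, ← MvPowerSeries.coeff_map, hf, map_zero]
      rw [WittVector.ker_constantCoeff] at this
      exact Ideal.mem_span_singleton.1 this
    choose y hy using h1
    obtain ⟨F, hF⟩ : ∃ F : MvPowerSeries (Fin r) (WittVector p P),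
      ∀ d, MvPowerSeries.coeff d F = y d := ⟨y, fun d => rfl⟩
    refine ⟨F, ?_⟩
    ext d : 1
    rw [hy, ← nsmul_eq_mul, ← nsmul_eq_mul, map_nsmul, hF]
  obtain ⟨g, hg⟩ := hker ((MvPowerSeries.map WittVector.frobenius h).expand p
    (Fact.out : p.Prime).ne_zero - h ^ p) (by
      rw [map_sub, map_constantCoeff_expand_frobenius, map_pow, sub_self])
  refine ⟨MvPowerSeries.map WittVector.constantCoeff g, fun s => ?_⟩
  have h2 := congrArg (theta _ s) hg
  rw [map_sub, theta_expand_frobenius, Derivation.leibniz_pow, Derivation.leibniz,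
    Derivation.map_natCast, smul_zero, add_zero, nsmul_eq_mul, smul_eq_mul, smul_eq_mul,
    ← mul_sub] at h2
  have h3 : (MvPowerSeries.map WittVector.frobenius (theta _ s h)).expand p
      (Fact.out : p.Prime).ne_zero - h ^ (p - 1) * theta _ s h = theta _ s g := by
    ext d : 1
    have h4 := congrArg (MvPowerSeries.coeff d) h2
    rw [← nsmul_eq_mul, ← nsmul_eq_mul, map_nsmul, map_nsmul, ← sub_eq_zero, ← smul_sub,
      nsmul_eq_mul, mul_comm] at h4
    exact sub_eq_zero.1 (WittVector.eq_zero_of_p_mul_eq_zero _ h4)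
  have h5 := congrArg (MvPowerSeries.map WittVector.constantCoeff) h3
  rw [map_sub, map_constantCoeff_expand_frobenius, map_mul, map_pow, map_theta, map_theta] at h5
  rw [← h5]
  ring

omit [PerfectRing P p] in
theorem theta_pow_char (s : Fin r) (f : MvPowerSeries (Fin r) P) : theta P s (f ^ p) = 0 := by
  have : (p : MvPowerSeries (Fin r) P) = 0 := by
    rw [← map_natCast (MvPowerSeries.C (σ := Fin r) (R := P)), CharP.cast_eq_zero, map_zero]
  rw [Derivation.leibniz_pow, nsmul_eq_mul, this, zero_mul]

theorem exists_dlog_pow_eq (y : (MvPowerSeries (Fin r) P)ˣ) :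
    ∃ g, ∀ s, (((y⁻¹ : (MvPowerSeries (Fin r) P)ˣ) : MvPowerSeries (Fin r) P) * theta P s y) ^ p =
      ((y⁻¹ : (MvPowerSeries (Fin r) P)ˣ) : MvPowerSeries (Fin r) P) * theta P s y + theta P s g := by
  obtain ⟨g, hg⟩ := exists_theta_pow_eq p (y : MvPowerSeries (Fin r) P)
  refine ⟨((y⁻¹ : (MvPowerSeries (Fin r) P)ˣ) : MvPowerSeries (Fin r) P) ^ p * g, fun s => ?_⟩
  rw [mul_pow, hg, Derivation.leibniz, theta_pow_char, smul_zero, add_zero, mul_add, smul_eq_mul]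
  congr 1
  obtain ⟨n, hn⟩ : ∃ n, p = n + 1 := ⟨p - 1, (Nat.sub_add_cancel (Fact.out : p.Prime).one_le).symm⟩
  rw [hn, Nat.add_sub_cancel, pow_succ, mul_mul_mul_comm, mul_comm (_ ^ n) , mul_assoc, ← mul_assoc (_ ^ n) , ← mul_pow,
    y.mul_inv]
  simp

omit [PerfectRing P p] in
theorem coeff_smul_pow (f : MvPowerSeries (Fin r) P) (w : Fin r →₀ ℕ) :
    MvPowerSeries.coeff (p • w) (f ^ p) = MvPowerSeries.coeff w f ^ p := by
  rw [← MvPowerSeries.map_frobenius_expand p (Fact.out : p.Prime).ne_zero, MvPowerSeries.coeff_map,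
    MvPowerSeries.coeff_expand_smul, frobenius_def]

/-- The coefficient of the form `dh ∧ dlog y`. -/
noncomputable def mixedDet {A : Type} [CommRing A] {q : ℕ} (h : MvPowerSeries (Fin (q + 1)) A)
    (y : Fin q → (MvPowerSeries (Fin (q + 1)) A)ˣ) : MvPowerSeries (Fin (q + 1)) A :=
  (Matrix.of (Fin.cons (fun s => theta A s h) fun t s =>
    ((y t)⁻¹ : (MvPowerSeries (Fin (q + 1)) A)ˣ) * theta A s (y t)) :
      Matrix (Fin (q + 1)) (Fin (q + 1)) (MvPowerSeries (Fin (q + 1)) A)).det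

theorem det_cons_mul {S : Type} [CommRing S] {q : ℕ} (c : S) (x : Fin (q + 1) → S)
    (M : Fin q → Fin (q + 1) → S) :
    (Matrix.of (Fin.cons (fun s => c * x s) M) : Matrix (Fin (q + 1)) (Fin (q + 1)) S).det =
      c * (Matrix.of (Fin.cons x M) : Matrix (Fin (q + 1)) (Fin (q + 1)) S).det := by
  have := Matrix.det_updateRow_smul (Matrix.of (Fin.cons x M) : Matrix (Fin (q + 1)) (Fin (q + 1)) S) 0 c x
  have h1 : ∀ z, (Matrix.of (Fin.cons x M) : Matrix (Fin (q + 1)) (Fin (q + 1)) S).updateRow 0 z =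
      Matrix.of (Fin.cons z M) := by
    intro z
    ext t s
    refine Fin.cases ?_ (fun t => ?_) t
    · simp
    · rw [Matrix.updateRow_ne (Fin.succ_ne_zero t)]
      simp
  rw [h1, h1] at this
  exact this

theorem coeff_smul_mixedDet {q : ℕ} (f h : MvPowerSeries (Fin (q + 1)) P)
    (y : Fin q → (MvPowerSeries (Fin (q + 1)) P)ˣ) (w : Fin (q + 1) →₀ ℕ) :
    MvPowerSeries.coeff (p • w) (f ^ p * (h ^ (p - 1) * mixedDet h y)) =
      MvPowerSeries.coeff w (f * mixedDet h y) ^ p := by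
  have : CharP (MvPowerSeries (Fin (q + 1)) P) p :=
    charP_of_injective_ringHom (f := MvPowerSeries.C (σ := Fin (q + 1)) (R := P))
      (MvPowerSeries.C_injective) p
  have : ExpChar (MvPowerSeries (Fin (q + 1)) P) p := ExpChar.prime Fact.out
  obtain ⟨g, hg⟩ := exists_theta_pow_eq p h
  choose l hl using fun t => exists_dlog_pow_eq p (y t)
  set N : Fin (q + 1) → Fin (q + 1) → MvPowerSeries (Fin (q + 1)) P :=
    Fin.cons (fun s => theta P s h) fun t s =>
      ((y t)⁻¹ : (MvPowerSeries (Fin (q + 1)) P)ˣ) * theta P s (y t) with hN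
  obtain ⟨e, he⟩ := exists_det_eq_add_sum_derivation (theta P) (fun s s' x => theta_comm s s' x)
    (Matrix.of (Fin.cons (fun s => h ^ (p - 1) * theta P s h) fun t s =>
      ((y t)⁻¹ : (MvPowerSeries (Fin (q + 1)) P)ˣ) * theta P s (y t)))
    (Matrix.of fun t s => N t s ^ p) (Fin.cons g l) 1 (fun t s s' => by
      refine Fin.cases ?_ (fun t => ?_) t
      · simp only [Matrix.of_apply, Fin.cons_zero]
        rw [Derivation.leibniz, Derivation.leibniz, Derivation.leibniz_pow, Derivation.leibniz_pow,
          theta_comm s s']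
        simp only [smul_eq_mul, nsmul_eq_mul]
        ring
      · simp only [Matrix.of_apply, Fin.cons_succ]
        exact dlog_closed (fun x => theta_comm s s' x) (y t)) (fun t s => by
      refine Fin.cases ?_ (fun t => ?_) t
      · simp [hN, hg]
      · simp [hN, hl])
  have h1 : (Matrix.of fun t s => N t s ^ p).det = mixedDet h y ^ p := by
    have := (RingHom.map_det (frobenius (MvPowerSeries (Fin (q + 1)) P) p) (Matrix.of N)).symm
    rw [frobenius_def] at this
    rw [mixedDet, ← this]
    rfl
  rw [h1, det_cons_mul, Nat.cast_one, one_mul] at he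
  change _ = h ^ (p - 1) * mixedDet h y + _ at he
  rw [← coeff_smul_pow, mul_pow, he, mul_add, map_add, left_eq_add, Finset.mul_sum, map_sum]
  refine Finset.sum_eq_zero fun s _ => ?_
  have h2 : f ^ p * theta P s (e s) = theta P s (f ^ p * e s) := by
    rw [Derivation.leibniz, theta_pow_char, smul_zero, add_zero, smul_eq_mul]
  rw [h2, coeff_theta]
  simp

theorem coeff_diagExp_mixedDet {q : ℕ} (h : MvPowerSeries (Fin (q + 1)) P)
    (y : Fin q → (MvPowerSeries (Fin (q + 1)) P)ˣ) (j : ℕ) :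
    MvPowerSeries.coeff (diagExp (q + 1) (p ^ j)) (h ^ (p ^ j - 1) * mixedDet h y) =
      MvPowerSeries.coeff (diagExp (q + 1) 1) (mixedDet h y) ^ p ^ j := by
  induction j with
  | zero => simp
  | succ j ih =>
    rw [pow_succ (p) j, pow_mul, ← ih, ← coeff_smul_mixedDet p]
    have h1 : p ^ j * p - 1 = (p ^ j - 1) * p + (p - 1) := by
      have h2 : 0 < p ^ j := pow_pos (Fact.out : p.Prime).pos j
      have h3 : 0 < p := (Fact.out : p.Prime).pos
      obtain ⟨a, ha⟩ := Nat.exists_eq_succ_of_ne_zero h2.ne'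
      rw [ha]
      simp only [Nat.succ_eq_add_one, Nat.add_sub_cancel, add_mul]
      omega
    rw [h1, pow_add, pow_mul, mul_assoc]
    have h2 : diagExp (q + 1) (p ^ j * p) = p • diagExp (q + 1) (p ^ j) := by
      ext s
      simp [diagExp_apply, mul_comm]
    rw [h2]

end Cartier

section Linear
variable {A : Type} [CommRing A] {r : ℕ}

theorem coeff_diagExp_det_theta (u : Fin r → MvPowerSeries (Fin r) A)
    (f : Fin r → MvPowerSeries (Fin r) A) :
    MvPowerSeries.coeff (diagExp r 1) (Matrix.of fun t s => u t * theta A s (f t)).det =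
      (Matrix.of fun t s => MvPowerSeries.constantCoeff (u t) *
        MvPowerSeries.coeff (Finsupp.single s 1) (f t)).det := by
  have h1 : (Matrix.of fun t s => u t * theta A s (f t)).det =
      (∏ s, (MvPowerSeries.X s : MvPowerSeries (Fin r) A)) *
        (Matrix.of fun t s => u t * MvPowerSeries.pderiv A s (f t)).det := by
    rw [← Matrix.det_mul_row]
    congr 1
    ext1 t s
    simp only [Matrix.of_apply, theta_apply]
    ring
  have h2 : ∏ s, (MvPowerSeries.X s : MvPowerSeries (Fin r) A) =
      MvPowerSeries.monomial (diagExp r 1) 1 := by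
    have : diagExp r 1 = ∑ s, Finsupp.single s 1 := by
      ext s
      simp [diagExp_apply, Finsupp.finsetSum_apply, Finsupp.single_apply]
    rw [this]
    have := MvPowerSeries.prod_monomial (R := A) (fun s : Fin r => Finsupp.single s 1)
      (fun _ => (1 : A)) Finset.univ
    rw [Finset.prod_const_one] at this
    exact this
  have h3 := MvPowerSeries.coeff_add_monomial_mul (diagExp r 1) 0
    (Matrix.of fun t s => u t * MvPowerSeries.pderiv A s (f t)).det 1
  rw [add_zero] at h3
  rw [h1, h2, h3, one_mul, MvPowerSeries.coeff_zero_eq_constantCoeff_apply, RingHom.map_det]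
  congr 1
  ext1 t s
  rw [RingHom.mapMatrix_apply, Matrix.map_apply, Matrix.of_apply, Matrix.of_apply, map_mul,
    ← MvPowerSeries.coeff_zero_eq_constantCoeff_apply (MvPowerSeries.pderiv A s (f t)),
    MvPowerSeries.coeff_pderiv]
  simp

end Linear

section

open PowerSeries

theorem exists_wittQuotient (P : Type) [Field P] (p : ℕ) [Fact p.Prime] [CharP P p] [PerfectRing P p]
    (j : ℕ) : ∃ (A : Type) (_ : CommRing A) (π : A →+* P), Function.Surjective π ∧
      (∀ x, π x = 0 → ∃ y, x = p * y) ∧ (p : A) ^ (j + 1) = 0 ∧ ∀ x, (p : A) ^ j * x = 0 → π x = 0 := by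
  have hz : ∀ x ∈ Ideal.span {((p : WittVector p P)) ^ (j + 1)},
      WittVector.constantCoeff x = 0 := by
    intro x hx
    obtain ⟨y, rfl⟩ := Ideal.mem_span_singleton.1 hx
    rw [map_mul, map_pow, map_natCast, CharP.cast_eq_zero, zero_pow (Nat.succ_ne_zero j), zero_mul]
  have hk : ∀ x : WittVector p P, WittVector.constantCoeff x = 0 → ∃ y, x = p * y := by
    intro x hx
    have : x ∈ RingHom.ker (WittVector.constantCoeff (p := p) (R := P)) := hx
    rw [WittVector.ker_constantCoeff] at this
    exact Ideal.mem_span_singleton.1 this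
  refine ⟨WittVector p P ⧸ Ideal.span {((p : WittVector p P)) ^ (j + 1)}, inferInstance,
    Ideal.Quotient.lift _ WittVector.constantCoeff hz, ?_, ?_, ?_, ?_⟩
  · intro x
    obtain ⟨w, rfl⟩ := WittVector.constantCoeff_surjective p x
    exact ⟨Ideal.Quotient.mk _ w, Ideal.Quotient.lift_mk _ _ _⟩
  · intro x hx
    obtain ⟨w, rfl⟩ := Ideal.Quotient.mk_surjective x
    rw [Ideal.Quotient.lift_mk] at hx
    obtain ⟨y, rfl⟩ := hk w hx
    exact ⟨Ideal.Quotient.mk _ y, by rw [map_mul, map_natCast]⟩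
  · rw [← map_natCast (Ideal.Quotient.mk _), ← map_pow, Ideal.Quotient.eq_zero_iff_mem]
    exact Ideal.mem_span_singleton_self _
  · intro x hx
    obtain ⟨w, rfl⟩ := Ideal.Quotient.mk_surjective x
    rw [← map_natCast (Ideal.Quotient.mk _), ← map_pow, ← map_mul, Ideal.Quotient.eq_zero_iff_mem,
      Ideal.mem_span_singleton] at hx
    obtain ⟨y, hy⟩ := hx
    have hp0 : (p : WittVector p P) ^ j ≠ 0 := pow_ne_zero _ fun h => by
      have := WittVector.eq_zero_of_p_mul_eq_zero (1 : WittVector p P) (by rw [one_mul, h])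
      exact one_ne_zero this
    rw [pow_succ, mul_assoc] at hy
    rw [Ideal.Quotient.lift_mk, mul_left_cancel₀ hp0 hy, map_mul, map_natCast, CharP.cast_eq_zero,
      zero_mul]

theorem coeff_of_one_add_mul_eq_one {B : Type} [CommRing B] {m : ℕ} (hm : 1 ≤ m) {h : B} {W : B⟦X⟧}
    (hW : W * (1 + X ^ m * PowerSeries.C h) = 1) (k : ℕ) : PowerSeries.coeff (m * k) W = (-h) ^ k := by
  have h1 : W + X ^ m * (PowerSeries.C h * W) = 1 := by rw [← hW]; ring
  induction k with
  | zero =>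
    have := congrArg (PowerSeries.coeff 0) h1
    rw [map_add, PowerSeries.coeff_X_pow_mul', if_neg (by omega), add_zero] at this
    rw [mul_zero, this, pow_zero]
    simp
  | succ k ih =>
    have := congrArg (PowerSeries.coeff (m * k + m)) h1
    rw [map_add, PowerSeries.coeff_X_pow_mul, PowerSeries.coeff_C_mul, ih, PowerSeries.coeff_one,
      if_neg (by omega)] at this
    rw [Nat.mul_succ, eq_neg_of_add_eq_zero_left this]
    ring

instance isDomain_mvPowerSeries (σ P : Type) [CommRing P] [IsDomain P] : IsDomain (MvPowerSeries σ P) :=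
  NoZeroDivisors.to_isDomain _

section Res
variable {A P : Type} [CommRing A] [Field P] {p j M q : ℕ} {π : A →+* P}
  (h : IsResidueData p (j + 1) (PowerSeries.map (MvPowerSeries.map (σ := Fin (q + 1)) π))
      (fun s => serDer (theta A s)) (diagCoeff A (q + 1) M (p ^ j)))
include h

theorem isSymbolMap_res : IsSymbolMap fun a : Fin (q + 1) → (LaurentSeries (MvPowerSeries (Fin (q + 1)) P))ˣ =>
    h.res fun t => lead (a t) where
  mul a i x y := by
    have key : ∀ z, (fun t => lead (Function.update a i z t)) =
        Function.update (fun t => lead (a t)) i (lead z) := by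
      intro z
      funext t
      by_cases ht : t = i
      · subst ht; simp
      · simp [Function.update_of_ne ht]
    rw [key, key, key, map_mul, h.res_update_mul]
  steinberg a i j hij hab := by
    rcases lead_of_add_eq_one hab with ⟨k, l, hl⟩ | ⟨k, l, hl⟩
    · exact h.res_eq_zero _ hij (X ^ l) (X ^ k) (fun s => serDer_X_pow _ _) (fun s => serDer_X_pow _ _)
        (by rw [map_pow, map_pow, PowerSeries.map_X, hl])
    · exact h.res_eq_zero _ hij.symm (X ^ l) (X ^ k) (fun s => serDer_X_pow _ _)
        (fun s => serDer_X_pow _ _) (by rw [map_pow, map_pow, PowerSeries.map_X, hl])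

theorem res_eq_zero_of_mem {M' : ℕ} (hM : M < M') (f : Fin (q + 1) → (MvPowerSeries (Fin (q + 1)) P)⟦X⟧ˣ)
    (hf : f 0 ∈ oneUnits _ M') : h.res f = 0 := by
  obtain ⟨g, hg⟩ := exists_eq_oneAdd (by omega) hf
  obtain ⟨g, rfl⟩ := h.surjective g
  choose F hF using fun t => h.exists_unit (f t)
  rw [h.res_eq f (Fin.cons (oneAdd M' g) fun t => F t.succ) fun t => ?_]
  · have h1 : dlogDet (fun s : Fin (q + 1) => serDer (theta A s))
        (Fin.cons (oneAdd M' g) fun t => F t.succ) = X ^ M' * (Matrix.of (Fin.cons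
          (fun s => ((oneAdd M' g)⁻¹ : (MvPowerSeries (Fin (q + 1)) A)⟦X⟧ˣ) * serDer (theta A s) g)
          fun t s => ((F t.succ)⁻¹ : (MvPowerSeries (Fin (q + 1)) A)⟦X⟧ˣ) *
            serDer (theta A s) (F t.succ)) : Matrix (Fin (q + 1)) (Fin (q + 1)) _).det := by
      rw [← det_cons_mul, dlogDet]
      congr 1
      ext1 t s
      refine Fin.cases ?_ (fun t => ?_) t
      · simp only [Matrix.of_apply, Fin.cons_zero]
        rw [oneAdd_val (by omega), map_add, Derivation.map_one_eq_zero, zero_add, Derivation.leibniz,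
          serDer_X_pow, smul_zero, add_zero, smul_eq_mul]
        ring
      · simp only [Matrix.of_apply, Fin.cons_succ]
    rw [h1, diagCoeff_apply, PowerSeries.coeff_X_pow_mul', if_neg (by omega), map_zero]
  · refine Fin.cases ?_ (fun t => ?_) t
    · rw [Fin.cons_zero, hg, oneAdd_val (by omega), oneAdd_val (by omega), map_add, map_mul, map_pow,
        PowerSeries.map_X, map_one]
    · rw [Fin.cons_succ, ← hF t.succ]
      rfl

theorem map_res_cons [Fact p.Prime] [CharP P p] [PerfectRing P p] {m : ℕ} (hm : 1 ≤ m)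
    (hM : M = m * p ^ j) (hn : (p : A) ^ (j + 1) = 0)
    (f : Fin (q + 1) → (MvPowerSeries (Fin (q + 1)) P)⟦X⟧ˣ) (x : MvPowerSeries (Fin (q + 1)) P)
    (y : Fin q → (MvPowerSeries (Fin (q + 1)) P)ˣ) (hf0 : f 0 = oneAdd m (PowerSeries.C x))
    (hf : ∀ t, f (Fin.succ t) = cstUnit (y t)) :
    π (h.res f) = (-1) ^ (p ^ j - 1) *
      MvPowerSeries.coeff (diagExp (q + 1) 1) (mixedDet x y) ^ p ^ j := by
  have hlift : ∀ z : MvPowerSeries (Fin (q + 1)) P, ∃ Z, MvPowerSeries.map π Z = z := by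
    intro z
    obtain ⟨Z, hZ⟩ := h.surjective (PowerSeries.C z)
    refine ⟨PowerSeries.coeff 0 Z, ?_⟩
    rw [← PowerSeries.coeff_map, hZ, PowerSeries.coeff_zero_C]
  obtain ⟨x, rfl⟩ := hlift x
  have hY : ∀ t, ∃ Y : (MvPowerSeries (Fin (q + 1)) A)ˣ,
      Units.map (MvPowerSeries.map (σ := Fin (q + 1)) π).toMonoidHom Y = y t := by
    intro t
    obtain ⟨F, hF⟩ := h.exists_unit (cstUnit (y t))
    refine ⟨Units.map (PowerSeries.constantCoeff (R := MvPowerSeries (Fin (q + 1)) A)).toMonoidHom F,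
      Units.ext ?_⟩
    have h1 := congrArg (fun u => PowerSeries.constantCoeff (Units.val u)) hF
    simp only [Units.coe_map, MonoidHom.coe_coe, cstUnit_val, PowerSeries.constantCoeff_C] at h1
    rw [← h1, ← PowerSeries.coeff_zero_eq_constantCoeff_apply, PowerSeries.coeff_map]
    simp
  choose Y hY using hY
  have hY' : ∀ t, MvPowerSeries.map π (Y t : MvPowerSeries (Fin (q + 1)) A) = y t := fun t => congrArg Units.val (hY t)
  rw [h.res_eq f (Fin.cons (oneAdd m (PowerSeries.C x)) fun t => cstUnit (Y t)) fun t => ?_]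
  · have h1 : dlogDet (fun s : Fin (q + 1) => serDer (theta A s))
        (Fin.cons (oneAdd m (PowerSeries.C x)) fun t => cstUnit (Y t)) =
          (((oneAdd m (PowerSeries.C x))⁻¹ : (MvPowerSeries (Fin (q + 1)) A)⟦X⟧ˣ) :
            (MvPowerSeries (Fin (q + 1)) A)⟦X⟧) * X ^ m *
            PowerSeries.C (mixedDet x Y) := by
      rw [mixedDet, RingHom.map_det, dlogDet]
      have h2 : (PowerSeries.C (R := MvPowerSeries (Fin (q + 1)) A)).mapMatrix (Matrix.of (Fin.cons
          (fun s => theta A s x) fun t s =>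
          ((Y t)⁻¹ : (MvPowerSeries (Fin (q + 1)) A)ˣ) * theta A s (Y t)) :
            Matrix (Fin (q + 1)) (Fin (q + 1)) (MvPowerSeries (Fin (q + 1)) A)) =
          Matrix.of (Fin.cons (fun s => PowerSeries.C (theta A s x)) fun t s =>
          PowerSeries.C (((Y t)⁻¹ : (MvPowerSeries (Fin (q + 1)) A)ˣ) * theta A s (Y t))) := by
        ext1 t s
        refine Fin.cases ?_ (fun t => ?_) t
        · simp
        · simp
      rw [h2, ← det_cons_mul]
      congr 1
      ext1 t s
      refine Fin.cases ?_ (fun t => ?_) t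
      · simp only [Matrix.of_apply, Fin.cons_zero]
        rw [oneAdd_val hm, map_add, Derivation.map_one_eq_zero, zero_add, Derivation.leibniz,
          serDer_X_pow, smul_zero, add_zero, smul_eq_mul, serDer_C, mul_assoc]
      · simp only [Matrix.of_apply, Fin.cons_succ]
        rw [← map_inv, cstUnit_val, cstUnit_val, serDer_C, ← map_mul]
    have hpj : 0 < p ^ j := pow_pos (Fact.out : p.Prime).pos j
    have h3 : PowerSeries.coeff M (dlogDet (fun s : Fin (q + 1) => serDer (theta A s))
        (Fin.cons (oneAdd m (PowerSeries.C x)) fun t => cstUnit (Y t))) =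
          (-x) ^ (p ^ j - 1) * mixedDet x Y := by
      have h4 : M = m * (p ^ j - 1) + m := by
        rw [hM, ← Nat.mul_succ, Nat.succ_eq_add_one, Nat.sub_add_cancel hpj]
      rw [h1, mul_comm _ (X ^ m), mul_assoc, h4, PowerSeries.coeff_X_pow_mul, PowerSeries.coeff_mul_C,
        coeff_of_one_add_mul_eq_one hm]
      rw [← oneAdd_val hm, Units.inv_mul]
    have h5 : MvPowerSeries.map π (mixedDet x Y) = mixedDet (MvPowerSeries.map π x) y := by
      rw [mixedDet, mixedDet, RingHom.map_det]
      congr 1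
      ext1 t s
      refine Fin.cases ?_ (fun t => ?_) t
      · simp [map_theta]
      · simp only [RingHom.mapMatrix_apply, Matrix.map_apply, Matrix.of_apply, Fin.cons_succ, map_mul,
          map_theta, hY']
        rw [← hY t, ← map_inv]
        rfl
    rw [diagCoeff_apply, h3, ← MvPowerSeries.coeff_map, map_mul, map_pow, map_neg, h5, neg_pow,
      mul_assoc, ← coeff_diagExp_mixedDet p]
    have h6 : ((-1 : MvPowerSeries (Fin (q + 1)) P)) ^ (p ^ j - 1) =
        MvPowerSeries.C ((-1) ^ (p ^ j - 1)) := by rw [map_pow, map_neg, map_one]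
    rw [h6, MvPowerSeries.coeff_C_mul]
  · refine Fin.cases ?_ (fun t => ?_) t
    · rw [Fin.cons_zero, hf0, oneAdd_val hm, oneAdd_val hm, map_add, map_mul, map_pow,
        PowerSeries.map_X, map_one, PowerSeries.map_C]
    · rw [Fin.cons_succ, hf, cstUnit_val, cstUnit_val, PowerSeries.map_C, hY']

end Res

end

section

open PowerSeries

theorem IsSymbolMap.comp_ringHom {F F' G : Type} [CommRing F] [CommRing F'] [AddCommGroup G] {k : ℕ}
    {S : (Fin k → F'ˣ) → G} (h : IsSymbolMap S) (L : F →+* F') :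
    IsSymbolMap fun a : Fin k → Fˣ => S fun t => Units.map (L : F →* F') (a t) where
  mul a i x y := by
    have key : ∀ z, (fun t => Units.map (L : F →* F') (Function.update a i z t)) =
        Function.update (fun t => Units.map (L : F →* F') (a t)) i (Units.map (L : F →* F') z) := by
      intro z
      funext t
      by_cases ht : t = i
      · subst ht; simp
      · simp [Function.update_of_ne ht]
    rw [key, key, key, map_mul, h.mul]
  steinberg a i j hij hab := h.steinberg _ i j hij (by
    simpa using congrArg L hab)

section Detect
variable {R : Type} [CommRing R] [IsDomain R] {q : ℕ}

theorem lead_laurentHom_oneE {Q : Type} [CommRing Q] [IsDomain Q] (H : R →+* Q) (v : Qˣ) {m : ℕ} (hm : 1 ≤ m) (a : R) :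
    lead (Units.map (laurentHom H v : LaurentSeries R →* LaurentSeries Q) (oneE m a)) =
      oneAdd m (PowerSeries.C (H a * v ^ m)) := by
  rw [oneE, laurentHom_serUnit, lead_serUnit]
  refine Units.ext ?_
  rw [oneAdd_val hm, Units.coe_map, MonoidHom.coe_coe, oneAdd_val hm, map_add, map_one, map_mul, map_pow,
    serHom_X, serHom_C, mul_pow, map_mul, map_pow]
  ring

theorem lead_laurentHom_tau_zpow_mul_cst {Q : Type} [CommRing Q] [IsDomain Q] (H : R →+* Q) (v : Qˣ) (n : ℤ) (b : Rˣ) :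
    lead (Units.map (laurentHom H v : LaurentSeries R →* LaurentSeries Q) (tau R ^ n * cst b)) =
      cstUnit (v ^ n * Units.map (H : R →* Q) b) := by
  rw [map_mul, map_mul, map_zpow, laurentHom_tau, map_zpow, map_mul, lead_serUnit, lead_tau, mul_one,
    cst, MonoidHom.comp_apply, laurentHom_serUnit, lead_serUnit, map_mul, map_zpow]
  congr 1
  exact Units.ext (serHom_C H v b)

variable {p : ℕ} [Fact p.Prime]

theorem sum_coeff_mixedDet_eq_zero {P : Type} [Field P] [CharP P p] [PerfectRing P p]
    (H : R →+* MvPowerSeries (Fin (q + 1)) P) (v : (MvPowerSeries (Fin (q + 1)) P)ˣ) {m : ℕ} (hm : 1 ≤ m)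
    (j : ℕ) {Λ : Type} [Fintype Λ] (a : Λ → R) (n : Λ → Fin q → ℤ) (b : Λ → Fin q → Rˣ)
    (hx : p ^ j • ∑ l, MilnorK.symbol (Fin.cons (oneE m (a l)) fun t => tau R ^ n l t * cst (b l t) :
      Fin (q + 1) → (LaurentSeries R)ˣ) ∈ UT R (p ^ j * m + 1) (q + 1)) :
    ∑ l, MvPowerSeries.coeff (diagExp (q + 1) 1) (mixedDet (H (a l) * (v : MvPowerSeries (Fin (q + 1)) P) ^ m) fun t =>
      v ^ n l t * Units.map (H : R →* MvPowerSeries (Fin (q + 1)) P) (b l t)) = 0 := by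
  obtain ⟨A, _, π, hs, hk, hn, ht⟩ := exists_wittQuotient P p j
  have h := isResidueData_diagCoeff (r := q + 1) (Fact.out : p.Prime) π hs hk j hn (m * p ^ j)
  have hS := (isSymbolMap_res h).comp_ringHom (laurentHom H v)
  have h1 : UT R (p ^ j * m + 1) (q + 1) ≤ hS.lift.ker := by
    rw [UT_eq_closure (by omega), AddSubgroup.closure_le]
    rintro z ⟨y, u, hu, hy, rfl⟩
    change hS.lift _ = 0
    rw [hS.lift_symbol]
    refine res_eq_zero_of_mem h (M' := p ^ j * m + 1) (by rw [mul_comm]; omega) _ ?_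
    beta_reduce
    rw [hy, laurentHom_serUnit, lead_serUnit, mem_oneUnits]
    have := serHom_dvd H v (mem_oneUnits.1 hu)
    rwa [map_sub, map_one] at this
  have h2 : hS.lift (p ^ j • _) = 0 := h1 hx
  rw [map_nsmul, nsmul_eq_mul, Nat.cast_pow] at h2
  have h3 := ht _ h2
  rw [map_sum, map_sum] at h3
  have h4 : ∀ l, π (hS.lift (MilnorK.symbol (Fin.cons (oneE m (a l)) fun t => tau R ^ n l t * cst (b l t) :
      Fin (q + 1) → (LaurentSeries R)ˣ))) = (-1) ^ (p ^ j - 1) *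
        MvPowerSeries.coeff (diagExp (q + 1) 1) (mixedDet (H (a l) * (v : MvPowerSeries (Fin (q + 1)) P) ^ m) fun t =>
      v ^ n l t * Units.map (H : R →* MvPowerSeries (Fin (q + 1)) P) (b l t)) ^ p ^ j := by
    intro l
    rw [hS.lift_symbol]
    refine map_res_cons h hm rfl hn _ _ _ ?_ fun t => ?_
    · beta_reduce
      rw [Fin.cons_zero, lead_laurentHom_oneE H v hm]
    · beta_reduce
      rw [Fin.cons_succ, lead_laurentHom_tau_zpow_mul_cst]
  have : ExpChar P p := ExpChar.prime Fact.out
  simp only [h4] at h3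
  rw [← Finset.mul_sum, ← sum_pow_char_pow] at h3
  have h5 := (mul_eq_zero.1 h3).resolve_left (pow_ne_zero _ (neg_ne_zero.2 one_ne_zero))
  exact (pow_eq_zero_iff (pow_pos (Fact.out : p.Prime).pos j).ne').1 h5

variable [CharP R p] {K : Type} [Field K] [Algebra R K] [IsFractionRing R K]

omit [IsDomain R] in
theorem constantCoeff_inv_mul_pderiv_zpow_mul {P : Type} [Field P] {r : ℕ} (v y : (MvPowerSeries (Fin r) P)ˣ) (n : ℤ) (s : Fin r) :
    (((v ^ n * y)⁻¹ : (MvPowerSeries (Fin r) P)ˣ) : MvPowerSeries (Fin r) P) *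
      MvPowerSeries.pderiv P s ((v ^ n * y : (MvPowerSeries (Fin r) P)ˣ) : MvPowerSeries (Fin r) P) =
    n * (((v⁻¹ : (MvPowerSeries (Fin r) P)ˣ) : MvPowerSeries (Fin r) P) * MvPowerSeries.pderiv P s v) +
      ((y⁻¹ : (MvPowerSeries (Fin r) P)ˣ) : MvPowerSeries (Fin r) P) * MvPowerSeries.pderiv P s y := by
  let e : (MvPowerSeries (Fin r) P)ˣ →* Multiplicative (MvPowerSeries (Fin r) P) :=
    MonoidHom.mk' (fun u => Multiplicative.ofAdd (((u⁻¹ : (MvPowerSeries (Fin r) P)ˣ) : MvPowerSeries (Fin r) P) *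
      MvPowerSeries.pderiv P s u)) fun x y => congrArg Multiplicative.ofAdd (dlog_mul (MvPowerSeries.pderiv P s) x y)
  have h1 : (e (v ^ n)).toAdd = n • (e v).toAdd := by rw [map_zpow]; rfl
  rw [dlog_mul]
  rw [zsmul_eq_mul] at h1
  congr 1

include p in
/-- The differential form attached to an element killed by a power of `p` in a graded piece. -/
theorem sum_det_eq_zero {m : ℕ} (hm : 1 ≤ m) (j : ℕ) {Λ : Type} [Fintype Λ] (a : Λ → R)
    (n : Λ → Fin q → ℤ) (b : Λ → Fin q → Rˣ)
    (hx : p ^ j • ∑ l, MilnorK.symbol (Fin.cons (oneE m (a l)) fun t => tau R ^ n l t * cst (b l t) :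
      Fin (q + 1) → (LaurentSeries R)ˣ) ∈ UT R (p ^ j * m + 1) (q + 1))
    (Δ : Fin (q + 1) → Derivation ℤ K K) (ε : Fin (q + 1) → ℤ) :
    ∑ l, (Matrix.of (Fin.cons (fun s => Δ s (algebraMap R K (a l)) + m * ε s * algebraMap R K (a l))
      fun t s => (algebraMap R K (b l t))⁻¹ * Δ s (algebraMap R K (b l t)) + n l t * ε s) :
        Matrix (Fin (q + 1)) (Fin (q + 1)) K).det = 0 := by
  have : CharP K p := charP_of_injective_ringHom (IsFractionRing.injective R K) p
  obtain ⟨H0, hH0⟩ := exists_testHom p Δ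
  set ι : K →+* PerfectClosure K p := PerfectClosure.of K p
  set H : R →+* MvPowerSeries (Fin (q + 1)) (PerfectClosure K p) :=
    ((MvPowerSeries.map ι).comp H0).comp (algebraMap R K) with hH
  have hHc : ∀ x, MvPowerSeries.constantCoeff (H x) = ι (algebraMap R K x) := fun x => by
    simp [hH, (hH0 _).1]
  have hHe : ∀ x s, MvPowerSeries.coeff (Finsupp.single s 1) (H x) = ι (Δ s (algebraMap R K x)) :=
    fun x s => by simp [hH, (hH0 _).2]
  set V : MvPowerSeries (Fin (q + 1)) (PerfectClosure K p) :=
    1 + ∑ s, MvPowerSeries.C (ε s : PerfectClosure K p) * MvPowerSeries.X s with hV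
  have hVc : MvPowerSeries.constantCoeff V = 1 := by simp [hV]
  have hVe : ∀ s, MvPowerSeries.coeff (Finsupp.single s 1) V = ε s := by
    intro s
    rw [hV, map_add, map_sum, Finset.sum_eq_single s]
    · rw [MvPowerSeries.coeff_C_mul, MvPowerSeries.coeff_X, if_pos rfl, mul_one,
        MvPowerSeries.coeff_one, if_neg (by simp), zero_add]
    · intro t _ hts
      rw [MvPowerSeries.coeff_C_mul, MvPowerSeries.coeff_X, if_neg, mul_zero]
      intro h
      exact hts ((Finsupp.single_left_inj one_ne_zero).1 h).symm
    · simp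
  have hVu : IsUnit V := by
    rw [MvPowerSeries.isUnit_iff_constantCoeff, hVc]
    exact isUnit_one
  obtain ⟨v, hv⟩ := hVu
  have hvc : MvPowerSeries.constantCoeff ((v⁻¹ : (MvPowerSeries (Fin (q + 1)) (PerfectClosure K p))ˣ) :
      MvPowerSeries (Fin (q + 1)) (PerfectClosure K p)) = 1 := by
    have := congrArg MvPowerSeries.constantCoeff v.inv_mul
    rwa [map_mul, hv, hVc, mul_one, map_one] at this
  have hpd : ∀ (f : MvPowerSeries (Fin (q + 1)) (PerfectClosure K p)) s,
      MvPowerSeries.coeff (Finsupp.single s 1) f =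
        MvPowerSeries.constantCoeff (MvPowerSeries.pderiv _ s f) := by
    intro f s
    rw [← MvPowerSeries.coeff_zero_eq_constantCoeff_apply, MvPowerSeries.coeff_pderiv]
    simp
  have key := sum_coeff_mixedDet_eq_zero H v hm j a n b hx
  apply (map_eq_zero_iff ι ι.injective).1
  rw [map_sum, ← key]
  refine Finset.sum_congr rfl fun l _ => ?_
  set y : Fin q → (MvPowerSeries (Fin (q + 1)) (PerfectClosure K p))ˣ := fun t =>
    v ^ n l t * Units.map (H : R →* MvPowerSeries (Fin (q + 1)) (PerfectClosure K p)) (b l t) with hy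
  have h1 : mixedDet (H (a l) * (v : MvPowerSeries (Fin (q + 1)) (PerfectClosure K p)) ^ m) y = (Matrix.of fun t s =>
      (Fin.cons 1 (fun t => ((y t)⁻¹ : (MvPowerSeries (Fin (q + 1)) (PerfectClosure K p))ˣ)) :
        Fin (q + 1) → MvPowerSeries (Fin (q + 1)) (PerfectClosure K p)) t * theta _ s
      ((Fin.cons (H (a l) * (v : MvPowerSeries (Fin (q + 1)) (PerfectClosure K p)) ^ m) (fun t => y t) : Fin (q + 1) → MvPowerSeries (Fin (q + 1)) (PerfectClosure K p)) t)).det := by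
    rw [mixedDet]
    congr 1
    ext1 t s
    refine Fin.cases ?_ (fun t => ?_) t
    · simp
    · simp
  rw [h1, coeff_diagExp_det_theta, RingHom.map_det]
  congr 1
  ext1 t s
  refine Fin.cases ?_ (fun t => ?_) t
  · simp only [RingHom.mapMatrix_apply, Matrix.map_apply, Matrix.of_apply, Fin.cons_zero, map_one, one_mul]
    rw [hpd, Derivation.leibniz, Derivation.leibniz_pow]
    simp only [smul_eq_mul, nsmul_eq_mul, map_add, map_mul, map_pow, map_natCast, map_intCast, hv, hVc,
      ← hpd, hHe, hHc, hVe, one_pow]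
    ring
  · simp only [RingHom.mapMatrix_apply, Matrix.map_apply, Matrix.of_apply, Fin.cons_succ]
    rw [hpd, ← map_mul, hy, constantCoeff_inv_mul_pderiv_zpow_mul]
    simp only [map_add, map_mul, map_intCast, hvc, ← hpd, hv, hVe, one_mul, map_inv₀]
    rw [Units.coe_map, MonoidHom.coe_coe, hHe, add_comm]
    congr 2
    have := congrArg MvPowerSeries.constantCoeff
      (Units.map (H : R →* MvPowerSeries (Fin (q + 1)) (PerfectClosure K p)) (b l t)).inv_mul
    rw [map_mul, Units.coe_map, MonoidHom.coe_coe, hHc, map_one] at this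
    exact (eq_inv_of_mul_eq_one_left this).symm

end Detect

end

section Main

theorem derivation_prod_eq {K ι : Type} [Field K] (D : Derivation ℤ K K) {f : ι → K} (hf : ∀ i, f i ≠ 0) (s : Finset ι) :
    D (∏ i ∈ s, f i) = ∑ i ∈ s, (∏ j ∈ s, f j) * ((f i)⁻¹ * D (f i)) := by
  induction s using Finset.induction_on with
  | empty => simp
  | insert a s ha ih =>
    rw [Finset.prod_insert ha, Derivation.leibniz, ih, Finset.sum_insert ha, smul_eq_mul, smul_eq_mul, Finset.mul_sum, add_comm]
    congr 1
    · field_simp [hf a]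
    · simp only [mul_assoc]

theorem det_dlog_cons {K : Type} [Field K] {q : ℕ} (Δ : Fin (q + 1) → Derivation ℤ K K) (c : K) (u : Fin q → K)
    (hu : ∀ t, u t ≠ 0) :
    (Matrix.of (Fin.cons (fun s => Δ s (c * ∏ t, u t)) fun t s => (u t)⁻¹ * Δ s (u t)) :
      Matrix (Fin (q + 1)) (Fin (q + 1)) K).det =
    (Matrix.of fun s t => Δ s ((Fin.cons c u : Fin (q + 1) → K) t)).det := by
  set M : Fin q → Fin (q + 1) → K := fun t s => (u t)⁻¹ * Δ s (u t) with hM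
  set A : Matrix (Fin (q + 1)) (Fin (q + 1)) K := Matrix.of (Fin.cons (fun s => Δ s c) M) with hA
  have h1 : (Matrix.of (Fin.cons (fun s => Δ s (c * ∏ t, u t)) M) : Matrix (Fin (q + 1)) (Fin (q + 1)) K) =
      A.updateRow 0 (∑ k, (Fin.cons (∏ t, u t) (fun _ => c * ∏ t, u t) : Fin (q + 1) → K) k • A k) := by
    ext1 k s
    refine Fin.cases ?_ (fun t => ?_) k
    · rw [Matrix.updateRow_self, Fin.sum_univ_succ]
      simp only [hA, hM, Matrix.of_apply, Fin.cons_zero, Fin.cons_succ, Pi.add_apply, Pi.smul_apply, Finset.sum_apply,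
        smul_eq_mul, Derivation.leibniz, Matrix.of_apply]
      rw [derivation_prod_eq (Δ s) hu, Finset.mul_sum, add_comm]
      simp only [mul_assoc]
    · rw [Matrix.updateRow_ne (Fin.succ_ne_zero t)]
      rfl
  rw [h1, Matrix.det_updateRow_sum]
  have h3 : A = Matrix.of fun k s => (Fin.cons 1 (fun t => (u t)⁻¹) : Fin (q + 1) → K) k *
      (fun k s => Δ s ((Fin.cons c u : Fin (q + 1) → K) k)) k s := by
    ext1 k s
    refine Fin.cases ?_ (fun t => ?_) k <;> simp [hA, hM]
  rw [h3, det_mul_rows, Fin.prod_univ_succ]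
  simp only [Fin.cons_zero, Fin.cons_succ, one_mul, smul_eq_mul, ← mul_assoc, ← Finset.prod_mul_distrib]
  rw [Finset.prod_eq_one fun t _ => mul_inv_cancel₀ (hu t), one_mul]
  exact Matrix.det_transpose _

variable {R : Type} [CommRing R] [IsDomain R] [IsLocalRing R] {p : ℕ} [Fact p.Prime] [CharP R p]

section Vanishing
variable (K : Type) [Field K] [Algebra R K] [IsFractionRing R K] (hL : LiftsModulo R p (⊥ : Ideal (frobenius R p).range))
  {G : Type} [AddCommGroup G] {m q : ℕ} (hm : 1 ≤ m)
  {Λ : Type} [Fintype Λ]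
include K hL hm

/-- A sum of constant symbols whose logarithmic differential form is closed comes from `p`-th powers. -/
theorem sum_cstSymbol_mem {S : (Fin (q + 1) → (LaurentSeries R)ˣ) → G} (h : IsGradedSymbolMap (m + 1) S) (hpm : p ∣ m)
    (a : Λ → R) (u : Λ → Fin q → Rˣ)
    (h0 : ∀ Δ : Fin (q + 1) → Derivation ℤ K K, ∑ l, (Matrix.of (Fin.cons (fun s => Δ s (algebraMap R K (a l)))
      fun t s => (algebraMap R K (u l t))⁻¹ * Δ s (algebraMap R K (u l t))) :
        Matrix (Fin (q + 1)) (Fin (q + 1)) K).det = 0) :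
    ∑ l, cstSymbol m S (a l) (u l) ∈ AddSubgroup.closure
      (Set.range fun x : R × (Fin q → Rˣ) => cstSymbol m S (x.1 ^ p) x.2) := by
  have ha : ∀ l, a l = a l * (∏ t, ((u l t)⁻¹ : Rˣ)) * ∏ t, (u l t : R) := fun l => by
    rw [mul_assoc, Units.coe_prod, ← Finset.prod_mul_distrib, Finset.prod_eq_one fun t _ => Units.inv_mul _, mul_one]
  have h1 := altDer_sum_mem K hL (isAltDer_rho (p := p) hm h)
    (rho_one_eq_zero hm h hpm)
    (fun l => Fin.cons (a l * (∏ t, ((u l t)⁻¹ : Rˣ))) fun t => (u l t : R)) (fun Δ => by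
      rw [← h0 Δ]
      refine Finset.sum_congr rfl fun l _ => ?_
      have h2 := det_dlog_cons Δ (algebraMap R K (a l * (∏ t, ((u l t)⁻¹ : Rˣ)))) (fun t => algebraMap R K (u l t))
        (fun t => ((u l t).isUnit.map (algebraMap R K)).ne_zero)
      rw [← map_prod, ← map_mul, ← ha] at h2
      rw [h2]
      congr 1
      ext1 s t
      refine Fin.cases ?_ (fun t => ?_) t <;> rfl)
  have h3 : ∀ l, cstSymbol m S (a l) (u l) = rho p hm h (a l * (∏ t, ((u l t)⁻¹ : Rˣ))) fun t => (u l t : R) :=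
    fun l => by rw [rho_unit, ← ha]
  simp only [h3]
  refine AddSubgroup.closure_mono ?_ h1
  rintro _ ⟨c, e, rfl⟩
  refine ⟨(c * ∏ t, (e t : R), e), ?_⟩
  rw [rho_unit, mul_assoc, ← Finset.prod_mul_distrib]
  simp only [mul_pow, ← Finset.prod_pow, ← pow_succ, Nat.sub_add_cancel (Fact.out : p.Prime).one_le]

/-- A sum of constant symbols with vanishing differential form is zero. -/
theorem sum_cstSymbol_eq_zero {S : (Fin (q + 1) → (LaurentSeries R)ˣ) → G} (h : IsGradedSymbolMap (m + 1) S)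
    (a : Λ → R) (u : Λ → Fin q → Rˣ)
    (h0 : ∀ Δ : Fin q → Derivation ℤ K K, ∑ l, algebraMap R K (a l) * (Matrix.of fun t s =>
      (algebraMap R K (u l t))⁻¹ * Δ s (algebraMap R K (u l t))).det = 0) :
    ∑ l, cstSymbol m S (a l) (u l) = 0 := by
  have ha : ∀ l, a l = a l * (∏ t, ((u l t)⁻¹ : Rˣ)) * ∏ t, (u l t : R) := fun l => by
    rw [mul_assoc, Units.coe_prod, ← Finset.prod_mul_distrib, Finset.prod_eq_one fun t _ => Units.inv_mul _, mul_one]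
  have h1 := altDer_sum_eq_zero K hL (isAltDer_rho (p := p) hm h)
    (fun l => a l * (∏ t, ((u l t)⁻¹ : Rˣ))) (fun l t => (u l t : R)) (fun Δ => by
      rw [← h0 Δ]
      refine Finset.sum_congr rfl fun l _ => ?_
      rw [det_mul_rows, map_mul, mul_assoc, Units.coe_prod, map_prod]
      congr 1
      congr 1
      · refine Finset.prod_congr rfl fun t _ => ?_
        rw [← mul_eq_one_iff_eq_inv₀ ((u l t).isUnit.map (algebraMap R K)).ne_zero, ← map_mul, Units.inv_mul, map_one]
      · exact (Matrix.det_transpose _).symm)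
  rw [← h1]
  exact Finset.sum_congr rfl fun l _ => by rw [rho_unit, ← ha]

end Vanishing

theorem det_column_zero {A : Type} [CommRing A] {k : ℕ} (N : Matrix (Fin (k + 1)) (Fin (k + 1)) A)
    (h : ∀ t : Fin k, N t.succ 0 = 0) : N.det = N 0 0 * (N.submatrix Fin.succ Fin.succ).det := by
  rw [Matrix.det_succ_column_zero, Fin.sum_univ_succ, Finset.sum_eq_zero fun t _ => by rw [h t]; ring]
  simp

theorem det_column_zero_last {A : Type} [CommRing A] {k : ℕ} (N : Matrix (Fin (k + 1)) (Fin (k + 1)) A)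
    (h : ∀ t : Fin k, N t.castSucc 0 = 0) :
    N.det = (-1) ^ k * N (Fin.last k) 0 * (N.submatrix Fin.castSucc Fin.succ).det := by
  rw [Matrix.det_succ_column_zero, Fin.sum_univ_castSucc, Finset.sum_eq_zero fun t _ => by rw [h t]; ring]
  simp

theorem det_tau_column {R K : Type} [CommRing R] [Field K] [Algebra R K] {m q : ℕ} (hm : (m : K) = 0) (a : R) (u : Fin q → Rˣ)
    (Δ : Fin (q + 1) → Derivation ℤ K K) :
    (Matrix.of (Fin.cons (fun s => (Fin.cons 0 Δ : Fin (q + 2) → Derivation ℤ K K) s (algebraMap R K a) +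
        m * ((Fin.cons 1 0 : Fin (q + 2) → ℤ) s : ℤ) * algebraMap R K a)
      fun t s => (algebraMap R K (Fin.snoc (α := fun _ => Rˣ) u 1 t : Rˣ))⁻¹ * (Fin.cons 0 Δ : Fin (q + 2) → Derivation ℤ K K) s
          (algebraMap R K (Fin.snoc (α := fun _ => Rˣ) u 1 t : Rˣ)) +
        (Fin.snoc (α := fun _ => ℤ) (fun _ => 0) 1 t : ℤ) * ((Fin.cons 1 0 : Fin (q + 2) → ℤ) s : ℤ)) :
        Matrix (Fin (q + 2)) (Fin (q + 2)) K).det =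
    (-1) ^ (q + 1) * (Matrix.of (Fin.cons (fun s => Δ s (algebraMap R K a))
      fun t s => (algebraMap R K (u t))⁻¹ * Δ s (algebraMap R K (u t))) : Matrix (Fin (q + 1)) (Fin (q + 1)) K).det := by
  rw [det_column_zero_last]
  · congr 1
    · rw [← Fin.succ_last]
      simp
    · congr 1
      ext t s
      refine Fin.cases ?_ (fun t => ?_) t <;> simp [hm]
  · refine Fin.cases ?_ fun t => ?_
    · simp [hm]
    · rw [← Fin.succ_castSucc]
      simp

omit [IsLocalRing R] in
theorem nsmul_pow_mem_UT {m : ℕ} (hm : 1 ≤ m) (q j : ℕ) {x} (hx : x ∈ UT R m (q + 1)) :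
    p ^ j • x ∈ UT R (p ^ j * m) (q + 1) := by
  induction j with
  | zero => simpa using hx
  | succ j ih =>
    rw [pow_succ', mul_smul, mul_assoc]
    exact nsmul_mem_UT (Nat.mul_pos (pow_pos (Fact.out : p.Prime).pos j) hm) q ih

omit [IsLocalRing R] in
theorem nsmul_mem_UT_of_mk_eq {m q j : ℕ} {x y : MilnorK (q + 1) (LaurentSeries R)}
    (hxy : QuotientAddGroup.mk' (UT R (m + 1) (q + 1)) x = QuotientAddGroup.mk' (UT R (m + 1) (q + 1)) y)
    (hx : p ^ j • x ∈ UT R (p ^ j * m + 1) (q + 1)) : p ^ j • y ∈ UT R (p ^ j * m + 1) (q + 1) := by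
  have hp : 1 ≤ p ^ j := Nat.one_le_pow _ _ (Fact.out : p.Prime).pos
  have h1 : -x + y ∈ UT R (m + 1) (q + 1) := QuotientAddGroup.eq.1 hxy
  have h2 := UT_anti (R := R) (m := p ^ j * m + 1) (by omega) (by rw [Nat.mul_succ]; omega) q
    (nsmul_pow_mem_UT (p := p) (m.succ_pos) q j h1)
  have h3 := add_mem hx h2
  rwa [← nsmul_add, add_neg_cancel_left] at h3

include p in
theorem mk_mem_values {m : ℕ} (hm : 1 ≤ m) {q : ℕ} {x : MilnorK (q + 1) (LaurentSeries R)} (hx : x ∈ UT R m (q + 1)) :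
    QuotientAddGroup.mk' (UT R (m + 1) (q + 1)) x ∈
      cstValues m (fun a => QuotientAddGroup.mk' (UT R (m + 1) (q + 1)) (MilnorK.symbol a)) ⊔
      tauValues m (fun a => QuotientAddGroup.mk' (UT R (m + 1) (q + 1)) (MilnorK.symbol a)) := by
  have h := isGradedSymbolMap_quotient (R := R) (m := m + 1) m.succ_pos (q + 1)
  rw [UT_eq_closure hm] at hx
  induction hx using AddSubgroup.closure_induction with
  | mem x hx =>
    obtain ⟨a, u, hu, ha, rfl⟩ := hx
    exact h.mem_values (p := p) hm a hu ha
  | zero => rw [map_zero]; exact zero_mem _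
  | add x y _ _ hx hy => rw [map_add]; exact add_mem hx hy
  | neg x _ hx => rw [map_neg]; exact neg_mem hx

section Descent
variable (hL : LiftsModulo R p (⊥ : Ideal (frobenius R p).range)) {m q j : ℕ} (hm : 1 ≤ m)
include hL hm

theorem mem_UT_succ_of_not_dvd (hpm : ¬ p ∣ m) {x : MilnorK (q + 1) (LaurentSeries R)} (hx : x ∈ UT R m (q + 1))
    (hpx : p ^ j • x ∈ UT R (p ^ j * m + 1) (q + 1)) : x ∈ UT R (m + 1) (q + 1) := by
  set S : (Fin (q + 1) → (LaurentSeries R)ˣ) → MilnorK (q + 1) (LaurentSeries R) ⧸ UT R (m + 1) (q + 1) :=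
    fun a => QuotientAddGroup.mk' (UT R (m + 1) (q + 1)) (MilnorK.symbol a) with hS
  have h : IsGradedSymbolMap (m + 1) S := isGradedSymbolMap_quotient m.succ_pos (q + 1)
  have h1 : QuotientAddGroup.mk' (UT R (m + 1) (q + 1)) x ∈ cstValues m S :=
    sup_le le_rfl (h.tauValues_le hm hpm) (mk_mem_values (p := p) hm hx)
  obtain ⟨N, a, u, hau⟩ := h.exists_sum_rho hm h1
  rw [← QuotientAddGroup.eq_zero_iff]
  refine hau.trans (sum_cstSymbol_eq_zero (p := p) (FractionRing R) hL hm h a u fun Δ => ?_)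
  have h2 : QuotientAddGroup.mk' (UT R (m + 1) (q + 1)) x = QuotientAddGroup.mk' (UT R (m + 1) (q + 1))
      (∑ l, MilnorK.symbol (Fin.cons (oneE m (a l)) fun t => tau R ^ (0 : ℤ) * cst (u l t))) := by
    rw [hau, map_sum]
    simp only [zpow_zero, one_mul]
    rfl
  have h3 := sum_det_eq_zero (K := FractionRing R) hm j a (fun _ _ => 0) u (nsmul_mem_UT_of_mk_eq h2 hpx)
    (Fin.cons 0 Δ) (Fin.cons 1 0)
  have hmK : (m : FractionRing R) ≠ 0 := by
    have : CharP (FractionRing R) p := charP_of_injective_ringHom (IsFractionRing.injective R (FractionRing R)) p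
    rwa [Ne, CharP.cast_eq_zero_iff _ p]
  refine (mul_eq_zero_iff_left hmK).1 ?_
  rw [← h3, Finset.mul_sum]
  refine Finset.sum_congr rfl fun l _ => ?_
  rw [det_column_zero _ (fun t => by simp)]
  rw [← mul_assoc]
  congr 1
  · simp
  · congr 1
    ext t s
    simp

/-- In degrees divisible by `p`, elements dying after multiplication by a power of `p` are multiples of `p`. -/
theorem exists_sub_nsmul_mem_UT {m' : ℕ} (hmm : m = p * m') {x : MilnorK (q + 1) (LaurentSeries R)}
    (hx : x ∈ UT R m (q + 1)) (hpx : p ^ j • x ∈ UT R (p ^ j * m + 1) (q + 1)) :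
    ∃ x' ∈ UT R m' (q + 1), x - p • x' ∈ UT R (m + 1) (q + 1) := by
  have hm' : 1 ≤ m' := Nat.one_le_iff_ne_zero.2 (by rintro rfl; omega)
  have hpm : p ∣ m := ⟨m', hmm⟩
  set K := FractionRing R with hK
  have hmK : (m : K) = 0 := by
    have : CharP K p := charP_of_injective_ringHom (IsFractionRing.injective R K) p
    rwa [CharP.cast_eq_zero_iff _ p]
  set π := QuotientAddGroup.mk' (UT R (m + 1) (q + 1)) with hπ
  set S : (Fin (q + 1) → (LaurentSeries R)ˣ) → MilnorK (q + 1) (LaurentSeries R) ⧸ UT R (m + 1) (q + 1) :=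
    fun a => π (MilnorK.symbol a) with hS
  have h : IsGradedSymbolMap (m + 1) S := isGradedSymbolMap_quotient m.succ_pos (q + 1)
  set P := (UT R m' (q + 1)).map (π.comp (nsmulAddMonoidHom p)) with hP
  suffices h1 : π x ∈ P by
    obtain ⟨x', hx', h2⟩ := h1
    refine ⟨x', hx', (QuotientAddGroup.eq_zero_iff _).1 ?_⟩
    exact (map_sub π _ _).trans (sub_eq_zero.2 h2.symm)
  have hpow : ∀ (d : R) (y : Fin q → (LaurentSeries R)ˣ), S (Fin.cons (oneE m (d ^ p)) y) ∈ P := fun d y => by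
    have h2 : oneE m (d ^ p) = oneE m' d ^ p := by
      have : CharP (PowerSeries R) p := charP_of_injective_ringHom PowerSeries.C_injective p
      have : ExpChar (PowerSeries R) p := ExpChar.prime Fact.out
      rw [oneE, oneE, ← map_pow]
      congr 1
      refine Units.ext ?_
      rw [Units.val_pow_eq_pow_val, oneAdd_val hm, oneAdd_val hm', add_pow_expChar, one_pow, mul_pow, ← pow_mul, map_pow,
        mul_comm m', hmm]
    have h3 := isSymbolMap_symbol.pow (Fin.cons 1 y) 0 (oneE m' d) p
    rw [Fin.update_cons_zero, Fin.update_cons_zero, ← h2] at h3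
    exact ⟨_, symbol_mem_UT hm' (Fin.cons (oneE m' d) y) 0 (oneAdd_mem hm' (PowerSeries.C d)) rfl, (congrArg π h3).symm⟩
  have hcl : AddSubgroup.closure (Set.range fun x : R × (Fin q → Rˣ) => cstSymbol m S (x.1 ^ p) x.2) ≤ P :=
    (AddSubgroup.closure_le _).2 (by rintro _ ⟨⟨d, e⟩, rfl⟩; exact hpow _ _)
  obtain ⟨y, hy, z, hz, hyz⟩ := AddSubgroup.mem_sup.1 (mk_mem_values (p := p) hm hx)
  obtain ⟨N, a, u, rfl⟩ := h.exists_sum_rho hm hy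
  rcases q with _ | q
  · have hz0 : z = 0 := by
      have h4 : tauValues m S = ⊥ := by
        refine AddSubgroup.closure_eq_bot_iff.2 ?_
        rintro _ ⟨⟨_, _, i⟩, _⟩
        exact i.elim0
      rwa [h4] at hz
    rw [hz0] at hyz
    replace hyz := (add_zero (∑ l, cstSymbol m S (a l) (u l))).symm.trans hyz
    rw [← hyz]
    refine hcl (sum_cstSymbol_mem (p := p) K hL hm h hpm a u fun Δ => ?_)
    have h2 : π x = π (∑ l, MilnorK.symbol (Fin.cons (oneE m (a l)) fun t => tau R ^ (0 : ℤ) * cst (u l t))) := by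
      rw [← hyz, map_sum]
      simp only [zpow_zero, one_mul]
      rfl
    have h3 := sum_det_eq_zero (K := K) hm j a (fun _ _ => 0) u (nsmul_mem_UT_of_mk_eq h2 hpx) Δ 0
    simpa using h3
  · set S' : (Fin (q + 1) → (LaurentSeries R)ˣ) → MilnorK (q + 2) (LaurentSeries R) ⧸ UT R (m + 1) (q + 2) :=
      fun a => S (Fin.snoc (α := fun _ => (LaurentSeries R)ˣ) a (tau R)) with hS'
    have h' : IsGradedSymbolMap (m + 1) S' := h.snoc (tau R)
    obtain ⟨N', a', u', rfl⟩ := h'.exists_sum_rho hm (h.tauValues_le_snoc (p := p) hm hz)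
    have h2 : π x = π (∑ l : Fin N ⊕ Fin N', MilnorK.symbol (Fin.cons (oneE m (Sum.elim a a' l)) fun t =>
        tau R ^ (Sum.elim (fun _ _ => (0 : ℤ)) (fun _ => Fin.snoc (α := fun _ => ℤ) (fun _ => 0) 1) l : Fin (q + 1) → ℤ) t *
          cst ((Sum.elim u (fun l => Fin.snoc (α := fun _ => Rˣ) (u' l) 1) l : Fin (q + 1) → Rˣ) t))) := by
      rw [← hyz, Fintype.sum_sum_type, map_add, map_sum, map_sum]
      congr 1
      · simp only [Sum.elim_inl, zpow_zero, one_mul]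
        rfl
      · refine Finset.sum_congr rfl fun l _ => ?_
        simp only [Sum.elim_inr, cstSymbol, hS', hS]
        rw [← Fin.cons_snoc_eq_snoc_cons]
        congr 3
        ext1 t
        refine Fin.lastCases ?_ (fun t => ?_) t <;> simp
    have h3 := sum_det_eq_zero (K := K) hm j _ _ _ (nsmul_mem_UT_of_mk_eq h2 hpx)
    rw [← hyz]
    refine add_mem (hcl (sum_cstSymbol_mem (p := p) K hL hm h hpm a u fun Δ => ?_))
      ((AddSubgroup.closure_le _).2 ?_ (sum_cstSymbol_mem (p := p) K hL hm h' hpm a' u' fun Δ => ?_))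
    · have h4 := h3 Δ 0
      rw [Fintype.sum_sum_type, Finset.sum_eq_zero (s := (Finset.univ : Finset (Fin N'))) fun l _ =>
        Matrix.det_eq_zero_of_row_eq_zero (Fin.last (q + 1)) fun s => ?_, add_zero] at h4
      · simpa using h4
      · rw [← Fin.succ_last]
        simp
    · rintro _ ⟨⟨d, e⟩, rfl⟩
      simp only [cstSymbol, hS']
      rw [← Fin.cons_snoc_eq_snoc_cons]
      exact hpow _ _
    · have h4 := h3 (Fin.cons 0 Δ) (Fin.cons 1 0)
      rw [Fintype.sum_sum_type, Finset.sum_eq_zero (s := (Finset.univ : Finset (Fin N))) fun l _ =>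
        Matrix.det_eq_zero_of_column_eq_zero 0 fun t => ?_, zero_add] at h4
      · refine (mul_eq_zero_iff_left (pow_ne_zero (q + 1) (neg_ne_zero.2 (one_ne_zero (α := K))))).1 ?_
        rw [← h4, Finset.mul_sum]
        exact Finset.sum_congr rfl fun l _ => (det_tau_column hmK (a' l) (u' l) Δ).symm
      · refine Fin.cases ?_ (fun t => ?_) t <;> simp [hmK]

omit hm in
/-- Multiplication by powers of `p` is injective on the graded pieces. -/
theorem mem_UT_succ_of_nsmul_pow_mem : ∀ (m : ℕ) (_ : 1 ≤ m) (j : ℕ) {x : MilnorK (q + 1) (LaurentSeries R)}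
    (_ : x ∈ UT R m (q + 1)) (_ : p ^ j • x ∈ UT R (p ^ j * m + 1) (q + 1)), x ∈ UT R (m + 1) (q + 1) := by
  intro m
  induction m using Nat.strong_induction_on with
  | _ m ih =>
    intro hm j x hx hpx
    by_cases hpm : p ∣ m
    · obtain ⟨m', rfl⟩ := hpm
      have hp : 2 ≤ p := (Fact.out : p.Prime).two_le
      have hm' : 1 ≤ m' := Nat.one_le_iff_ne_zero.2 (by rintro rfl; omega)
      obtain ⟨x', hx', h1⟩ := exists_sub_nsmul_mem_UT hL hm rfl hx hpx
      have h2 := nsmul_mem_UT_of_mk_eq (p := p) (j := j) (y := p • x')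
        (QuotientAddGroup.eq_iff_sub_mem.2 h1) hpx
      rw [← mul_smul, ← pow_succ, ← mul_assoc, ← pow_succ] at h2
      have h3 := nsmul_mem_UT (p := p) (m'.succ_pos) q (ih m' (by nlinarith) hm' (j + 1) hx' h2)
      have h4 := UT_anti (R := R) (m := p * m' + 1) (by omega) (by rw [Nat.mul_succ]; omega) q h3
      have h5 := add_mem h1 h4
      rwa [sub_add_cancel] at h5
    · exact mem_UT_succ_of_not_dvd hL hm hpm hx hpx

end Descent

end Main

theorem mult_p_graded_milnorK_injective
    (p : ℕ) (hp : p.Prime)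
    -- `R` a regular local `𝔽_p`-algebra
    (R : Type) [CommRing R] [IsLocalRing R] [IsNoetherianRing R] [CharP R p]
    (hreg : ∃ (n : ℕ) (t : Fin n → R),
      Ideal.span (Set.range t) = IsLocalRing.maximalIdeal R ∧ ringKrullDim R = n)
    (r m : ℕ) (hr : 1 ≤ r) (hm : 1 ≤ m) :
    -- multiplication by `p` carries `U^m` into `U^{pm}` …
    (∀ x ∈ UT R m r, p • x ∈ UT R (p * m) r) ∧
    -- … and the induced map `U^m/U^{m+1} → U^{pm}/U^{pm+1}` is injective
    (∀ x ∈ UT R m r, p • x ∈ UT R (p * m + 1) r → x ∈ UT R (m + 1) r) := by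
  have : Fact p.Prime := ⟨hp⟩
  obtain ⟨n, t, ht, hd⟩ := hreg
  have : IsDomain R := isDomain_of_regular n R t ht hd
  obtain ⟨q, rfl⟩ : ∃ q, r = q + 1 := ⟨r - 1, by omega⟩
  refine ⟨fun x hx => nsmul_mem_UT hm q hx, fun x hx hpx => ?_⟩
  exact mem_UT_succ_of_nsmul_pow_mem
    (liftsModulo_of_flat (flatMod_frobenius_of_regular p n R t ht hd) ⊥) m hm 1 hx (by simpa using hpx)

end RuellingSaito
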